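/- (1-d global existence for γ = 2, the shallow water case.) There exist ε₀ > 0 and C ≥ 1 such that for every 0 < ε ≤ ε₀ and every u₀ ∈ C^∞([−1,1]) with Σ_{b=0}^{5} ∫_{−1}^{1} d(x)^{1+b} |∂_x^b u₀(x)|² dx < ε, there exists a global-in-time solution (η, v) of the 1-d γ = 2 perturbation system on Ω₀ × [0,∞) with initial data η(x,0) = x, v(x,0) = u₀(x), satisfying E₂(t) ≤ C·ε for all t ≥ 0. In particular the perturbed velocity decays: ‖v(·,t)‖_{W^{1,∞}} ≤ (C·ε)^{1/2} α(t)^{−3/2} for all t ≥ 0. -/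

import Mathlib

open Set MeasureTheory Filter

noncomputable section

/-- The spatial domain `Ω₀ = (−1, 1)`. -/
def Ω₀ : Set ℝ := Ioo (-1) 1

/-- The weight `d(x) = (1/4)(1 − x²)` used for `γ = 2`. -/
def dd (x : ℝ) : ℝ := (1 - x ^ 2) / 4

/-- Squared integer Sobolev norm `‖f‖_{H^n(Ω₀)}²`. -/
def HSq (n : ℕ) (f : ℝ → ℝ) : ℝ :=
  ∑ j ∈ Finset.range (n + 1), ∫ x in Ω₀, (iteratedDeriv j f x) ^ 2

/-- Squared `W^{1,∞}(Ω₀)` norm. -/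
def W1InfSq (f : ℝ → ℝ) : ℝ :=
  (sSup ((fun x => |f x|) '' Ω₀)) ^ 2 + (sSup ((fun x => |deriv f x|) '' Ω₀)) ^ 2

/-- The higher-order energy `e₂(t)` for `γ = 2` in 1-d. -/
def e2 (α : ℝ → ℝ) (η v : ℝ → ℝ → ℝ) (t : ℝ) : ℝ :=
  (∫ x in Ω₀, dd x ^ 7 * (iteratedDeriv 6 (fun y => η y t - y) x) ^ 2) +
    ∑ b ∈ Finset.range 6,
      ((α t ^ 3 * ∫ x in Ω₀, dd x ^ (1 + b) * (iteratedDeriv b (fun y => v y t) x) ^ 2) +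
        ∫ x in Ω₀, dd x ^ (1 + b) * (iteratedDeriv b (fun y => η y t - y) x) ^ 2)

/-- The norm `E₂(t)` for `γ = 2` in 1-d. -/
def E2 (α : ℝ → ℝ) (η v : ℝ → ℝ → ℝ) (t : ℝ) : ℝ :=
  e2 α η v t + α t ^ 3 * W1InfSq (fun y => v y t) + W1InfSq (fun y => η y t - y) +
    ∑ b ∈ Finset.range 4,
      (α t ^ 3 * HSq (2 + b) (fun y => dd y ^ b * v y t) +
        HSq (2 + b) (fun y => dd y ^ b * (η y t - y)))

/-- `(η, v)` is a (sufficiently smooth, globally defined) solution of the 1-d `γ = 2`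
perturbation system: `∂_t η = v`, `∂_x η > 0`, and
`α³ ∂_t v + 2α²α' v + η + 2 d' (∂_x η)^{−2} − 2 d (∂_x η)^{−3} ∂_x² η = 0`. -/
def IsSol2 (α α' : ℝ → ℝ) (η v : ℝ → ℝ → ℝ) : Prop :=
  (∀ t ∈ Ici (0 : ℝ), ContDiffOn ℝ 2 (fun y => η y t) Ω₀) ∧
  (∀ x ∈ Ω₀, ∀ t ∈ Ici (0 : ℝ), 0 < deriv (fun y => η y t) x) ∧
  (∀ x ∈ Ω₀, ∀ t ∈ Ici (0 : ℝ), HasDerivWithinAt (fun s => η x s) (v x t) (Ici 0) t) ∧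
  (∀ x ∈ Ω₀, ∀ t > (0 : ℝ), DifferentiableAt ℝ (fun s => v x s) t) ∧
  (∀ x ∈ Ω₀, ∀ t > (0 : ℝ),
    α t ^ 3 * deriv (fun s => v x s) t + 2 * α t ^ 2 * α' t * v x t + η x t
      + 2 * deriv dd x * ((deriv (fun y => η y t) x) ^ 2)⁻¹
      - 2 * dd x * ((deriv (fun y => η y t) x) ^ 3)⁻¹ *
          iteratedDeriv 2 (fun y => η y t) x = 0)

namespace Shallow

open Polynomial
open scoped Topology

/-- The weight `d` as a polynomial. -/
def dPol : ℝ[X] := C (1 / 4) * (1 - X ^ 2)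

lemma eval_dPol (x : ℝ) : dPol.eval x = dd x := by
  simp [dPol, dd]; ring

lemma derivative_dPol : derivative dPol = C (-1 / 2) * X := by
  have : (C (-1 / 2) : ℝ[X]) = C (1 / 4) * (-C 2) := by
    rw [← C_neg, ← C_mul]; norm_num
  rw [this]
  simp only [dPol, derivative_mul, derivative_C, derivative_sub, derivative_one, derivative_X_pow]
  simp
  ring

lemma dd_nonneg {x : ℝ} (hx : x ∈ Icc (-1 : ℝ) 1) : 0 ≤ dd x := by
  have := hx.1; have := hx.2
  unfold dd; nlinarith

lemma dd_le {x : ℝ} : dd x ≤ 1 / 4 := by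
  unfold dd; nlinarith [sq_nonneg x]

lemma dd_pos {x : ℝ} (hx : x ∈ Ω₀) : 0 < dd x := by
  have := hx.1; have := hx.2
  unfold dd; nlinarith

@[fun_prop]
lemma continuous_polynomial_eval (p : ℝ[X]) : Continuous fun x => p.eval x := p.continuous

@[fun_prop]
lemma continuous_dd : Continuous dd := by
  unfold dd; fun_prop

lemma hasDerivAt_dd (x : ℝ) : HasDerivAt dd (-x / 2) x := by
  have := dPol.hasDerivAt x
  rw [derivative_dPol] at this
  simp only [eval_mul, eval_C, eval_X] at this
  have h : (fun y => dPol.eval y) = dd := funext eval_dPol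
  rw [h] at this
  rwa [show -x / 2 = -1 / 2 * x by ring]

/-- The weighted square integral `∫ d^l p²` over `[-1, 1]`. -/
def J (l : ℕ) (p : ℝ[X]) : ℝ := ∫ x in (-1 : ℝ)..1, dd x ^ l * (p.eval x) ^ 2

lemma neg_one_le_one' : (-1 : ℝ) ≤ 1 := by norm_num

lemma uIcc_eq : uIcc (-1 : ℝ) 1 = Icc (-1) 1 := uIcc_of_le neg_one_le_one'

lemma integral_derivative (q : ℝ[X]) :
    ∫ x in (-1 : ℝ)..1, (derivative q).eval x = q.eval 1 - q.eval (-1) :=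
  intervalIntegral.integral_eq_sub_of_hasDerivAt (fun x _ => q.hasDerivAt x)
    ((derivative q).continuous.intervalIntegrable _ _)

/-- Integration of a pointwise inequality modulo an exact derivative vanishing at the ends. -/
lemma integral_mono_mod {f g : ℝ → ℝ} (hf : Continuous f) (hg : Continuous g) (q : ℝ[X])
    (h1 : q.eval 1 = q.eval (-1))
    (h : ∀ x ∈ Icc (-1 : ℝ) 1, f x ≤ g x + (derivative q).eval x) :
    ∫ x in (-1 : ℝ)..1, f x ≤ ∫ x in (-1 : ℝ)..1, g x := by
  have h2 : ∫ x in (-1 : ℝ)..1, g x = ∫ x in (-1 : ℝ)..1, (g x + (derivative q).eval x) := by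
    rw [intervalIntegral.integral_add (hg.intervalIntegrable _ _)
      ((derivative q).continuous.intervalIntegrable _ _), integral_derivative, h1]
    ring
  rw [h2]
  exact intervalIntegral.integral_mono_on neg_one_le_one' (hf.intervalIntegrable _ _)
    ((hg.add (derivative q).continuous).intervalIntegrable _ _) h

lemma continuous_wt (l : ℕ) (p : ℝ[X]) : Continuous fun x => dd x ^ l * (p.eval x) ^ 2 :=
  (continuous_dd.pow l).mul (p.continuous.pow 2)

lemma J_nonneg (l : ℕ) (p : ℝ[X]) : 0 ≤ J l p := by
  apply intervalIntegral.integral_nonneg neg_one_le_one'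
  intro x hx
  have := dd_nonneg hx
  positivity

lemma J_anti {l m : ℕ} (h : l ≤ m) (p : ℝ[X]) : J m p ≤ J l p := by
  apply intervalIntegral.integral_mono_on neg_one_le_one'
    ((continuous_wt _ _).intervalIntegrable _ _) ((continuous_wt _ _).intervalIntegrable _ _)
  intro x hx
  have h0 := dd_nonneg hx
  have h1 : dd x ≤ 1 := dd_le.trans (by norm_num)
  have := pow_le_pow_of_le_one h0 h1 h
  gcongr

lemma eval_one_dPol : dPol.eval 1 = 0 := by simp [dPol]
lemma eval_neg_one_dPol : dPol.eval (-1) = 0 := by simp [dPol]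

/-- Hardy's inequality with polynomial weights. -/
lemma hardy (l : ℕ) (p : ℝ[X]) :
    J l p ≤ 32 * (2 * l + 3) ^ 2 * (J (l + 2) p + J (l + 2) (derivative p)) := by
  have key : J l p ≤ ∫ x in (-1 : ℝ)..1, (8 * (2 * l + 3) ^ 2 * (dd x ^ (l + 2) * (p.eval x) ^ 2)
      + 32 * (dd x ^ (l + 2) * ((derivative p).eval x) ^ 2)) := by
    refine integral_mono_mod (by fun_prop) (by fun_prop) (-4 * (X * dPol ^ (l + 1) * p ^ 2)) ?_ ?_
    · simp [eval_one_dPol, eval_neg_one_dPol]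
    intro x hx
    have h0 := dd_nonneg hx
    have hl : (0 : ℝ) ≤ l := by positivity
    have hx2 : x ^ 2 = 1 - 4 * dd x := by unfold dd; ring
    have hd : (derivative (-4 * (X * dPol ^ (l + 1) * p ^ 2))).eval x =
        -4 * (-(l + 1) / 2 * x ^ 2 * dd x ^ l * (p.eval x) ^ 2 + dd x ^ (l + 1) * (p.eval x) ^ 2
          + 2 * x * dd x ^ (l + 1) * (p.eval x) * (derivative p).eval x) := by
      have h4 : (-4 : ℝ[X]) = C (-4) := by rw [C_neg]; rfl
      rw [h4]
      simp only [derivative_mul, derivative_X, derivative_pow, derivative_dPol, eval_mul, eval_add,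
        eval_pow, eval_X, eval_C, eval_dPol, derivative_C, eval_one, eval_zero]
      simp
      ring
    rw [hd, hx2]
    set D := dd x
    set a := p.eval x
    set b := (derivative p).eval x
    have hDl : 0 ≤ D ^ l := by positivity
    have e1 : D ^ (l + 1) = D ^ l * D := by ring
    have e2 : D ^ (l + 2) = D ^ l * D ^ 2 := by ring
    rw [e1, e2]
    have hxx : x ^ 2 ≤ 1 := by nlinarith [hx.1, hx.2]
    have : 0 ≤ D ^ l * ((8 * (2 * l + 3) ^ 2) * D ^ 2 * a ^ 2 + 32 * D ^ 2 * b ^ 2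
        + 2 * (l + 1) * (1 - 4 * D) * a ^ 2 - 4 * D * a ^ 2 - 8 * x * D * a * b - a ^ 2) := by
      apply mul_nonneg hDl
      have h3 : 8 * x * D * a * b ≤ 1 / 2 * a ^ 2 + 32 * D ^ 2 * b ^ 2 := by
        have : (8 * (D * b)) * (x * a) ≤ 32 * (D * b) ^ 2 + 1 / 2 * (x * a) ^ 2 := by
          nlinarith [sq_nonneg (8 * (D * b) - x * a)]
        nlinarith [mul_le_mul_of_nonneg_right hxx (sq_nonneg a)]
      have h4 : 4 * (2 * l + 3) * D * a ^ 2 ≤ 8 * (2 * l + 3) ^ 2 * D ^ 2 * a ^ 2 + 1 / 2 * a ^ 2 := by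
        nlinarith [sq_nonneg ((4 * (2 * l + 3) * D - 1) * a)]
      nlinarith [mul_nonneg hl (sq_nonneg a)]
    nlinarith
  rw [intervalIntegral.integral_add (((continuous_wt _ _).const_mul _).intervalIntegrable _ _)
    (((continuous_wt _ _).const_mul _).intervalIntegrable _ _),
    intervalIntegral.integral_const_mul, intervalIntegral.integral_const_mul] at key
  change J l p ≤ 8 * (2 * l + 3) ^ 2 * J (l + 2) p + 32 * J (l + 2) (derivative p) at key
  have h1 := J_nonneg (l + 2) p
  have h2 := J_nonneg (l + 2) (derivative p)
  have hl : (0 : ℝ) ≤ l := by positivity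
  have h3 : (1 : ℝ) ≤ (2 * l + 3) ^ 2 := by nlinarith
  nlinarith [mul_nonneg (sub_nonneg.2 h3) h2, mul_nonneg (sub_nonneg.2 h3) h1]

/-- Interpolation between consecutive weighted norms. -/
lemma J_interp (m : ℕ) (g : ℝ[X]) {lam : ℝ} (hlam : 0 < lam) :
    2 * J (m + 1) (derivative g) ≤ lam * J m g + lam⁻¹ *
      (J (m + 2) (derivative (derivative g)) + (m + 1) / 2 * J (m + 1) (derivative g)) := by
  have key : ∫ x in (-1 : ℝ)..1, 2 * (dd x ^ (m + 1) * ((derivative g).eval x) ^ 2) ≤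
      ∫ x in (-1 : ℝ)..1, (lam * (dd x ^ m * (g.eval x) ^ 2) + lam⁻¹ *
      (dd x ^ (m + 2) * ((derivative (derivative g)).eval x) ^ 2 + (m + 1) / 2 *
        (dd x ^ (m + 1) * ((derivative g).eval x) ^ 2))) := by
    set g1 := derivative g with hg1
    set g2 := derivative g1 with hg2
    set Lg : ℝ[X] := dPol * g2 + C (((m : ℝ) + 1) * (-1 / 2)) * X * g1 with hLg
    refine integral_mono_mod (by fun_prop) (by fun_prop) (C 2 * (dPol ^ (m + 1) * g * g1) +
      C lam⁻¹ * (dPol ^ (m + 1) * g1 * Lg - dPol ^ (m + 2) * g1 * g2)) ?_ ?_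
    · simp [eval_one_dPol, eval_neg_one_dPol]
    intro x hx
    have h0 := dd_nonneg hx
    simp only [derivative_mul, derivative_X, derivative_pow, derivative_dPol, eval_mul, eval_add,
        eval_pow, eval_X, eval_C, eval_dPol, derivative_C, eval_one, eval_zero,
        derivative_add, derivative_sub, eval_sub, ← hg1, ← hg2, hLg]
    simp only [Nat.cast_add, Nat.cast_one, Nat.add_sub_cancel, Nat.cast_ofNat]
    set D := dd x
    set a := g.eval x
    set b := g1.eval x
    set c := g2.eval x
    set e := (derivative g2).eval x
    have hDl : 0 ≤ D ^ m := by positivity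
    have e1 : D ^ (m + 1) = D ^ m * D := by ring
    have e2 : D ^ (m + 2) = D ^ m * D ^ 2 := by ring
    have e3 : D ^ (m + 2 - 1) = D ^ m * D := by rw [show m + 2 - 1 = m + 1 by omega]; ring
    rw [e1, e2, e3]
    have hl : lam * lam⁻¹ = 1 := mul_inv_cancel₀ hlam.ne'
    have hl0 : 0 < lam⁻¹ := inv_pos.2 hlam
    have hsq : 0 ≤ D ^ m * (lam⁻¹ * (lam * a + (D * c - (m + 1) / 2 * x * b)) ^ 2) := by positivity
    have hexp : lam⁻¹ * (lam * a + (D * c - (m + 1) / 2 * x * b)) ^ 2 =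
      (lam * lam⁻¹) * (lam * a ^ 2) + 2 * (lam * lam⁻¹) * a * (D * c - (m + 1) / 2 * x * b) +
        lam⁻¹ * (D * c - (m + 1) / 2 * x * b) ^ 2 := by ring
    rw [hexp, hl] at hsq
    rw [← sub_nonneg]
    refine hsq.trans (le_of_eq ?_)
    ring
  have c1 : IntervalIntegrable (fun x => lam * (dd x ^ m * (g.eval x) ^ 2)) volume (-1) 1 :=
    ((continuous_wt _ _).const_mul _).intervalIntegrable _ _
  have c2 : IntervalIntegrable (fun x => dd x ^ (m + 2) * ((derivative (derivative g)).eval x) ^ 2)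
    volume (-1) 1 := (continuous_wt _ _).intervalIntegrable _ _
  have c3 : IntervalIntegrable (fun x => ((m : ℝ) + 1) / 2 *
      (dd x ^ (m + 1) * ((derivative g).eval x) ^ 2)) volume (-1) 1 :=
    ((continuous_wt _ _).const_mul _).intervalIntegrable _ _
  rw [intervalIntegral.integral_const_mul, intervalIntegral.integral_add c1 ((c2.add c3).const_mul _),
    intervalIntegral.integral_const_mul, intervalIntegral.integral_const_mul,
    intervalIntegral.integral_add c2 c3, intervalIntegral.integral_const_mul] at key
  exact key

/-- The low-order energy norm `∫ d p² + ∫ d⁶ (p⁽⁵⁾)²`. -/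
def N5 (p : ℝ[X]) : ℝ := J 1 p + J 6 (derivative^[5] p)

/-- The energy norm with the sixth derivative added. -/
def N6 (p : ℝ[X]) : ℝ := N5 p + J 7 (derivative^[6] p)

lemma N5_nonneg (p : ℝ[X]) : 0 ≤ N5 p := add_nonneg (J_nonneg _ _) (J_nonneg _ _)

lemma N5_le_N6 (p : ℝ[X]) : N5 p ≤ N6 p := le_add_of_nonneg_right (J_nonneg _ _)

lemma N6_nonneg (p : ℝ[X]) : 0 ≤ N6 p := (N5_nonneg p).trans (N5_le_N6 p)

lemma derivative_iter (k : ℕ) (p : ℝ[X]) :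
    derivative (derivative^[k] p) = derivative^[k + 1] p :=
  (Function.iterate_succ_apply' _ _ _).symm

lemma chain_step (k : ℕ) : ∀ δ : ℝ, 0 < δ → ∃ C ≥ (0 : ℝ), ∀ p : ℝ[X],
    J (k + 1) (derivative^[k] p) ≤ δ * J (k + 2) (derivative^[k + 1] p) + C * J 1 p := by
  induction k with
  | zero =>
    intro δ hδ
    refine ⟨1, zero_le_one, fun p => ?_⟩
    have := J_nonneg 2 (derivative^[1] p)
    simp only [zero_add, Function.iterate_zero, id_eq, one_mul]
    nlinarith
  | succ k ih =>
    intro δ hδ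
    set lam : ℝ := (k + 2) / 2 + 2 / δ with hlam
    have h1 : 0 < lam := by positivity
    obtain ⟨C, hC, h⟩ := ih (1 / (2 * lam)) (by positivity)
    refine ⟨2 * lam * C, by positivity, fun p => ?_⟩
    have h2 := J_interp (k + 1) (derivative^[k] p) h1
    rw [derivative_iter, derivative_iter] at h2
    have h3 := h p
    have hk : ((k + 1 : ℕ) : ℝ) = k + 1 := by push_cast; ring
    rw [hk] at h2
    have e1 : k + 1 + 1 = k + 2 := rfl
    have e2 : k + 1 + 2 = k + 3 := rfl
    rw [e1, e2] at h2 ⊢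
    set b0 := J 1 p
    set b1 := J (k + 1) (derivative^[k] p)
    set b2 := J (k + 2) (derivative^[k + 1] p) with hb2
    set b3 := J (k + 3) (derivative^[k + 2] p) with hb3
    have hb2' : 0 ≤ b2 := J_nonneg _ _
    have hb3' : 0 ≤ b3 := J_nonneg _ _
    have h4 : lam⁻¹ * ((k + 1 + 1) / 2 * b2) ≤ b2 := by
      rw [inv_mul_le_iff₀ h1]
      have : 0 ≤ 2 / δ * b2 := by positivity
      rw [hlam]; nlinarith
    have h5 : lam⁻¹ * b3 ≤ δ / 2 * b3 := by
      apply mul_le_mul_of_nonneg_right _ hb3'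
      rw [inv_le_comm₀ h1 (by positivity), inv_div, hlam]
      have : (0 : ℝ) ≤ (k + 2) / 2 := by positivity
      linarith
    have h6 : lam * b1 ≤ b2 / 2 + lam * C * b0 := by
      have := mul_le_mul_of_nonneg_left h3 h1.le
      have e : lam * (1 / (2 * lam) * b2 + C * b0) = b2 / 2 + lam * C * b0 := by
        field_simp
      linarith
    rw [mul_add] at h2
    nlinarith

lemma chain : ∃ C ≥ (1 : ℝ), ∀ p : ℝ[X], ∀ k ≤ 5,
    J (k + 1) (derivative^[k] p) ≤ C * N5 p := by
  have h := fun k => chain_step k 1 one_pos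
  choose C hC h using h
  refine ⟨1 + C 0 + C 1 + C 2 + C 3 + C 4, ?_, fun p k hk => ?_⟩
  · have := hC 0; have := hC 1; have := hC 2; have := hC 3; have := hC 4
    linarith
  have h0 := h 0 p
  have h1 := h 1 p
  have h2 := h 2 p
  have h3 := h 3 p
  have h4 := h 4 p
  have n5 : 0 ≤ J 6 (derivative^[5] p) := J_nonneg _ _
  have n0 : 0 ≤ J 1 p := J_nonneg _ _
  have m0 := mul_nonneg (hC 0) n0
  have m1 := mul_nonneg (hC 1) n0
  have m2 := mul_nonneg (hC 2) n0
  have m3 := mul_nonneg (hC 3) n0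
  have m4 := mul_nonneg (hC 4) n0
  have k0 := mul_nonneg (hC 0) n5
  have k1 := mul_nonneg (hC 1) n5
  have k2 := mul_nonneg (hC 2) n5
  have k3 := mul_nonneg (hC 3) n5
  have k4 := mul_nonneg (hC 4) n5
  unfold N5
  simp only [zero_add, Nat.reduceAdd] at h0 h1 h2 h3 h4
  interval_cases k <;> simp only [zero_add, Nat.reduceAdd, Function.iterate_zero, id_eq] at * <;>
    nlinarith

/-- Oscillation bound by the integral of a majorant of the derivative. -/
lemma abs_eval_sub_le (q : ℝ[X]) {h : ℝ → ℝ} (hh : Continuous h)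
    (hb : ∀ x ∈ Icc (-1 : ℝ) 1, |(derivative q).eval x| ≤ h x)
    {x y : ℝ} (hx : x ∈ Icc (-1 : ℝ) 1) (hy : y ∈ Icc (-1 : ℝ) 1) :
    |q.eval x - q.eval y| ≤ ∫ z in (-1 : ℝ)..1, h z := by
  wlog hxy : y ≤ x generalizing x y
  · rw [abs_sub_comm]; exact this hy hx (le_of_not_ge hxy)
  have e : ∫ z in y..x, (derivative q).eval z = q.eval x - q.eval y :=
    intervalIntegral.integral_eq_sub_of_hasDerivAt (fun x _ => q.hasDerivAt x)
      ((derivative q).continuous.intervalIntegrable _ _)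
  rw [← e]
  have h0 : ∀ z ∈ Icc (-1 : ℝ) 1, 0 ≤ h z := fun z hz => (abs_nonneg _).trans (hb z hz)
  calc |∫ z in y..x, (derivative q).eval z| ≤ ∫ z in y..x, |(derivative q).eval z| :=
        intervalIntegral.abs_integral_le_integral_abs hxy
    _ ≤ ∫ z in y..x, h z := by
        apply intervalIntegral.integral_mono_on hxy
          ((derivative q).continuous.abs.intervalIntegrable _ _) (hh.intervalIntegrable _ _)
        intro z hz
        exact hb z ⟨hy.1.trans hz.1, hz.2.trans hx.2⟩
    _ ≤ ∫ z in (-1 : ℝ)..1, h z := by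
        apply intervalIntegral.integral_mono_interval hy.1 hxy hx.2 _ (hh.intervalIntegrable _ _)
        rw [Filter.EventuallyLE, ae_restrict_iff' measurableSet_Ioc]
        exact Eventually.of_forall fun z hz => h0 z ⟨hz.1.le, hz.2⟩

lemma integral_J_comb (a b : ℝ) (l m : ℕ) (p q : ℝ[X]) :
    ∫ x in (-1 : ℝ)..1, (a * (dd x ^ l * (p.eval x) ^ 2) + b * (dd x ^ m * (q.eval x) ^ 2)) =
      a * J l p + b * J m q := by
  rw [intervalIntegral.integral_add (((continuous_wt _ _).const_mul _).intervalIntegrable _ _)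
    (((continuous_wt _ _).const_mul _).intervalIntegrable _ _),
    intervalIntegral.integral_const_mul, intervalIntegral.integral_const_mul]
  rfl

/-- Weighted sup bound. -/
lemma sup_wt (l : ℕ) (p : ℝ[X]) {x : ℝ} (hx : x ∈ Icc (-1 : ℝ) 1) :
    dd x ^ (l + 1) * (p.eval x) ^ 2 ≤ (l + 2) * (J l p + J (l + 2) (derivative p)) := by
  have key := abs_eval_sub_le (dPol ^ (l + 1) * p ^ 2)
    (h := fun z => (l + 2) * (dd z ^ l * (p.eval z) ^ 2) +
      1 * (dd z ^ (l + 2) * ((derivative p).eval z) ^ 2)) (by fun_prop)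
    (by
      intro z hz
      have h0 := dd_nonneg hz
      simp only [derivative_mul, derivative_pow, derivative_dPol, eval_mul, eval_add,
        eval_pow, eval_X, eval_C, eval_dPol]
      simp only [Nat.cast_add, Nat.cast_one, Nat.add_sub_cancel, Nat.cast_ofNat]
      set D := dd z
      set a := p.eval z
      set b := (derivative p).eval z
      have hDl : 0 ≤ D ^ l := by positivity
      have e1 : D ^ (l + 1) = D ^ l * D := by ring
      have e2 : D ^ (l + 2) = D ^ l * D ^ 2 := by ring
      rw [e1, e2]
      have hl : (0 : ℝ) ≤ l := by positivity
      have h1 : 0 ≤ D ^ l * a ^ 2 := by positivity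
      have h2 : 0 ≤ D ^ l * (a - D * b) ^ 2 := by positivity
      have h3 : 0 ≤ D ^ l * (a + D * b) ^ 2 := by positivity
      have h5 : 0 ≤ (l + 1 : ℝ) * (D ^ l * a ^ 2) := by positivity
      have hz1 := mul_nonneg h5 (sub_nonneg.2 hz.2)
      have hz2 := mul_nonneg h5 (neg_le_iff_add_nonneg.1 hz.1)
      rw [abs_le]
      constructor
      · simp
        nlinarith
      · simp
        nlinarith) hx (y := 1) ⟨by norm_num, le_rfl⟩
  rw [integral_J_comb] at key
  simp only [eval_mul, eval_pow, eval_dPol] at key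
  have h1 : dd 1 = 0 := by simp [dd]
  rw [h1] at key
  have h2 := le_of_abs_le key
  have h3 := J_nonneg (l + 2) (derivative p)
  have hl : (0 : ℝ) ≤ l := by positivity
  have h4 : (0 : ℝ) ^ (l + 1) = 0 := by simp
  rw [h4] at h2
  nlinarith

/-- Unweighted sup bound. -/
lemma sup_one (p : ℝ[X]) {x : ℝ} (hx : x ∈ Icc (-1 : ℝ) 1) :
    (p.eval x) ^ 2 ≤ 3 * (J 0 p + J 0 (derivative p)) := by
  have key : ∀ s : ℝ, s = 1 ∨ s = -1 → |((1 + C s * X) * p ^ 2).eval x -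
      ((1 + C s * X) * p ^ 2).eval (-s)| ≤ ∫ z in (-1 : ℝ)..1, (3 * (dd z ^ 0 * (p.eval z) ^ 2) +
        2 * (dd z ^ 0 * ((derivative p).eval z) ^ 2)) := by
    intro s hs
    apply abs_eval_sub_le _ (by fun_prop) _ hx
    · rcases hs with rfl | rfl <;> norm_num
    intro z hz
    simp only [derivative_mul, derivative_X, derivative_pow, eval_mul, eval_add, derivative_add,
        eval_pow, eval_X, eval_C, derivative_C, derivative_one, eval_one, eval_zero]
    simp only [Nat.cast_ofNat, pow_zero, one_mul, zero_mul, zero_add, mul_one]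
    set a := p.eval z
    set b := (derivative p).eval z
    have hc : ∃ c, c = 1 + s * z ∧ 0 ≤ c ∧ c ≤ 2 ∧ -1 ≤ s ∧ s ≤ 1 := by
      refine ⟨_, rfl, ?_⟩
      rcases hs with rfl | rfl <;> refine ⟨?_, ?_, ?_, ?_⟩ <;> linarith [hz.1, hz.2]
    obtain ⟨c, hc, c0, c2, s1, s2⟩ := hc
    rw [← hc]
    have ha := sq_nonneg a
    have hb := sq_nonneg b
    have k1 := mul_nonneg c0 (sq_nonneg (a - b))
    have k2 := mul_nonneg c0 (sq_nonneg (a + b))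
    have k3 := mul_nonneg (sub_nonneg.2 c2) (add_nonneg ha hb)
    simp only [Nat.add_one_sub_one, pow_one]
    rw [abs_le]
    constructor <;> nlinarith
  have k1 := le_of_abs_le (key 1 (Or.inl rfl))
  have k2 := le_of_abs_le (key (-1) (Or.inr rfl))
  rw [integral_J_comb] at k1 k2
  simp at k1 k2
  have h0 := J_nonneg 0 p
  have h1 := J_nonneg 0 (derivative p)
  linarith

/-- All weighted integral and sup bounds controlled by the energy norms. -/
structure StaticBd (C : ℝ) (p : ℝ[X]) : Prop where
  j1 : ∀ k ≤ 5, J (k + 1) (derivative^[k] p) ≤ C * N5 p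
  j00 : J 0 p ≤ C * N5 p
  j01 : J 0 (derivative^[1] p) ≤ C * N5 p
  j02 : J 0 (derivative^[2] p) ≤ C * N5 p
  j23 : J 2 (derivative^[3] p) ≤ C * N5 p
  j44 : J 4 (derivative^[4] p) ≤ C * N5 p
  j55 : J 5 (derivative^[5] p) ≤ C * N6 p
  j34 : J 3 (derivative^[4] p) ≤ C * N6 p
  j13 : J 1 (derivative^[3] p) ≤ C * N6 p
  s0 : ∀ x ∈ Icc (-1 : ℝ) 1, (p.eval x) ^ 2 ≤ C * N5 p
  s1 : ∀ x ∈ Icc (-1 : ℝ) 1, ((derivative^[1] p).eval x) ^ 2 ≤ C * N5 p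
  s2 : ∀ x ∈ Icc (-1 : ℝ) 1, dd x * ((derivative^[2] p).eval x) ^ 2 ≤ C * N5 p
  s3 : ∀ x ∈ Icc (-1 : ℝ) 1, dd x ^ 3 * ((derivative^[3] p).eval x) ^ 2 ≤ C * N5 p
  s4 : ∀ x ∈ Icc (-1 : ℝ) 1, dd x ^ 5 * ((derivative^[4] p).eval x) ^ 2 ≤ C * N5 p
  t3 : ∀ x ∈ Icc (-1 : ℝ) 1, dd x ^ 2 * ((derivative^[3] p).eval x) ^ 2 ≤ C * N6 p
  t4 : ∀ x ∈ Icc (-1 : ℝ) 1, dd x ^ 4 * ((derivative^[4] p).eval x) ^ 2 ≤ C * N6 p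
  t5 : ∀ x ∈ Icc (-1 : ℝ) 1, dd x ^ 6 * ((derivative^[5] p).eval x) ^ 2 ≤ C * N6 p

lemma hardy_le {l k : ℕ} {p : ℝ[X]} {c M : ℝ} (hl : l ≤ 5)
    (h1 : J (l + 2) (derivative^[k] p) ≤ c * M) (h2 : J (l + 2) (derivative^[k + 1] p) ≤ c * M) :
    J l (derivative^[k] p) ≤ 10816 * c * M := by
  have h := hardy l (derivative^[k] p)
  rw [derivative_iter] at h
  have hl' : (l : ℝ) ≤ 5 := by exact_mod_cast hl
  have h0 : (0 : ℝ) ≤ l := by positivity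
  have h3 : (2 * (l : ℝ) + 3) ^ 2 ≤ 169 := by nlinarith
  have n1 := J_nonneg (l + 2) (derivative^[k] p)
  have n2 := J_nonneg (l + 2) (derivative^[k + 1] p)
  have := mul_nonneg (sub_nonneg.2 h3) (add_nonneg n1 n2)
  linarith

lemma sup_wt_le {l k : ℕ} {p : ℝ[X]} {K M x : ℝ} (hl : l ≤ 5) (hx : x ∈ Icc (-1 : ℝ) 1)
    (a : J l (derivative^[k] p) ≤ K * M) (b : J (l + 2) (derivative^[k + 1] p) ≤ K * M) :
    dd x ^ (l + 1) * ((derivative^[k] p).eval x) ^ 2 ≤ 20 * K * M := by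
  have := sup_wt l (derivative^[k] p) hx
  rw [derivative_iter] at this
  have hl' : (l : ℝ) ≤ 5 := by exact_mod_cast hl
  have h0 : (0 : ℝ) ≤ l := by positivity
  have n1 := J_nonneg l (derivative^[k] p)
  have n2 := J_nonneg (l + 2) (derivative^[k + 1] p)
  have := mul_nonneg (sub_nonneg.2 hl') (add_nonneg n1 n2)
  linarith

lemma sup_one_le {k : ℕ} {p : ℝ[X]} {K M x : ℝ} (hx : x ∈ Icc (-1 : ℝ) 1)
    (a : J 0 (derivative^[k] p) ≤ K * M) (b : J 0 (derivative^[k + 1] p) ≤ K * M) :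
    ((derivative^[k] p).eval x) ^ 2 ≤ 20 * K * M := by
  have := sup_one (derivative^[k] p) hx
  rw [derivative_iter] at this
  have n1 := J_nonneg 0 (derivative^[k] p)
  linarith

lemma exists_staticBd : ∃ C ≥ (1 : ℝ), ∀ p : ℝ[X], StaticBd C p := by
  obtain ⟨C, hC, h⟩ := chain
  obtain ⟨L1, hL1⟩ : ∃ L, L = 10816 * C := ⟨_, rfl⟩
  obtain ⟨L2, hL2⟩ : ∃ L, L = 10816 * L1 := ⟨_, rfl⟩
  obtain ⟨K, hK⟩ : ∃ L, L = 10816 * L2 := ⟨_, rfl⟩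
  have g1 : C ≤ L1 := by linarith
  have g2 : L1 ≤ L2 := by linarith
  have g3 : L2 ≤ K := by linarith
  have g4 : K ≤ 20 * K := by linarith
  refine ⟨20 * K, by linarith, fun p => ?_⟩
  have n5 := N5_nonneg p
  have n6 := N6_nonneg p
  have n56 := N5_le_N6 p
  have h := h p
  have C0 : 0 ≤ C := by linarith
  have grow : ∀ {l m k : ℕ} {c c' M M' : ℝ}, l ≤ m → 0 ≤ M → 0 ≤ c → c ≤ c' → M ≤ M' →
      J l (derivative^[k] p) ≤ c * M → J m (derivative^[k] p) ≤ c' * M' :=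
    fun hlm hM hc hcc hMM hh => (J_anti hlm _).trans (hh.trans
      (mul_le_mul hcc hMM hM (hc.trans hcc)))
  have j65 : J 6 (derivative^[5] p) ≤ C * N5 p := h 5 (by norm_num)
  have j54 : J 5 (derivative^[4] p) ≤ C * N5 p := h 4 (by norm_num)
  have j43 : J 4 (derivative^[3] p) ≤ C * N5 p := h 3 (by norm_num)
  have j32 : J 3 (derivative^[2] p) ≤ C * N5 p := h 2 (by norm_num)
  have j21 : J 2 (derivative^[1] p) ≤ C * N5 p := h 1 (by norm_num)
  have j10 : J 1 (derivative^[0] p) ≤ C * N5 p := h 0 (by norm_num)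
  have j76 : J 7 (derivative^[6] p) ≤ C * N6 p := by
    have : J 7 (derivative^[6] p) ≤ N6 p := le_add_of_nonneg_left n5
    have := mul_nonneg (sub_nonneg.2 hC) n6
    linarith
  have l1 : 0 ≤ L1 := by linarith
  have l2 : 0 ≤ L2 := by linarith
  have j44 : J 4 (derivative^[4] p) ≤ L1 * N5 p := by
    rw [hL1]; exact hardy_le (by norm_num) (grow (by norm_num) n5 C0 le_rfl le_rfl j54) j65
  have j23 : J 2 (derivative^[3] p) ≤ L2 * N5 p := by
    rw [hL2]; exact hardy_le (by norm_num) (grow le_rfl n5 C0 g1 le_rfl j43) j44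
  have j22 : J 2 (derivative^[2] p) ≤ L1 * N5 p := by
    rw [hL1]; exact hardy_le (by norm_num) (grow (by norm_num) n5 C0 le_rfl le_rfl j32) j43
  have j02 : J 0 (derivative^[2] p) ≤ K * N5 p := by
    rw [hK]; exact hardy_le (by norm_num) (grow le_rfl n5 l1 g2 le_rfl j22) j23
  have j01 : J 0 (derivative^[1] p) ≤ L2 * N5 p := by
    rw [hL2]; exact hardy_le (by norm_num) (grow le_rfl n5 C0 g1 le_rfl j21) j22
  have j00 : J 0 (derivative^[0] p) ≤ L1 * N5 p := by
    rw [hL1]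
    exact hardy_le (by norm_num) (grow (by norm_num) n5 C0 le_rfl le_rfl j10) j21
  have j55 : J 5 (derivative^[5] p) ≤ L1 * N6 p := by
    rw [hL1]; exact hardy_le (by norm_num) (grow (by norm_num) n5 C0 le_rfl n56 j65) j76
  have j34 : J 3 (derivative^[4] p) ≤ L2 * N6 p := by
    rw [hL2]; exact hardy_le (by norm_num) (grow le_rfl n5 C0 g1 n56 j54) j55
  have j13 : J 1 (derivative^[3] p) ≤ K * N6 p := by
    rw [hK]
    exact hardy_le (by norm_num) (grow (by norm_num) n5 l2 le_rfl n56 j23) j34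
  have k5 : ∀ {l k : ℕ} {c : ℝ}, 0 ≤ c → c ≤ K → J l (derivative^[k] p) ≤ c * N5 p →
      J l (derivative^[k] p) ≤ K * N5 p := fun hc hcc hh => grow le_rfl n5 hc hcc le_rfl hh
  have k6 : ∀ {l k : ℕ} {c : ℝ}, 0 ≤ c → c ≤ K → J l (derivative^[k] p) ≤ c * N6 p →
      J l (derivative^[k] p) ≤ K * N6 p := fun hc hcc hh => grow le_rfl n6 hc hcc le_rfl hh
  have g5 : C ≤ K := by linarith
  have g6 : L1 ≤ K := by linarith
  have k00 := k5 l1 g6 j00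
  have k01 := k5 l2 g3 j01
  have k23 := k5 l2 g3 j23
  have k44 := k5 l1 g6 j44
  have k65 := k5 C0 g5 j65
  have k55 := k6 l1 g6 j55
  have k34 := k6 l2 g3 j34
  have k76 := k6 C0 g5 j76
  have K0 : 0 ≤ K := by linarith
  have e5 : ∀ {l k : ℕ}, J l (derivative^[k] p) ≤ K * N5 p →
      J l (derivative^[k] p) ≤ 20 * K * N5 p := fun hh => grow le_rfl n5 K0 g4 le_rfl hh
  have e6 : ∀ {l k : ℕ}, J l (derivative^[k] p) ≤ K * N6 p →
      J l (derivative^[k] p) ≤ 20 * K * N6 p := fun hh => grow le_rfl n6 K0 g4 le_rfl hh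
  exact
  { j1 := fun k hk => e5 (k5 C0 g5 (h k hk))
    j00 := e5 (k := 0) k00
    j01 := e5 k01
    j02 := e5 j02
    j23 := e5 k23
    j44 := e5 k44
    j55 := e6 k55
    j34 := e6 k34
    j13 := e6 j13
    s0 := fun x hx => sup_one_le (k := 0) hx k00 k01
    s1 := fun x hx => sup_one_le hx k01 j02
    s2 := fun x hx => by simpa using sup_wt_le (l := 0) (by norm_num) hx j02 k23
    s3 := fun x hx => sup_wt_le (by norm_num) hx k23 k44
    s4 := fun x hx => sup_wt_le (by norm_num) hx k44 k65
    t3 := fun x hx => sup_wt_le (by norm_num) hx j13 k34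
    t4 := fun x hx => sup_wt_le (by norm_num) hx k34 k55
    t5 := fun x hx => sup_wt_le (by norm_num) hx k55 k76 }

/-- `T` is bounded from the energy norm to `L²`. -/
def EnergyBdd (T : ℝ[X] → ℝ[X]) : Prop := ∃ C ≥ (0 : ℝ), ∀ p, J 0 (T p) ≤ C * N5 p

lemma EnergyBdd.add {S T : ℝ[X] → ℝ[X]} (hS : EnergyBdd S) (hT : EnergyBdd T) :
    EnergyBdd fun p => S p + T p := by
  obtain ⟨C, hC, h⟩ := hS
  obtain ⟨D, hD, h'⟩ := hT
  refine ⟨2 * C + 2 * D, by positivity, fun p => ?_⟩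
  have : J 0 (S p + T p) ≤ 2 * J 0 (S p) + 2 * J 0 (T p) := by
    rw [← integral_J_comb]
    apply intervalIntegral.integral_mono_on neg_one_le_one' ((continuous_wt _ _).intervalIntegrable _ _)
      (Continuous.intervalIntegrable (by fun_prop) _ _)
    intro x _
    simp only [eval_add, pow_zero]
    nlinarith [sq_nonneg ((S p).eval x - (T p).eval x)]
  have := h p
  have := h' p
  linarith

lemma EnergyBdd.sum {ι : Type*} (s : Finset ι) {T : ι → ℝ[X] → ℝ[X]}
    (hT : ∀ i ∈ s, EnergyBdd (T i)) : EnergyBdd fun p => ∑ i ∈ s, T i p := by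
  classical
  induction s using Finset.induction_on with
  | empty => exact ⟨0, le_rfl, fun p => by simp [J]⟩
  | insert a s ha ih =>
    simp only [Finset.sum_insert ha]
    exact (hT a (Finset.mem_insert_self _ _)).add
      (ih fun i hi => hT i (Finset.mem_insert_of_mem hi))

lemma J_mul_le (R : ℝ[X]) : ∃ C ≥ (0 : ℝ), ∀ (l : ℕ) (p : ℝ[X]),
    J 0 (dPol ^ l * R * p) ≤ C * J (2 * l) p := by
  obtain ⟨M, hM⟩ := (isCompact_Icc (a := (-1 : ℝ)) (b := 1)).exists_bound_of_continuousOn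
    R.continuous.continuousOn
  refine ⟨M ^ 2, sq_nonneg _, fun l p => ?_⟩
  have e : M ^ 2 * J (2 * l) p = ∫ x in (-1 : ℝ)..1, M ^ 2 * (dd x ^ (2 * l) * (p.eval x) ^ 2) := by
    rw [intervalIntegral.integral_const_mul]; rfl
  rw [e]
  apply intervalIntegral.integral_mono_on neg_one_le_one' ((continuous_wt _ _).intervalIntegrable _ _)
    (Continuous.intervalIntegrable (by fun_prop) _ _)
  intro x hx
  have h1 : (R.eval x) ^ 2 ≤ M ^ 2 := by
    have := hM x hx
    rw [Real.norm_eq_abs] at this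
    exact sq_le_sq' (by linarith [neg_abs_le (R.eval x)]) ((le_abs_self _).trans this)
  simp only [eval_mul, eval_pow, eval_dPol, pow_zero, one_mul]
  have h2 : 0 ≤ dd x ^ (2 * l) * (p.eval x) ^ 2 := by
    have := dd_nonneg hx
    positivity
  calc _ = (R.eval x) ^ 2 * (dd x ^ (2 * l) * (p.eval x) ^ 2) := by ring
    _ ≤ _ := mul_le_mul_of_nonneg_right h1 h2

lemma energyBdd_of_wt {l m : ℕ} (hm : m ≤ 5) (hl : m ≤ l + 2) :
    ∃ C ≥ (0 : ℝ), ∀ p, J (2 * l) (derivative^[m] p) ≤ C * N5 p := by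
  obtain ⟨C, hC, h⟩ := exists_staticBd
  refine ⟨C, by linarith, fun p => ?_⟩
  have h := h p
  interval_cases m
  · exact (J_anti (Nat.zero_le _) _).trans h.j00
  · exact (J_anti (Nat.zero_le _) _).trans h.j01
  · exact (J_anti (Nat.zero_le _) _).trans h.j02
  · exact (J_anti (by omega) _).trans h.j23
  · exact (J_anti (by omega) _).trans h.j44
  · exact (J_anti (by omega) _).trans (h.j1 5 le_rfl)

lemma energyBdd_iterate (b k : ℕ) (hb : b ≤ 3) (hk : k ≤ 2 + b) :
    EnergyBdd fun p => derivative^[k] (dPol ^ b * p) := by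
  simp only [Polynomial.iterate_derivative_mul]
  apply EnergyBdd.sum
  intro i hi
  rw [Finset.mem_range] at hi
  obtain ⟨R, hR⟩ := pow_sub_dvd_iterate_derivative_pow dPol b (k - i)
  obtain ⟨C, hC, h⟩ := J_mul_le ((k.choose i : ℝ[X]) * R)
  obtain ⟨D, hD, h'⟩ := energyBdd_of_wt (l := b - (k - i)) (m := i) (by omega) (by omega)
  refine ⟨C * D, by positivity, fun p => ?_⟩
  rw [hR]
  have e : k.choose i • (dPol ^ (b - (k - i)) * R * derivative^[i] p) =
      dPol ^ (b - (k - i)) * ((k.choose i : ℝ[X]) * R) * derivative^[i] p := by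
    rw [nsmul_eq_mul]; ring
  beta_reduce
  rw [e]
  have := h (b - (k - i)) (derivative^[i] p)
  have := mul_le_mul_of_nonneg_left (h' p) hC
  linarith

lemma exists_energyBdd_iterate : ∃ C ≥ (1 : ℝ), ∀ b ≤ 3, ∀ k ≤ 2 + b, ∀ p : ℝ[X],
    J 0 (derivative^[k] (dPol ^ b * p)) ≤ C * N5 p := by
  have H : ∀ b k : ℕ, ∃ C ≥ (0 : ℝ), b ≤ 3 → k ≤ 2 + b → ∀ p : ℝ[X],
      J 0 (derivative^[k] (dPol ^ b * p)) ≤ C * N5 p := by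
    intro b k
    by_cases h : b ≤ 3 ∧ k ≤ 2 + b
    · obtain ⟨C, hC, h'⟩ := energyBdd_iterate b k h.1 h.2
      exact ⟨C, hC, fun _ _ => h'⟩
    · exact ⟨0, le_rfl, fun h1 h2 => absurd ⟨h1, h2⟩ h⟩
  choose C hC h using H
  refine ⟨1 + ∑ b ∈ Finset.range 4, ∑ k ∈ Finset.range 6, C b k, ?_, fun b hb k hk p => ?_⟩
  · have : 0 ≤ ∑ b ∈ Finset.range 4, ∑ k ∈ Finset.range 6, C b k :=
      Finset.sum_nonneg fun b _ => Finset.sum_nonneg fun k _ => hC b k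
    linarith
  refine (h b k hb hk p).trans (mul_le_mul_of_nonneg_right ?_ (N5_nonneg p))
  have h1 : C b k ≤ ∑ k ∈ Finset.range 6, C b k :=
    Finset.single_le_sum (fun k _ => hC b k) (Finset.mem_range.2 (by omega))
  have h2 := Finset.single_le_sum (s := Finset.range 4)
    (fun b _ => Finset.sum_nonneg fun k (_ : k ∈ Finset.range 6) => hC b k)
    (Finset.mem_range.2 (by omega : b < 4))
  linarith

/-- The adjoint first-order operator: `(d^{n+1} w)' = d^n (A n w)`. -/
def A (n : ℕ) (w : ℝ[X]) : ℝ[X] := dPol * derivative w + C ((n : ℝ) + 1) * (derivative dPol * w)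

lemma derivative_dPol_pow_mul (n : ℕ) (w : ℝ[X]) :
    derivative (dPol ^ (n + 1) * w) = dPol ^ n * A n w := by
  rw [derivative_mul, derivative_pow, A]
  simp
  ring

lemma A_zero (n : ℕ) : A n 0 = 0 := by simp [A]

lemma natDegree_A_le (n : ℕ) {w : ℝ[X]} {M : ℕ} (hw : w.natDegree ≤ M) :
    (A n w).natDegree ≤ M + 1 := by
  have h1 : dPol.natDegree ≤ 2 := by
    unfold dPol
    compute_degree
  have h2 : (derivative dPol).natDegree ≤ 1 := (natDegree_derivative_le _).trans (by omega)
  apply natDegree_add_le_of_degree_le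
  · by_cases h0 : w.natDegree = 0
    · rw [derivative_of_natDegree_zero h0]; simp
    refine natDegree_mul_le.trans ?_
    have := natDegree_derivative_le w
    omega
  · refine (natDegree_C_mul_le _ _).trans (natDegree_mul_le.trans ?_)
    omega

/-- The test polynomial whose pairing produces five integrations by parts. -/
def testPol (w : ℝ[X]) : ℝ[X] := -A 1 (A 2 (A 3 (A 4 (A 5 w))))

lemma natDegree_testPol_le {p : ℝ[X]} {N : ℕ} (hp : p.natDegree ≤ N) :
    (testPol (derivative^[5] p)).natDegree ≤ N := by
  by_cases h : p.natDegree < 5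
  · rw [iterate_derivative_eq_zero h]
    simp [testPol, A_zero]
  · have h1 : (derivative^[5] p).natDegree ≤ N - 5 :=
      (natDegree_iterate_derivative _ _).trans (by omega)
    have := natDegree_A_le 1 (natDegree_A_le 2 (natDegree_A_le 3 (natDegree_A_le 4
      (natDegree_A_le 5 h1))))
    rw [testPol, natDegree_neg]
    omega

lemma ibp_A (n : ℕ) (w : ℝ[X]) {f f' : ℝ → ℝ} (hf : ContinuousOn f (Icc (-1) 1))
    (hf' : ContinuousOn f' (Icc (-1) 1)) (h : ∀ x ∈ Ioo (-1 : ℝ) 1, HasDerivAt f (f' x) x) :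
    ∫ x in (-1 : ℝ)..1, dd x ^ n * f x * (A n w).eval x =
      -∫ x in (-1 : ℝ)..1, dd x ^ (n + 1) * f' x * w.eval x := by
  have hi1 : IntervalIntegrable (fun x => dd x ^ n * f x * (A n w).eval x) volume (-1) 1 := by
    apply ContinuousOn.intervalIntegrable
    rw [uIcc_eq]; fun_prop
  have hi2 : IntervalIntegrable (fun x => dd x ^ (n + 1) * f' x * w.eval x) volume (-1) 1 := by
    apply ContinuousOn.intervalIntegrable
    rw [uIcc_eq]; fun_prop
  rw [eq_neg_iff_add_eq_zero, ← intervalIntegral.integral_add hi1 hi2]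
  have key : ∀ x ∈ Ioo (-1 : ℝ) 1, HasDerivAt (fun x => f x * (dPol ^ (n + 1) * w).eval x)
      (dd x ^ n * f x * (A n w).eval x + dd x ^ (n + 1) * f' x * w.eval x) x := by
    intro x hx
    have h2 := (dPol ^ (n + 1) * w).hasDerivAt x
    rw [derivative_dPol_pow_mul] at h2
    refine ((h x hx).fun_mul h2).congr_deriv ?_
    simp only [eval_mul, eval_pow, eval_dPol]
    ring
  rw [intervalIntegral.integral_eq_sub_of_hasDerivAt_of_le neg_one_le_one' (by fun_prop) key
    (hi1.add hi2)]
  simp [eval_one_dPol, eval_neg_one_dPol]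

lemma integral_testPol (w : ℝ[X]) (F : ℕ → ℝ → ℝ)
    (hF : ∀ k ≤ 5, ContinuousOn (F k) (Icc (-1) 1))
    (hF' : ∀ k < 5, ∀ x ∈ Ioo (-1 : ℝ) 1, HasDerivAt (F k) (F (k + 1) x) x) :
    ∫ x in (-1 : ℝ)..1, dd x * F 0 x * (testPol w).eval x =
      ∫ x in (-1 : ℝ)..1, dd x ^ 6 * F 5 x * w.eval x := by
  have e0 := fun v : ℝ[X] => ibp_A 1 v (hF 0 (by norm_num)) (hF 1 (by norm_num)) (hF' 0 (by norm_num))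
  have e1 := fun v : ℝ[X] => ibp_A 2 v (hF 1 (by norm_num)) (hF 2 (by norm_num)) (hF' 1 (by norm_num))
  have e2 := fun v : ℝ[X] => ibp_A 3 v (hF 2 (by norm_num)) (hF 3 (by norm_num)) (hF' 2 (by norm_num))
  have e3 := fun v : ℝ[X] => ibp_A 4 v (hF 3 (by norm_num)) (hF 4 (by norm_num)) (hF' 3 (by norm_num))
  have e4 := fun v : ℝ[X] => ibp_A 5 v (hF 4 (by norm_num)) (hF 5 (by norm_num)) (hF' 4 (by norm_num))
  simp only [testPol, eval_neg, mul_neg, intervalIntegral.integral_neg]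
  simp only [pow_one] at e0
  rw [e0, e1, e2, e3, e4]
  simp

/-- The derivatives of `y² - 1` where `y = (1 + s)⁻¹`, in terms of the derivatives of `s`. -/
def gB (y : ℝ) (s : ℕ → ℝ) : ℕ → ℝ
  | 0 => y ^ 2 - 1
  | 1 => -2 * y ^ 3 * s 1
  | 2 => -2 * y ^ 3 * s 2 + 6 * y ^ 4 * s 1 ^ 2
  | 3 => -2 * y ^ 3 * s 3 + 18 * y ^ 4 * (s 1 * s 2) - 24 * y ^ 5 * s 1 ^ 3
  | 4 => -2 * y ^ 3 * s 4 + 6 * y ^ 4 * (4 * (s 1 * s 3) + 3 * s 2 ^ 2)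
      - 144 * y ^ 5 * (s 1 ^ 2 * s 2) + 120 * y ^ 6 * s 1 ^ 4
  | 5 => -2 * y ^ 3 * s 5 + 6 * y ^ 4 * (5 * (s 1 * s 4) + 10 * (s 2 * s 3))
      - 24 * y ^ 5 * (10 * (s 1 ^ 2 * s 3) + 15 * (s 1 * s 2 ^ 2))
      + 1200 * y ^ 6 * (s 1 ^ 3 * s 2) - 720 * y ^ 7 * s 1 ^ 5
  | _ => -2 * y ^ 3 * s 6 + 6 * y ^ 4 * (6 * (s 1 * s 5) + 15 * (s 2 * s 4) + 10 * s 3 ^ 2)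
      - 24 * y ^ 5 * (15 * (s 1 ^ 2 * s 4) + 60 * (s 1 * s 2 * s 3) + 15 * s 2 ^ 3)
      + 120 * y ^ 6 * (20 * (s 1 ^ 3 * s 3) + 45 * (s 1 ^ 2 * s 2 ^ 2))
      - 10800 * y ^ 7 * (s 1 ^ 4 * s 2) + 5040 * y ^ 8 * s 1 ^ 6

lemma hasDerivAt_gB {y : ℝ → ℝ} {s : ℝ → ℕ → ℝ} {x : ℝ}
    (hs : ∀ k, HasDerivAt (fun z => s z k) (s x (k + 1)) x)
    (hy : HasDerivAt y (-(y x) ^ 2 * s x 1) x) (k : ℕ) (hk : k < 6) :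
    HasDerivAt (fun z => gB (y z) (s z) k) (gB (y x) (s x) (k + 1)) x := by
  have h1 := hs 1
  have h2 := hs 2
  have h3 := hs 3
  have h4 := hs 4
  have h5 := hs 5
  interval_cases k <;> simp only [gB, zero_add, Nat.reduceAdd]
  · exact ((hy.fun_pow 2).sub_const 1).congr_deriv
      (by push_cast; ring)
  · exact (((hy.fun_pow 3).const_mul (-2)).fun_mul h1).congr_deriv
      (by push_cast; ring)
  · exact ((((hy.fun_pow 3).const_mul (-2)).fun_mul h2).fun_add
      (((hy.fun_pow 4).const_mul 6).fun_mul (h1.fun_pow 2))).congr_deriv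
      (by push_cast; ring)
  · exact (((((hy.fun_pow 3).const_mul (-2)).fun_mul h3).fun_add
      (((hy.fun_pow 4).const_mul 18).fun_mul (h1.fun_mul h2))).fun_sub
      (((hy.fun_pow 5).const_mul 24).fun_mul (h1.fun_pow 3))).congr_deriv
      (by push_cast; ring)
  · exact ((((((hy.fun_pow 3).const_mul (-2)).fun_mul h4).fun_add
      (((hy.fun_pow 4).const_mul 6).fun_mul (((h1.fun_mul h3).const_mul 4).fun_add
        ((h2.fun_pow 2).const_mul 3)))).fun_sub
      (((hy.fun_pow 5).const_mul 144).fun_mul ((h1.fun_pow 2).fun_mul h2))).fun_add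
      (((hy.fun_pow 6).const_mul 120).fun_mul (h1.fun_pow 4))).congr_deriv
      (by push_cast; ring)
  · exact (((((((hy.fun_pow 3).const_mul (-2)).fun_mul h5).fun_add
      (((hy.fun_pow 4).const_mul 6).fun_mul (((h1.fun_mul h4).const_mul 5).fun_add
        ((h2.fun_mul h3).const_mul 10)))).fun_sub
      (((hy.fun_pow 5).const_mul 24).fun_mul ((((h1.fun_pow 2).fun_mul h3).const_mul 10).fun_add
        ((h1.fun_mul (h2.fun_pow 2)).const_mul 15)))).fun_add
      (((hy.fun_pow 6).const_mul 1200).fun_mul ((h1.fun_pow 3).fun_mul h2))).fun_sub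
      (((hy.fun_pow 7).const_mul 720).fun_mul (h1.fun_pow 5))).congr_deriv
      (by push_cast; ring)

/-- The derivatives of `2 d' g + d g'`. -/
def fB (x y : ℝ) (s : ℕ → ℝ) (k : ℕ) : ℝ :=
  dd x * gB y s (k + 1) - ((k + 2) / 2 * x) * gB y s k - (k * (k + 3) / 4) * gB y s (k - 1)

lemma hasDerivAt_fB {y : ℝ → ℝ} {s : ℝ → ℕ → ℝ} {x : ℝ}
    (hs : ∀ k, HasDerivAt (fun z => s z k) (s x (k + 1)) x)
    (hy : HasDerivAt y (-(y x) ^ 2 * s x 1) x) (k : ℕ) (hk : k < 5) :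
    HasDerivAt (fun z => fB z (y z) (s z) k) (fB x (y x) (s x) (k + 1)) x := by
  have g1 := hasDerivAt_gB hs hy (k + 1) (by omega)
  have g0 := hasDerivAt_gB hs hy k (by omega)
  have hx := (hasDerivAt_id' x).const_mul ((k + 2 : ℝ) / 2)
  rcases Nat.eq_zero_or_pos k with rfl | hk0
  · have e : (fun z => fB z (y z) (s z) 0) =
        fun z => dd z * gB (y z) (s z) (0 + 1) - ((0 : ℕ) + 2) / 2 * z * gB (y z) (s z) 0 := by
      ext z; simp [fB]
    rw [e]
    refine (((hasDerivAt_dd x).fun_mul g1).fun_sub (hx.fun_mul g0)).congr_deriv ?_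
    simp [fB]; ring
  · obtain ⟨j, rfl⟩ := Nat.exists_eq_add_of_lt hk0
    have gm := hasDerivAt_gB hs hy j (by omega)
    have h3 : ∀ z, gB (y z) (s z) (0 + j + 1 - 1) = gB (y z) (s z) j := fun z => by
      rw [Nat.add_sub_cancel, zero_add]
    simp only [fB, h3]
    refine ((((hasDerivAt_dd x).fun_mul g1).fun_sub (hx.fun_mul g0)).fun_sub
      (gm.const_mul (((0 + j + 1 : ℕ) : ℝ) * (((0 + j + 1 : ℕ) : ℝ) + 3) / 4))).congr_deriv ?_
    simp only [Nat.add_sub_cancel, zero_add]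
    push_cast
    ring

/-- The part of `fB x y s 5` which is quadratically small at top order. -/
def rem (x y : ℝ) (s : ℕ → ℝ) : ℝ :=
  fB x y s 5 - (dd x * (-2 * y ^ 3 * s 6 + 6 * y ^ 4 * (s 1 * s 5)) + 7 * x * y ^ 3 * s 5 + 20 * s 4)

lemma abs_mul_mul_mul_le {c u w t K a T : ℝ} (hc : |c| ≤ K) (hu : |u| ≤ a) (hw : |w| ≤ 1)
    (ht : |t| ≤ T) : |c * (u * w * t)| ≤ K * (a * T) := by
  have ha : 0 ≤ a := (abs_nonneg u).trans hu
  have hK : 0 ≤ K := (abs_nonneg c).trans hc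
  rw [abs_mul, abs_mul, abs_mul]
  calc |c| * (|u| * |w| * |t|) ≤ K * (a * 1 * T) := by gcongr
    _ = _ := by ring

lemma abs_add_le_succ {z w n B : ℝ} (hz : |z| ≤ n * B) (hw : |w| ≤ B) : |z + w| ≤ (n + 1) * B := by
  have := abs_add_le z w
  linarith

lemma abs_rem_le {x y r a : ℝ} {s : ℕ → ℝ} (hx : |x| ≤ 1) (hy : y = (1 + s 0)⁻¹)
    (hs : |s 0| ≤ 1 / 2) (hr0 : 0 ≤ r) (hr1 : r ≤ 1) (hr : dd x = r ^ 2) (ha : a ≤ 1)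
    (h0 : |s 0| ≤ a) (h1 : |r * s 1| ≤ a) (h2 : |r ^ 2 * s 2| ≤ a) (h3 : |r ^ 4 * s 3| ≤ a) :
    |r ^ 6 * rem x y s| ≤ 21 * (1400000 * (a *
      (|r ^ 7 * s 5| + |r ^ 5 * s 4| + |r ^ 3 * s 3| + |r * s 2| + |s 1|))) := by
  obtain ⟨hsl, hsu⟩ := abs_le.1 hs
  have hy0 : 0 < y := by rw [hy]; exact inv_pos.2 (by linarith)
  have hy2 : |y| ≤ 2 := by
    rw [abs_of_pos hy0, hy, inv_le_comm₀ (by linarith) (by norm_num)]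
    linarith
  have hy1 : y * (1 + s 0) = 1 := by rw [hy]; exact inv_mul_cancel₀ (by linarith)
  have hcube : y ^ 3 - 1 = -(y * (y ^ 2 + y + 1)) * s 0 := by
    linear_combination (1 + y + y ^ 2) * hy1
  set T := |r ^ 7 * s 5| + |r ^ 5 * s 4| + |r ^ 3 * s 3| + |r * s 2| + |s 1| with hT
  have t5 : |r ^ 7 * s 5| ≤ T := by rw [hT]; linarith [abs_nonneg (r ^ 7 * s 5), abs_nonneg (r ^ 5 * s 4), abs_nonneg (r ^ 3 * s 3), abs_nonneg (r * s 2), abs_nonneg (s 1)]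
  have t4 : |r ^ 5 * s 4| ≤ T := by rw [hT]; linarith [abs_nonneg (r ^ 7 * s 5), abs_nonneg (r ^ 5 * s 4), abs_nonneg (r ^ 3 * s 3), abs_nonneg (r * s 2), abs_nonneg (s 1)]
  have t3 : |r ^ 3 * s 3| ≤ T := by rw [hT]; linarith [abs_nonneg (r ^ 7 * s 5), abs_nonneg (r ^ 5 * s 4), abs_nonneg (r ^ 3 * s 3), abs_nonneg (r * s 2), abs_nonneg (s 1)]
  have t2 : |r * s 2| ≤ T := by rw [hT]; linarith [abs_nonneg (r ^ 7 * s 5), abs_nonneg (r ^ 5 * s 4), abs_nonneg (r ^ 3 * s 3), abs_nonneg (r * s 2), abs_nonneg (s 1)]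
  have t1 : |s 1| ≤ T := by rw [hT]; linarith [abs_nonneg (r ^ 7 * s 5), abs_nonneg (r ^ 5 * s 4), abs_nonneg (r ^ 3 * s 3), abs_nonneg (r * s 2), abs_nonneg (s 1)]
  have hw : ∀ i j k : ℕ, |(r * s 1) ^ i * (r ^ 2 * s 2) ^ j * r ^ k| ≤ 1 := by
    intro i j k
    rw [abs_mul, abs_mul, abs_pow, abs_pow, abs_pow, abs_of_nonneg hr0]
    have e1 := pow_le_one₀ (n := i) (abs_nonneg _) (h1.trans ha)
    have e2 := pow_le_one₀ (n := j) (abs_nonneg _) (h2.trans ha)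
    have e3 := pow_le_one₀ (n := k) hr0 hr1
    exact mul_le_one₀ (mul_le_one₀ e1 (by positivity) e2) (by positivity) e3
  have hc : ∀ (c : ℝ) (e n : ℕ), |c| * 2 ^ n ≤ 1400000 → |c * (x ^ e * y ^ n)| ≤ 1400000 := by
    intro c e n h
    refine le_trans ?_ h
    rw [abs_mul, abs_mul, abs_pow, abs_pow]
    have e1 := pow_le_one₀ (n := e) (abs_nonneg _) hx
    have e2 : |y| ^ n ≤ 2 ^ n := pow_le_pow_left₀ (abs_nonneg _) hy2 n
    calc |c| * (|x| ^ e * |y| ^ n) ≤ |c| * (1 * 2 ^ n) := by gcongr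
      _ = _ := by ring
  have hcl : |(-20 : ℝ) * (y * (y ^ 2 + y + 1))| ≤ 1400000 := by
    rw [abs_of_pos hy0] at hy2
    rw [abs_mul, abs_of_pos (by positivity : 0 < y * (y ^ 2 + y + 1))]
    have : y * (y ^ 2 + y + 1) ≤ 2 * (2 ^ 2 + 2 + 1) := by gcongr
    norm_num at this ⊢
    linarith
  have m : ∀ (c : ℝ) (e n : ℕ) {u t : ℝ} (i j k : ℕ), |c| * 2 ^ n ≤ 1400000 → |u| ≤ a → |t| ≤ T →
      |c * (x ^ e * y ^ n) * (u * ((r * s 1) ^ i * (r ^ 2 * s 2) ^ j * r ^ k) * t)| ≤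
        1400000 * (a * T) := fun c e n _ _ i j k h hu ht =>
    abs_mul_mul_mul_le (hc c e n h) hu (hw i j k) ht
  have k1 := m 30 0 4 0 0 0 (by norm_num) h1 t5
  rw [← one_mul (1400000 * (a * T))] at k1
  have H := abs_add_le_succ k1 (m 90 0 4 0 0 1 (by norm_num) h2 t4)
  replace H := abs_add_le_succ H (m 60 0 4 0 0 1 (by norm_num) h3 t3)
  replace H := abs_add_le_succ H (m (-360) 0 5 1 0 1 (by norm_num) h1 t4)
  replace H := abs_add_le_succ H (m (-1440) 0 5 0 1 2 (by norm_num) h1 t3)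
  replace H := abs_add_le_succ H (m (-360) 0 5 0 1 3 (by norm_num) h2 t2)
  replace H := abs_add_le_succ H (m 2400 0 6 2 0 2 (by norm_num) h1 t3)
  replace H := abs_add_le_succ H (m 5400 0 6 1 1 3 (by norm_num) h1 t2)
  replace H := abs_add_le_succ H (m (-10800) 0 7 3 0 3 (by norm_num) h1 t2)
  replace H := abs_add_le_succ H (m 5040 0 8 4 0 3 (by norm_num) h1 t1)
  replace H := abs_add_le_succ H (m (-105) 1 4 0 0 0 (by norm_num) h1 t4)
  replace H := abs_add_le_succ H (m (-210) 1 4 0 0 1 (by norm_num) h2 t3)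
  replace H := abs_add_le_succ H (m 840 1 5 1 0 1 (by norm_num) h1 t3)
  replace H := abs_add_le_succ H (m 1260 1 5 0 1 2 (by norm_num) h1 t2)
  replace H := abs_add_le_succ H (m (-4200) 1 6 2 0 2 (by norm_num) h1 t2)
  replace H := abs_add_le_succ H (m 2520 1 7 3 0 2 (by norm_num) h1 t1)
  replace H := abs_add_le_succ H (m (-240) 0 4 0 0 2 (by norm_num) h1 t3)
  replace H := abs_add_le_succ H (m (-180) 0 4 0 0 3 (by norm_num) h2 t2)
  replace H := abs_add_le_succ H (m 1440 0 5 1 0 3 (by norm_num) h1 t2)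
  replace H := abs_add_le_succ H (m (-1200) 0 6 2 0 3 (by norm_num) h1 t1)
  replace H := abs_add_le_succ H (abs_mul_mul_mul_le hcl h0 (hw 0 0 1) t4)
  norm_num only at H
  refine le_trans (le_of_eq (congrArg _ ?_)) H
  have e : rem x y s = r ^ 2 * (6 * y ^ 4 * (5 * (s 1 * s 5) + 15 * (s 2 * s 4) + 10 * s 3 ^ 2)
      - 24 * y ^ 5 * (15 * (s 1 ^ 2 * s 4) + 60 * (s 1 * s 2 * s 3) + 15 * s 2 ^ 3)
      + 120 * y ^ 6 * (20 * (s 1 ^ 3 * s 3) + 45 * (s 1 ^ 2 * s 2 ^ 2))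
      - 10800 * y ^ 7 * (s 1 ^ 4 * s 2) + 5040 * y ^ 8 * s 1 ^ 6)
      - 7 / 2 * x * (6 * y ^ 4 * (5 * (s 1 * s 4) + 10 * (s 2 * s 3))
      - 24 * y ^ 5 * (10 * (s 1 ^ 2 * s 3) + 15 * (s 1 * s 2 ^ 2))
      + 1200 * y ^ 6 * (s 1 ^ 3 * s 2) - 720 * y ^ 7 * s 1 ^ 5)
      - 10 * (6 * y ^ 4 * (4 * (s 1 * s 3) + 3 * s 2 ^ 2)
      - 144 * y ^ 5 * (s 1 ^ 2 * s 2) + 120 * y ^ 6 * s 1 ^ 4)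
      + 20 * (y ^ 3 - 1) * s 4 := by
    simp only [rem, fB, gB, hr]
    norm_num
    ring
  rw [e, hcube]
  ring

/-- Values of the derivatives of `p'`. -/
def sv (p : ℝ[X]) (x : ℝ) (k : ℕ) : ℝ := (derivative^[k + 1] p).eval x

/-- `(1 + p')⁻¹`. -/
def yv (p : ℝ[X]) (x : ℝ) : ℝ := (1 + sv p x 0)⁻¹

lemma hasDerivAt_sv (p : ℝ[X]) (x : ℝ) (k : ℕ) :
    HasDerivAt (fun z => sv p z k) (sv p x (k + 1)) x := by
  have := (derivative^[k + 1] p).hasDerivAt x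
  rwa [derivative_iter] at this

lemma hasDerivAt_yv {p : ℝ[X]} {x : ℝ} (h : |sv p x 0| ≤ 1 / 2) :
    HasDerivAt (yv p) (-(yv p x) ^ 2 * sv p x 1) x := by
  have h1 := (abs_le.1 h).1
  refine (((hasDerivAt_sv p x 0).const_add 1).fun_inv (by linarith)).congr_deriv ?_
  rw [yv, inv_pow]
  simp only [zero_add]
  ring

lemma sq_sum_five_le (a b c d e : ℝ) :
    (a + b + c + d + e) ^ 2 ≤ 5 * (a ^ 2 + b ^ 2 + c ^ 2 + d ^ 2 + e ^ 2) := by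
  nlinarith [sq_nonneg (a - b), sq_nonneg (a - c), sq_nonneg (a - d), sq_nonneg (a - e),
    sq_nonneg (b - c), sq_nonneg (b - d), sq_nonneg (b - e), sq_nonneg (c - d), sq_nonneg (c - e),
    sq_nonneg (d - e)]

/-- The density dominating the energy flux. -/
def topDens (lam : ℝ) (p w : ℝ[X]) (x : ℝ) : ℝ :=
  lam ^ 2 * (dd x ^ 6 * ((derivative^[5] w).eval x) ^ 2) + (dd x ^ 7 * (sv p x 5) ^ 2
    + dd x ^ 5 * (sv p x 4) ^ 2 + dd x ^ 3 * (sv p x 3) ^ 2 + dd x ^ 1 * (sv p x 2) ^ 2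
    + dd x ^ 0 * (sv p x 1) ^ 2)

lemma mul_le_three_mul {z T S : ℝ} (h : T ^ 2 ≤ 5 * S) (hS : 0 ≤ S) : z * T ≤ 3 * (z ^ 2 + S) := by
  nlinarith [sq_nonneg (z - T / 2)]

set_option maxHeartbeats 1000000 in
lemma exists_flux_bound : ∃ K > (0 : ℝ), ∃ κ₀ > (0 : ℝ), ∀ (p w : ℝ[X]) (lam κ : ℝ), 0 < lam →
    0 ≤ κ → κ ≤ κ₀ → N6 p ≤ κ ^ 2 → lam ^ 2 * N5 w ≤ κ ^ 2 → ∀ x ∈ Icc (-1 : ℝ) 1,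
      |sv p x 0| ≤ 1 / 2 ∧
      -(dd x ^ 6 * rem x (yv p x) (sv p x) * (derivative^[5] w).eval x) -
        3 * (dd x ^ 7 * (sv p x 5) ^ 2 * (derivative^[1] w).eval x * yv p x ^ 4) ≤
      K * κ * lam⁻¹ * topDens lam p w x := by
  obtain ⟨C, hC, hst⟩ := exists_staticBd
  have hC0 : 0 ≤ C := by linarith
  set c := √C with hc
  have hc1 : 1 ≤ c := Real.one_le_sqrt.2 hC
  have hcc : c ^ 2 = C := Real.sq_sqrt hC0
  refine ⟨100000000 * c, by positivity, 1 / (2 * c), by positivity, ?_⟩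
  intro p w lam κ hlam hκ hκ0 hp hw x hx
  have hp' := hst p
  have hw' := hst w
  set a := c * κ with ha
  have ha0 : 0 ≤ a := by positivity
  have ha2 : a ≤ 1 / 2 := by
    have := mul_le_mul_of_nonneg_left hκ0 (by positivity : 0 ≤ c)
    rw [ha]
    refine this.trans (le_of_eq ?_)
    field_simp
  have hN6 : C * N6 p ≤ a ^ 2 := by
    rw [ha, mul_pow, hcc]; gcongr
  have hN5 : C * N5 p ≤ a ^ 2 := le_trans (by gcongr; exact N5_le_N6 p) hN6
  have h0 : |sv p x 0| ≤ a := abs_le_of_sq_le_sq ((hp'.s1 x hx).trans hN5) ha0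
  set r := √(dd x) with hr
  have hdd := dd_nonneg hx
  have hrd : dd x = r ^ 2 := (Real.sq_sqrt hdd).symm
  have hr0 : 0 ≤ r := Real.sqrt_nonneg _
  have hr1 : r ≤ 1 := Real.sqrt_le_one.2 (dd_le.trans (by norm_num))
  have hs2 := hp'.s2 x hx
  have ht3 := hp'.t3 x hx
  have ht4 := hp'.t4 x hx
  rw [hrd] at hs2 ht3 ht4
  have h1 : |r * sv p x 1| ≤ a := by
    apply abs_le_of_sq_le_sq _ ha0
    rw [mul_pow]
    exact hs2.trans hN5
  have h2 : |r ^ 2 * sv p x 2| ≤ a := by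
    apply abs_le_of_sq_le_sq _ ha0
    rw [mul_pow]
    exact ht3.trans hN6
  have h3 : |r ^ 4 * sv p x 3| ≤ a := by
    apply abs_le_of_sq_le_sq _ ha0
    rw [mul_pow, ← pow_mul]
    rw [← pow_mul] at ht4
    exact ht4.trans hN6
  have hV : |(derivative^[1] w).eval x| ≤ a * lam⁻¹ := by
    apply abs_le_of_sq_le_sq _ (by positivity)
    refine (hw'.s1 x hx).trans ?_
    rw [mul_pow, inv_pow, ← div_eq_mul_inv, le_div_iff₀ (by positivity), ha, mul_pow, hcc]
    calc C * N5 w * lam ^ 2 = C * (lam ^ 2 * N5 w) := by ring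
      _ ≤ C * κ ^ 2 := by gcongr
  have hs : |sv p x 0| ≤ 1 / 2 := h0.trans ha2
  refine ⟨hs, ?_⟩
  have hrem := abs_rem_le (abs_le.2 hx) rfl hs hr0 hr1 hrd (by linarith) h0 h1 h2 h3
  change |r ^ 6 * rem x (yv p x) (sv p x)| ≤ _ at hrem
  have hy0 : 0 ≤ yv p x := inv_nonneg.2 (by linarith [(abs_le.1 hs).1])
  have hy2 : yv p x ≤ 2 := by
    rw [yv, inv_le_comm₀ (by linarith [(abs_le.1 hs).1]) (by norm_num)]
    linarith [(abs_le.1 hs).1]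
  have hy4 : yv p x ^ 4 ≤ 16 := by
    calc yv p x ^ 4 ≤ 2 ^ 4 := by gcongr
      _ = 16 := by norm_num
  set R := rem x (yv p x) (sv p x)
  set W := (derivative^[5] w).eval x
  set V := (derivative^[1] w).eval x
  set y := yv p x
  unfold topDens
  rw [hrd]
  generalize sv p x 5 = s5 at *
  generalize sv p x 4 = s4 at *
  generalize sv p x 3 = s3 at *
  generalize sv p x 2 = s2 at *
  generalize sv p x 1 = s1 at *
  set T := |r ^ 7 * s5| + |r ^ 5 * s4| + |r ^ 3 * s3| + |r * s2| + |s1|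
  set S := (r ^ 2) ^ 7 * s5 ^ 2 + (r ^ 2) ^ 5 * s4 ^ 2 + (r ^ 2) ^ 3 * s3 ^ 2 + (r ^ 2) ^ 1 * s2 ^ 2
    + (r ^ 2) ^ 0 * s1 ^ 2 with hS
  have hT0 : 0 ≤ T := by positivity
  have hTS : T ^ 2 ≤ 5 * S := by
    have : S = |r ^ 7 * s5| ^ 2 + |r ^ 5 * s4| ^ 2 + |r ^ 3 * s3| ^ 2 + |r * s2| ^ 2 + |s1| ^ 2 := by
      simp only [sq_abs, hS]; ring
    rw [this]
    exact sq_sum_five_le _ _ _ _ _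
  have hl : lam⁻¹ * lam = 1 := inv_mul_cancel₀ hlam.ne'
  have hl0 : 0 < lam⁻¹ := inv_pos.2 hlam
  have b1 : -((r ^ 2) ^ 6 * R * W) ≤ 29400000 * a * lam⁻¹ * (3 * (lam ^ 2 * ((r ^ 2) ^ 6 * W ^ 2) + S)) := by
    calc -((r ^ 2) ^ 6 * R * W) = -((r ^ 6 * R) * (r ^ 6 * W)) := by ring
      _ ≤ |(r ^ 6 * R) * (r ^ 6 * W)| := neg_le_abs _
      _ = |r ^ 6 * R| * |r ^ 6 * W| := abs_mul _ _
      _ ≤ 21 * (1400000 * (a * T)) * |r ^ 6 * W| := by gcongr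
      _ = 29400000 * a * ((lam⁻¹ * lam) * |r ^ 6 * W| * T) := by rw [hl]; ring
      _ = 29400000 * a * lam⁻¹ * ((lam * |r ^ 6 * W|) * T) := by ring
      _ ≤ 29400000 * a * lam⁻¹ * (3 * (lam ^ 2 * ((r ^ 2) ^ 6 * W ^ 2) + S)) := by
        refine mul_le_mul_of_nonneg_left ?_ (by positivity)
        have e : lam ^ 2 * ((r ^ 2) ^ 6 * W ^ 2) = (lam * |r ^ 6 * W|) ^ 2 := by
          rw [mul_pow, sq_abs]; ring
        rw [e]
        exact mul_le_three_mul hTS (by positivity)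
  have hS7 : (r ^ 2) ^ 7 * s5 ^ 2 ≤ S := by
    have : 0 ≤ (r ^ 2) ^ 5 * s4 ^ 2 + (r ^ 2) ^ 3 * s3 ^ 2 + (r ^ 2) ^ 1 * s2 ^ 2
      + (r ^ 2) ^ 0 * s1 ^ 2 := by positivity
    rw [hS]; linarith
  have b2 : -(3 * ((r ^ 2) ^ 7 * s5 ^ 2 * V * y ^ 4)) ≤ 48 * a * lam⁻¹ * S := by
    calc -(3 * ((r ^ 2) ^ 7 * s5 ^ 2 * V * y ^ 4)) = 3 * ((r ^ 2) ^ 7 * s5 ^ 2) * (-V) * y ^ 4 := by ring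
      _ ≤ 3 * ((r ^ 2) ^ 7 * s5 ^ 2) * (a * lam⁻¹) * y ^ 4 := by
        gcongr
        exact (neg_le_abs _).trans hV
      _ ≤ 3 * S * (a * lam⁻¹) * 16 := by gcongr
      _ = _ := by ring
  have hS0 : 0 ≤ S := by positivity
  have hW0 : 0 ≤ lam ^ 2 * ((r ^ 2) ^ 6 * W ^ 2) := by positivity
  calc _ ≤ 29400000 * a * lam⁻¹ * (3 * (lam ^ 2 * ((r ^ 2) ^ 6 * W ^ 2) + S)) + 48 * a * lam⁻¹ * S := by
        linarith
    _ = (a * lam⁻¹) * (88200000 * (lam ^ 2 * ((r ^ 2) ^ 6 * W ^ 2)) + 88200048 * S) := by ring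
    _ ≤ (a * lam⁻¹) * (100000000 * (lam ^ 2 * ((r ^ 2) ^ 6 * W ^ 2) + S)) := by
        gcongr; linarith
    _ = _ := by rw [ha]; ring

lemma exists_topDens_bound : ∃ C ≥ (1 : ℝ), ∀ (lam : ℝ) (p w : ℝ[X]),
    ∫ x in (-1 : ℝ)..1, topDens lam p w x ≤ C * (lam ^ 2 * N5 w + N6 p) := by
  obtain ⟨C, hC, hst⟩ := exists_staticBd
  refine ⟨5 * C, by linarith, fun lam p w => ?_⟩
  have hp := hst p
  have i : ∀ (l : ℕ) (q : ℝ[X]), IntervalIntegrable (fun x => dd x ^ l * (q.eval x) ^ 2) volume (-1) 1 :=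
    fun l q => (continuous_wt l q).intervalIntegrable _ _
  have e : ∫ x in (-1 : ℝ)..1, topDens lam p w x = lam ^ 2 * J 6 (derivative^[5] w) +
      (J 7 (derivative^[6] p) + J 5 (derivative^[5] p) + J 3 (derivative^[4] p) +
        J 1 (derivative^[3] p) + J 0 (derivative^[2] p)) := by
    simp only [topDens, sv, Nat.reduceAdd]
    rw [intervalIntegral.integral_add ((i _ _).const_mul _)
      (((((i _ _).add (i _ _)).add (i _ _)).add (i _ _)).add (i _ _)),
      intervalIntegral.integral_add ((((i _ _).add (i _ _)).add (i _ _)).add (i _ _)) (i _ _),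
      intervalIntegral.integral_add (((i _ _).add (i _ _)).add (i _ _)) (i _ _),
      intervalIntegral.integral_add ((i _ _).add (i _ _)) (i _ _),
      intervalIntegral.integral_add (i _ _) (i _ _), intervalIntegral.integral_const_mul]
    rfl
  rw [e]
  have h1 : J 6 (derivative^[5] w) ≤ N5 w := le_add_of_nonneg_left (J_nonneg _ _)
  have h2 : J 7 (derivative^[6] p) ≤ N6 p := le_add_of_nonneg_left (N5_nonneg _)
  have h3 := hp.j55
  have h4 := hp.j34
  have h5 := hp.j13
  have h6 := hp.j02
  have h7 := mul_le_mul_of_nonneg_left (N5_le_N6 p) (by linarith : 0 ≤ C)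
  have h8 := mul_le_mul_of_nonneg_left h1 (sq_nonneg lam)
  have h9 := mul_nonneg (sq_nonneg lam) (N5_nonneg w)
  have h10 := mul_nonneg (sub_nonneg.2 hC) h9
  have h11 := mul_nonneg (sub_nonneg.2 hC) (N6_nonneg p)
  linarith

lemma continuousOn_sv (p : ℝ[X]) (k : ℕ) (s : Set ℝ) : ContinuousOn (fun x => sv p x k) s :=
  (derivative^[k + 1] p).continuous.continuousOn

lemma continuousOn_yv {p : ℝ[X]} (hs : ∀ x ∈ Icc (-1 : ℝ) 1, |sv p x 0| ≤ 1 / 2) :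
    ContinuousOn (yv p) (Icc (-1) 1) :=
  fun x hx => (hasDerivAt_yv (hs x hx)).continuousAt.continuousWithinAt

/-- The integral of a derivative vanishes if the primitive vanishes at both ends. -/
lemma integral_eq_zero_of_hasDerivAt {F F' : ℝ → ℝ} (h : ∀ x ∈ Icc (-1 : ℝ) 1, HasDerivAt F (F' x) x)
    (hc : ContinuousOn F' (Icc (-1) 1)) (h1 : F 1 = 0) (h2 : F (-1) = 0) :
    ∫ x in (-1 : ℝ)..1, F' x = 0 := by
  rw [intervalIntegral.integral_eq_sub_of_hasDerivAt (f := F), h1, h2, sub_zero]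
  · rwa [uIcc_eq]
  · apply ContinuousOn.intervalIntegrable
    rwa [uIcc_eq]

lemma dd_one : dd 1 = 0 := by norm_num [dd]

lemma dd_neg_one : dd (-1) = 0 := by norm_num [dd]

lemma integrable_of_continuousOn {F : ℝ → ℝ} (hc : ContinuousOn F (Icc (-1) 1)) :
    IntervalIntegrable F volume (-1) 1 := by
  apply ContinuousOn.intervalIntegrable
  rwa [uIcc_eq]

lemma continuousOn_gB {p : ℝ[X]} (hs : ∀ x ∈ Icc (-1 : ℝ) 1, |sv p x 0| ≤ 1 / 2) (k : ℕ)
    (hk : k ≤ 6) : ContinuousOn (fun x => gB (yv p x) (sv p x) k) (Icc (-1) 1) := by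
  have h1 := fun k => continuousOn_sv p k (Icc (-1) 1)
  have h2 := continuousOn_yv hs
  interval_cases k <;> simp only [gB] <;> fun_prop

lemma continuousOn_fB {p : ℝ[X]} (hs : ∀ x ∈ Icc (-1 : ℝ) 1, |sv p x 0| ≤ 1 / 2) (k : ℕ)
    (hk : k ≤ 5) : ContinuousOn (fun x => fB x (yv p x) (sv p x) k) (Icc (-1) 1) := by
  have h1 := continuousOn_gB hs (k + 1) (by omega)
  have h2 := continuousOn_gB hs k (by omega)
  have h3 := continuousOn_gB hs (k - 1) (by omega)
  unfold fB
  fun_prop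

/-- The weak form of the pressure force. -/
lemma integral_force {p : ℝ[X]} (hs : ∀ x ∈ Icc (-1 : ℝ) 1, |sv p x 0| ≤ 1 / 2) (q : ℝ[X]) :
    ∫ x in (-1 : ℝ)..1, dd x ^ 2 * (yv p x ^ 2 - 1) * (derivative q).eval x =
      -∫ x in (-1 : ℝ)..1, dd x * fB x (yv p x) (sv p x) 0 * q.eval x := by
  have c2 := continuousOn_yv hs
  have c3 := continuousOn_fB hs 0 (by norm_num)
  rw [eq_neg_iff_add_eq_zero, ← intervalIntegral.integral_add
    (integrable_of_continuousOn (by fun_prop)) (integrable_of_continuousOn (by fun_prop))]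
  refine integral_eq_zero_of_hasDerivAt (F := fun x => dd x ^ 2 * (gB (yv p x) (sv p x) 0) * q.eval x)
    (fun x hx => ?_) (by fun_prop) (by simp [dd_one]) (by simp [dd_neg_one])
  refine ((((hasDerivAt_dd x).fun_pow 2).fun_mul (hasDerivAt_gB (hasDerivAt_sv p x)
    (hasDerivAt_yv (hs x hx)) 0 (by norm_num))).fun_mul (q.hasDerivAt x)).congr_deriv ?_
  simp only [fB, gB]
  norm_num
  ring

/-- Time derivative of the energy density. -/
def eDot (a a' : ℝ) (p w z : ℝ[X]) (x : ℝ) : ℝ :=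
  3 / 2 * a ^ 2 * a' * (dd x * w.eval x ^ 2 + dd x ^ 6 * (derivative^[5] w).eval x ^ 2)
    + a ^ 3 * (dd x * (w.eval x * z.eval x)
      + dd x ^ 6 * ((derivative^[5] w).eval x * (derivative^[5] z).eval x))
    + dd x * (p.eval x * w.eval x) + dd x ^ 2 * (1 - yv p x ^ 2) * (derivative w).eval x
    + 21 * (dd x ^ 6 * (sv p x 4 * (derivative^[5] w).eval x))
    + 2 * (dd x ^ 7 * sv p x 5 * (derivative^[6] w).eval x * yv p x ^ 3)
    - 3 * (dd x ^ 7 * sv p x 5 ^ 2 * (derivative^[1] w).eval x * yv p x ^ 4)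

/-- The energy flux. -/
def flux (p w : ℝ[X]) (x : ℝ) : ℝ :=
  -(dd x ^ 6 * rem x (yv p x) (sv p x) * (derivative^[5] w).eval x)
    - 3 * (dd x ^ 7 * (sv p x 5) ^ 2 * (derivative^[1] w).eval x * yv p x ^ 4)

lemma integral_top_ibp {p : ℝ[X]} (hs : ∀ x ∈ Icc (-1 : ℝ) 1, |sv p x 0| ≤ 1 / 2) (w : ℝ[X]) :
    ∫ x in (-1 : ℝ)..1, (dd x ^ 7 * sv p x 5 * (derivative^[6] w).eval x * yv p x ^ 3
      - 7 / 2 * x * dd x ^ 6 * sv p x 5 * (derivative^[5] w).eval x * yv p x ^ 3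
      + dd x ^ 7 * (derivative^[5] w).eval x *
        (sv p x 6 * yv p x ^ 3 - 3 * yv p x ^ 4 * sv p x 1 * sv p x 5)) = 0 := by
  have c1 := fun k => continuousOn_sv p k (Icc (-1) 1)
  have c2 := continuousOn_yv hs
  refine integral_eq_zero_of_hasDerivAt
    (F := fun x => dd x ^ 7 * sv p x 5 * (derivative^[5] w).eval x * yv p x ^ 3)
    (fun x hx => ?_) (by fun_prop) (by simp [dd_one]) (by simp [dd_neg_one])
  have hw := (derivative^[5] w).hasDerivAt x
  rw [derivative_iter] at hw
  refine (((((hasDerivAt_dd x).fun_pow 7).fun_mul (hasDerivAt_sv p x 5)).fun_mul hw).fun_mul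
    ((hasDerivAt_yv (hs x hx)).fun_pow 3)).congr_deriv ?_
  norm_num
  ring

lemma continuousOn_rem {p : ℝ[X]} (hs : ∀ x ∈ Icc (-1 : ℝ) 1, |sv p x 0| ≤ 1 / 2) :
    ContinuousOn (fun x => rem x (yv p x) (sv p x)) (Icc (-1) 1) := by
  have c1 := fun k => continuousOn_sv p k (Icc (-1) 1)
  have c2 := continuousOn_yv hs
  have c3 := continuousOn_fB hs 5 le_rfl
  unfold rem
  fun_prop

lemma continuousOn_flux {p : ℝ[X]} (hs : ∀ x ∈ Icc (-1 : ℝ) 1, |sv p x 0| ≤ 1 / 2) (w : ℝ[X]) :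
    ContinuousOn (flux p w) (Icc (-1) 1) := by
  have c1 := fun k => continuousOn_sv p k (Icc (-1) 1)
  have c2 := continuousOn_yv hs
  have c3 := continuousOn_rem hs
  unfold flux
  fun_prop

lemma continuousOn_eDot {p : ℝ[X]} (hs : ∀ x ∈ Icc (-1 : ℝ) 1, |sv p x 0| ≤ 1 / 2) (a a' : ℝ)
    (w z : ℝ[X]) : ContinuousOn (eDot a a' p w z) (Icc (-1) 1) := by
  have c1 := fun k => continuousOn_sv p k (Icc (-1) 1)
  have c2 := continuousOn_yv hs
  unfold eDot
  fun_prop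

lemma integral_testPol_poly (u w : ℝ[X]) :
    ∫ x in (-1 : ℝ)..1, dd x * u.eval x * (testPol w).eval x =
      ∫ x in (-1 : ℝ)..1, dd x ^ 6 * (derivative^[5] u).eval x * w.eval x :=
  integral_testPol w (fun k x => (derivative^[k] u).eval x)
    (fun k _ => (Polynomial.continuous _).continuousOn) (fun k _ x _ => by
      have := (derivative^[k] u).hasDerivAt x
      rwa [derivative_iter] at this)

/-- The energy identity for Galerkin solutions. -/
lemma integral_eDot {N : ℕ} {p w z : ℝ[X]} {a a' : ℝ} (hw : w.natDegree ≤ N)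
    (hs : ∀ x ∈ Icc (-1 : ℝ) 1, |sv p x 0| ≤ 1 / 2)
    (weak : ∀ q : ℝ[X], q.natDegree ≤ N →
      ∫ x in (-1 : ℝ)..1, dd x * (C (a ^ 3) * z + C (2 * a ^ 2 * a') * w + p).eval x * q.eval x =
        ∫ x in (-1 : ℝ)..1, dd x ^ 2 * (yv p x ^ 2 - 1) * (derivative q).eval x) :
    ∫ x in (-1 : ℝ)..1, eDot a a' p w z x =
      -(1 / 2) * a ^ 2 * a' * (J 1 w + J 6 (derivative^[5] w)) + ∫ x in (-1 : ℝ)..1, flux p w x := by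
  have c1 := fun k => continuousOn_sv p k (Icc (-1) 1)
  have c2 := continuousOn_yv hs
  have c3 := continuousOn_rem hs
  have cf := continuousOn_fB hs 5 le_rfl
  have w1 := weak w hw
  have w2 := weak _ (natDegree_testPol_le hw)
  rw [integral_force hs, integral_testPol _ (fun k x => fB x (yv p x) (sv p x) k)
    (fun k hk => continuousOn_fB hs k hk) (fun k hk x hx => hasDerivAt_fB (hasDerivAt_sv p x)
    (hasDerivAt_yv (hs x (Ioo_subset_Icc_self hx))) k hk), integral_testPol_poly] at w2
  have w3 := integral_top_ibp hs w
  have hJ1 : J 1 w + J 6 (derivative^[5] w) = ∫ x in (-1 : ℝ)..1,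
      (dd x * w.eval x ^ 2 + dd x ^ 6 * (derivative^[5] w).eval x ^ 2) := by
    rw [intervalIntegral.integral_add (integrable_of_continuousOn (by fun_prop))
      (integrable_of_continuousOn (by fun_prop))]
    simp [J]
  rw [hJ1]
  have key : ∫ x in (-1 : ℝ)..1, (eDot a a' p w z x
      - (-(1 / 2) * a ^ 2 * a' * (dd x * w.eval x ^ 2 + dd x ^ 6 * (derivative^[5] w).eval x ^ 2))
      - flux p w x) = 
      ∫ x in (-1 : ℝ)..1, ((dd x * (C (a ^ 3) * z + C (2 * a ^ 2 * a') * w + p).eval x * w.eval x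
        - dd x ^ 2 * (yv p x ^ 2 - 1) * (derivative w).eval x)
        + (dd x ^ 6 * (derivative^[5] (C (a ^ 3) * z + C (2 * a ^ 2 * a') * w + p)).eval x *
            (derivative^[5] w).eval x
          + dd x ^ 6 * fB x (yv p x) (sv p x) 5 * (derivative^[5] w).eval x)
        + 2 * (dd x ^ 7 * sv p x 5 * (derivative^[6] w).eval x * yv p x ^ 3
      - 7 / 2 * x * dd x ^ 6 * sv p x 5 * (derivative^[5] w).eval x * yv p x ^ 3
      + dd x ^ 7 * (derivative^[5] w).eval x *
        (sv p x 6 * yv p x ^ 3 - 3 * yv p x ^ 4 * sv p x 1 * sv p x 5))) := by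
    refine intervalIntegral.integral_congr fun x hx => ?_
    have e5 : sv p x 4 = (derivative^[5] p).eval x := rfl
    simp only [eDot, flux, rem, iterate_map_add, iterate_derivative_C_mul, eval_add,
      eval_mul, eval_C, e5]
    ring
  have i1 : IntervalIntegrable (fun x => eDot a a' p w z x) volume (-1) 1 :=
    integrable_of_continuousOn (continuousOn_eDot hs a a' w z)
  have i2 : IntervalIntegrable (fun x => flux p w x) volume (-1) 1 :=
    integrable_of_continuousOn (continuousOn_flux hs w)
  have i3 : IntervalIntegrable (fun x => -(1 / 2) * a ^ 2 * a' *
      (dd x * w.eval x ^ 2 + dd x ^ 6 * (derivative^[5] w).eval x ^ 2)) volume (-1) 1 :=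
    integrable_of_continuousOn (by fun_prop)
  have z1 : ∫ x in (-1 : ℝ)..1,
      (dd x * (C (a ^ 3) * z + C (2 * a ^ 2 * a') * w + p).eval x * w.eval x
        - dd x ^ 2 * (yv p x ^ 2 - 1) * (derivative w).eval x) = 0 := by
    rw [intervalIntegral.integral_sub (integrable_of_continuousOn (by fun_prop))
      (integrable_of_continuousOn (by fun_prop)), w1, sub_self]
  have z2 : ∫ x in (-1 : ℝ)..1,
      (dd x ^ 6 * (derivative^[5] (C (a ^ 3) * z + C (2 * a ^ 2 * a') * w + p)).eval x *
            (derivative^[5] w).eval x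
          + dd x ^ 6 * fB x (yv p x) (sv p x) 5 * (derivative^[5] w).eval x) = 0 := by
    rw [intervalIntegral.integral_add (integrable_of_continuousOn (by fun_prop))
      (integrable_of_continuousOn (by fun_prop)), w2, neg_add_cancel]
  rw [intervalIntegral.integral_sub (i1.sub i3) i2, intervalIntegral.integral_sub i1 i3,
    intervalIntegral.integral_const_mul] at key
  have hR := key
  rw [intervalIntegral.integral_add ((integrable_of_continuousOn (by fun_prop)).add
      (integrable_of_continuousOn (by fun_prop))) (integrable_of_continuousOn (by fun_prop)),
    intervalIntegral.integral_const_mul, w3, ← sub_eq_zero] at hR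
  clear key
  have hadd : ∀ f g : ℝ → ℝ, ContinuousOn f (Icc (-1) 1) → ContinuousOn g (Icc (-1) 1) →
      ∫ x in (-1 : ℝ)..1, f x = 0 → ∫ x in (-1 : ℝ)..1, g x = 0 →
      ∫ x in (-1 : ℝ)..1, (f x + g x) = 0 := fun f g hf hg h1 h2 => by
    rw [intervalIntegral.integral_add (integrable_of_continuousOn hf)
      (integrable_of_continuousOn hg), h1, h2, add_zero]
  rw [hadd _ _ (by fun_prop) (by fun_prop) z1 z2] at hR
  linarith

lemma continuousOn_integral_param {F : ℝ → ℝ → ℝ} {a b : ℝ}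
    (hF : ContinuousOn (fun z : ℝ × ℝ => F z.1 z.2) (Icc a b ×ˢ Icc (-1) 1)) :
    ContinuousOn (fun t => ∫ x in (-1 : ℝ)..1, F t x) (Icc a b) := by
  rcases lt_or_ge b a with h | h
  · simp [Icc_eq_empty_of_lt h]
  set G : ℝ → ℝ → ℝ := fun t x => F (projIcc a b h t) (projIcc (-1 : ℝ) 1 neg_one_le_one' x)
  have hG : Continuous (Function.uncurry G) := by
    have : Continuous fun z : ℝ × ℝ => (((projIcc a b h z.1 : ℝ), (projIcc (-1 : ℝ) 1 neg_one_le_one' z.2 : ℝ)) : ℝ × ℝ) := by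
      fun_prop
    exact hF.comp_continuous this fun z => ⟨(projIcc a b h z.1).2, (projIcc (-1 : ℝ) 1 neg_one_le_one' z.2).2⟩
  have hc := (intervalIntegral.continuous_parametric_intervalIntegral_of_continuous' (μ := volume) hG (-1) 1)
  refine hc.continuousOn.congr fun t ht => ?_
  refine intervalIntegral.integral_congr fun x hx => ?_
  rw [uIcc_eq] at hx
  simp only [G]
  rw [projIcc_of_mem h ht, projIcc_of_mem neg_one_le_one' hx]

lemma hasDerivAt_integral_param {F F' : ℝ → ℝ → ℝ} {a b t : ℝ} (ht : t ∈ Ioo a b)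
    (hF : ContinuousOn (fun z : ℝ × ℝ => F z.1 z.2) (Icc a b ×ˢ Icc (-1) 1))
    (hF' : ContinuousOn (fun z : ℝ × ℝ => F' z.1 z.2) (Icc a b ×ˢ Icc (-1) 1))
    (h : ∀ s ∈ Ioo a b, ∀ x ∈ Icc (-1 : ℝ) 1, HasDerivAt (fun s => F s x) (F' s x) s) :
    HasDerivAt (fun t => ∫ x in (-1 : ℝ)..1, F t x) (∫ x in (-1 : ℝ)..1, F' t x) t := by
  obtain ⟨M, hM⟩ := (isCompact_Icc.prod isCompact_Icc).exists_bound_of_continuousOn hF'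
  have slice : ∀ {G : ℝ → ℝ → ℝ}, ContinuousOn (fun z : ℝ × ℝ => G z.1 z.2) (Icc a b ×ˢ Icc (-1) 1) →
      ∀ s ∈ Icc a b, ContinuousOn (G s) (Icc (-1) 1) := fun hG s hs =>
    hG.comp (f := fun x => (s, x)) (by fun_prop) fun x hx => ⟨hs, hx⟩
  have hm : ∀ {G : ℝ → ℝ → ℝ}, ContinuousOn (fun z : ℝ × ℝ => G z.1 z.2) (Icc a b ×ˢ Icc (-1) 1) →
      ∀ s ∈ Icc a b, AEStronglyMeasurable (G s) (volume.restrict (uIoc (-1 : ℝ) 1)) := fun hG s hs => by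
    rw [uIoc_of_le neg_one_le_one']
    exact ((slice hG s hs).mono Ioc_subset_Icc_self).aestronglyMeasurable measurableSet_Ioc
  have hsub : ∀ x, x ∈ uIoc (-1 : ℝ) 1 → x ∈ Icc (-1 : ℝ) 1 := fun x hx => by
    rw [uIoc_of_le neg_one_le_one'] at hx
    exact Ioc_subset_Icc_self hx
  refine (intervalIntegral.hasDerivAt_integral_of_dominated_loc_of_deriv_le (bound := fun _ => M)
    (Ioo_mem_nhds ht.1 ht.2) ?_ (integrable_of_continuousOn (slice hF t (Ioo_subset_Icc_self ht)))
    (hm hF' t (Ioo_subset_Icc_self ht)) ?_ intervalIntegrable_const ?_).2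
  · filter_upwards [Ioo_mem_nhds ht.1 ht.2] with s hs
    exact hm hF s (Ioo_subset_Icc_self hs)
  · exact ae_of_all _ fun x hx s hs => hM (s, x) ⟨Ioo_subset_Icc_self hs, hsub x hx⟩
  · exact ae_of_all _ fun x hx s hs => h s hs x (hsub x hx)

/-- `V` is the time derivative of `P` on `[0, T]`, uniformly with all space derivatives. -/
structure PolyDeriv (T : ℝ) (P V : ℝ → ℝ[X]) : Prop where
  cont : ∀ k, ContinuousOn (fun z : ℝ × ℝ => (derivative^[k] (P z.1)).eval z.2)
    (Icc 0 T ×ˢ Icc (-1) 1)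
  cont' : ∀ k, ContinuousOn (fun z : ℝ × ℝ => (derivative^[k] (V z.1)).eval z.2)
    (Icc 0 T ×ˢ Icc (-1) 1)
  deriv : ∀ k x, ∀ t ∈ Icc 0 T, HasDerivWithinAt (fun t => (derivative^[k] (P t)).eval x)
    ((derivative^[k] (V t)).eval x) (Icc 0 T) t

lemma PolyDeriv.hasDerivAt {T : ℝ} {P V : ℝ → ℝ[X]} (h : PolyDeriv T P V) (k : ℕ) (x : ℝ) {t : ℝ}
    (ht : t ∈ Ioo 0 T) : HasDerivAt (fun t => (derivative^[k] (P t)).eval x)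
    ((derivative^[k] (V t)).eval x) t :=
  (h.deriv k x t (Ioo_subset_Icc_self ht)).hasDerivAt (Icc_mem_nhds ht.1 ht.2)

/-- The energy density. -/
def eDens (a : ℝ) (p w : ℝ[X]) (x : ℝ) : ℝ :=
  1 / 2 * a ^ 3 * (dd x * w.eval x ^ 2 + dd x ^ 6 * (derivative^[5] w).eval x ^ 2)
    + 1 / 2 * (dd x * p.eval x ^ 2) + dd x ^ 2 * (sv p x 0 ^ 2 * yv p x)
    + 21 / 2 * (dd x ^ 6 * sv p x 4 ^ 2) + dd x ^ 7 * sv p x 5 ^ 2 * yv p x ^ 3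

lemma continuousOn_yv_param {P : ℝ → ℝ[X]} {S : Set (ℝ × ℝ)}
    (h : ContinuousOn (fun z : ℝ × ℝ => sv (P z.1) z.2 0) S) (hs : ∀ z ∈ S, |sv (P z.1) z.2 0| ≤ 1 / 2) :
    ContinuousOn (fun z : ℝ × ℝ => yv (P z.1) z.2) S := by
  unfold yv
  refine ContinuousOn.inv₀ (by fun_prop) fun z hz => ?_
  have := (abs_le.1 (hs z hz)).1
  intro h0
  linarith

section

variable {T : ℝ} {P V Z : ℝ → ℝ[X]} {α α' : ℝ → ℝ}

lemma continuousOn_eDens (hP : PolyDeriv T P V) (hα : ContinuousOn α (Icc 0 T))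
    (hs : ∀ t ∈ Icc 0 T, ∀ x ∈ Icc (-1 : ℝ) 1, |sv (P t) x 0| ≤ 1 / 2) :
    ContinuousOn (fun z : ℝ × ℝ => eDens (α z.1) (P z.1) (V z.1) z.2) (Icc 0 T ×ˢ Icc (-1) 1) := by
  have c1 : ∀ k, ContinuousOn (fun z : ℝ × ℝ => sv (P z.1) z.2 k) (Icc 0 T ×ˢ Icc (-1) 1) :=
    fun k => hP.cont (k + 1)
  have c2 := continuousOn_yv_param (c1 0) fun z hz => hs z.1 hz.1 z.2 hz.2
  have c3 := hP.cont 0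
  have c4 := hP.cont' 0
  have c5 := hP.cont' 5
  simp only [Function.iterate_zero, id] at c3 c4
  have c6 : ContinuousOn (fun z : ℝ × ℝ => α z.1) (Icc 0 T ×ˢ Icc (-1) 1) :=
    hα.comp continuousOn_fst fun z hz => hz.1
  have cd : ContinuousOn (fun z : ℝ × ℝ => dd z.2) (Icc 0 T ×ˢ Icc (-1) 1) :=
    (continuous_dd.comp continuous_snd).continuousOn
  exact (((((continuousOn_const.mul (c6.pow 3)).mul ((cd.mul (c4.pow 2)).add
    ((cd.pow 6).mul (c5.pow 2)))).add (continuousOn_const.mul (cd.mul (c3.pow 2)))).add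
    ((cd.pow 2).mul (((c1 0).pow 2).mul c2))).add
    (continuousOn_const.mul ((cd.pow 6).mul ((c1 4).pow 2)))).add
    (((cd.pow 7).mul ((c1 5).pow 2)).mul (c2.pow 3))

lemma continuousOn_eDot_param (hP : PolyDeriv T P V) (hV : PolyDeriv T V Z)
    (hα : ContinuousOn α (Icc 0 T)) (hα' : ContinuousOn α' (Icc 0 T))
    (hs : ∀ t ∈ Icc 0 T, ∀ x ∈ Icc (-1 : ℝ) 1, |sv (P t) x 0| ≤ 1 / 2) :
    ContinuousOn (fun z : ℝ × ℝ => eDot (α z.1) (α' z.1) (P z.1) (V z.1) (Z z.1) z.2)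
      (Icc 0 T ×ˢ Icc (-1) 1) := by
  have c1 : ∀ k, ContinuousOn (fun z : ℝ × ℝ => sv (P z.1) z.2 k) (Icc 0 T ×ˢ Icc (-1) 1) :=
    fun k => hP.cont (k + 1)
  have c2 := continuousOn_yv_param (c1 0) fun z hz => hs z.1 hz.1 z.2 hz.2
  have c3 := hP.cont 0
  have c4 := hV.cont 0
  have c5 := hV.cont
  have c7 := hV.cont' 0
  have c8 := hV.cont' 5
  have c9 := hV.cont 1
  simp only [Function.iterate_zero, id, Function.iterate_one] at c3 c4 c7 c9
  have c6 : ContinuousOn (fun z : ℝ × ℝ => α z.1) (Icc 0 T ×ˢ Icc (-1) 1) :=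
    hα.comp continuousOn_fst fun z hz => hz.1
  have c6' : ContinuousOn (fun z : ℝ × ℝ => α' z.1) (Icc 0 T ×ˢ Icc (-1) 1) :=
    hα'.comp continuousOn_fst fun z hz => hz.1
  have cd : ContinuousOn (fun z : ℝ × ℝ => dd z.2) (Icc 0 T ×ˢ Icc (-1) 1) :=
    (continuous_dd.comp continuous_snd).continuousOn
  simp only [eDot, Function.iterate_one]
  exact ((((((((continuousOn_const.mul (c6.pow 2)).mul c6').mul ((cd.mul (c4.pow 2)).add
    ((cd.pow 6).mul ((c5 5).pow 2)))).add ((c6.pow 3).mul ((cd.mul (c4.mul c7)).add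
    ((cd.pow 6).mul ((c5 5).mul c8))))).add (cd.mul (c3.mul c4))).add
    (((cd.pow 2).mul (continuousOn_const.sub (c2.pow 2))).mul c9)).add
    (continuousOn_const.mul ((cd.pow 6).mul ((c1 4).mul (c5 5))))).add
    (continuousOn_const.mul ((((cd.pow 7).mul (c1 5)).mul (c5 6)).mul (c2.pow 3)))).sub
    (continuousOn_const.mul ((((cd.pow 7).mul ((c1 5).pow 2)).mul c9).mul (c2.pow 4)))

lemma hasDerivAt_eDens (hP : PolyDeriv T P V) (hV : PolyDeriv T V Z)
    (hα : ∀ t ∈ Ioo 0 T, HasDerivAt α (α' t) t)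
    (hs : ∀ t ∈ Icc 0 T, ∀ x ∈ Icc (-1 : ℝ) 1, |sv (P t) x 0| ≤ 1 / 2) {t : ℝ} (ht : t ∈ Ioo 0 T)
    {x : ℝ} (hx : x ∈ Icc (-1 : ℝ) 1) :
    HasDerivAt (fun t => eDens (α t) (P t) (V t) x) (eDot (α t) (α' t) (P t) (V t) (Z t) x) t := by
  have hsk : ∀ k, HasDerivAt (fun t => sv (P t) x k) ((derivative^[k + 1] (V t)).eval x) t :=
    fun k => hP.hasDerivAt (k + 1) x ht
  have hb := (abs_le.1 (hs t (Ioo_subset_Icc_self ht) x hx)).1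
  have hne : 1 + sv (P t) x 0 ≠ 0 := by intro h; linarith
  have hy : HasDerivAt (fun t => yv (P t) x)
      (-(yv (P t) x) ^ 2 * (derivative^[1] (V t)).eval x) t := by
    refine (((hsk 0).const_add 1).fun_inv hne).congr_deriv ?_
    rw [yv, inv_pow]
    simp only [zero_add]
    ring
  have h0 := hP.hasDerivAt 0 x ht
  have h1 := hV.hasDerivAt 0 x ht
  have h5 := hV.hasDerivAt 5 x ht
  simp only [Function.iterate_zero, id] at h0 h1
  have ha := hα t ht
  refine ((((((ha.fun_pow 3).const_mul (1 / 2)).fun_mul (((h1.fun_pow 2).const_mul (dd x)).fun_add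
    ((h5.fun_pow 2).const_mul (dd x ^ 6)))).fun_add
    (((h0.fun_pow 2).const_mul (dd x)).const_mul (1 / 2))).fun_add
    ((((hsk 0).fun_pow 2).fun_mul hy).const_mul (dd x ^ 2))).fun_add
    ((((hsk 4).fun_pow 2).const_mul (dd x ^ 6)).const_mul (21 / 2))).fun_add
    ((((hsk 5).fun_pow 2).const_mul (dd x ^ 7)).fun_mul (hy.fun_pow 3)) |>.congr_deriv ?_
  have hye : yv (P t) x * (1 + sv (P t) x 0) = 1 := inv_mul_cancel₀ hne
  simp only [eDot, Function.iterate_one]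
  norm_num
  generalize yv (P t) x = y at *
  generalize sv (P t) x 0 = s at *
  have hys : y * s = 1 - y := by linear_combination hye
  have e : s ^ 2 * y ^ 2 = (1 - y) ^ 2 := by rw [← hys]; ring
  linear_combination (-(dd x ^ 2 * (derivative (V t)).eval x)) * e
    + 2 * (dd x ^ 2 * (derivative (V t)).eval x) * hys

end

/-- The properties of the scale factor which are used. -/
structure Scale (α α' : ℝ → ℝ) (c : ℝ) : Prop where
  deriv : ∀ t ∈ Ici (0 : ℝ), HasDerivWithinAt α (α' t) (Ici 0) t
  cont' : ContinuousOn α' (Ici 0)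
  one_le : ∀ t ∈ Ici (0 : ℝ), 1 ≤ α t
  nonneg' : ∀ t ∈ Ici (0 : ℝ), 0 ≤ α' t
  c_pos : 0 < c
  growth : ∀ t ∈ Ici (0 : ℝ), c * (1 + t) ≤ α t
  init : α 0 = 1

lemma Scale.cont {α α' : ℝ → ℝ} {c : ℝ} (h : Scale α α' c) : ContinuousOn α (Ici 0) :=
  fun t ht => (h.deriv t ht).continuousWithinAt

lemma Scale.hasDerivAt {α α' : ℝ → ℝ} {c : ℝ} (h : Scale α α' c) {t : ℝ} (ht : 0 < t) :
    HasDerivAt α (α' t) t :=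
  (h.deriv t ht.le).hasDerivAt (Ici_mem_nhds ht)

lemma exists_scale {α α' : ℝ → ℝ} (hαpos : ∀ t ∈ Ici (0 : ℝ), 0 < α t)
    (hα : ∀ t ∈ Ici (0 : ℝ), HasDerivWithinAt α (α' t) (Ici 0) t)
    (hα' : ∀ t ∈ Ici (0 : ℝ), HasDerivWithinAt α' ((α t ^ 2)⁻¹) (Ici 0) t)
    (hα0 : α 0 = 1) (hα'0 : 0 ≤ α' 0) : ∃ c, Scale α α' c := by
  have c1 : ContinuousOn α (Ici 0) := fun t ht => (hα t ht).continuousWithinAt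
  have c2 : ContinuousOn α' (Ici 0) := fun t ht => (hα' t ht).continuousWithinAt
  have d1 : ∀ t, 0 < t → HasDerivAt α (α' t) t := fun t ht => (hα t ht.le).hasDerivAt (Ici_mem_nhds ht)
  have d2 : ∀ t, 0 < t → HasDerivAt α' ((α t ^ 2)⁻¹) t := fun t ht =>
    (hα' t ht.le).hasDerivAt (Ici_mem_nhds ht)
  have m2 : StrictMonoOn α' (Ici 0) := by
    refine strictMonoOn_of_deriv_pos (convex_Ici 0) c2 fun t ht => ?_
    rw [interior_Ici] at ht
    rw [(d2 t ht).deriv]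
    have := hαpos t (mem_Ici.2 (le_of_lt ht))
    positivity
  have n2 : ∀ t ∈ Ici (0 : ℝ), 0 ≤ α' t := fun t ht =>
    hα'0.trans (m2.monotoneOn (mem_Ici.2 le_rfl) ht ht)
  have m1 : MonotoneOn α (Ici 0) := by
    refine monotoneOn_of_deriv_nonneg (convex_Ici 0) c1
      (fun t ht => ?_) fun t ht => ?_
    · rw [interior_Ici] at ht
      exact (d1 t ht).differentiableAt.differentiableWithinAt
    · rw [interior_Ici] at ht
      rw [(d1 t ht).deriv]
      exact n2 t (mem_Ici.2 (le_of_lt ht))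
  have n1 : ∀ t ∈ Ici (0 : ℝ), 1 ≤ α t := fun t ht => hα0 ▸ m1 (mem_Ici.2 le_rfl) ht ht
  have hp : 0 < α' 1 := hα'0.trans_lt (m2 (mem_Ici.2 le_rfl) (by simp) (by norm_num))
  have m3 : MonotoneOn (fun t => α t - α' 1 * t) (Ici 1) := by
    refine monotoneOn_of_deriv_nonneg (convex_Ici 1) ((c1.mono (Ici_subset_Ici.2 zero_le_one)).sub
      (by fun_prop)) (fun t ht => ?_) fun t ht => ?_
    · rw [interior_Ici] at ht
      have := d1 t (zero_lt_one.trans ht)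
      exact (this.sub ((hasDerivAt_id' t).const_mul (α' 1))).differentiableAt.differentiableWithinAt
    · rw [interior_Ici] at ht
      have := d1 t (zero_lt_one.trans ht)
      rw [(this.fun_sub ((hasDerivAt_id' t).const_mul (α' 1))).deriv]
      have := m2.monotoneOn (a := 1) (b := t) (by simp)
        (mem_Ici.2 (zero_lt_one.trans ht).le) (le_of_lt ht)
      linarith
  refine ⟨min (α' 1) (1 / 2), hα, c2, n1, n2, by positivity, fun t ht => ?_, hα0⟩
  have h1 := min_le_left (α' 1) (1 / 2)
  have h2 := min_le_right (α' 1) (1 / 2)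
  have h3 : 0 < min (α' 1) (1 / 2) := by positivity
  have ht0 : 0 ≤ t := ht
  rcases le_total t 1 with h | h
  · have := n1 t ht
    nlinarith
  · have h4 := m3 (mem_Ici.2 le_rfl) h h
    have := n1 1 (by simp)
    simp only at h4
    nlinarith

/-- The quantity controlled by the energy. -/
def Bq (a : ℝ) (p w : ℝ[X]) : ℝ := N6 p + a ^ 3 * N5 w

lemma Bq_le_integral_eDens {a : ℝ} (ha : 0 ≤ a) {p : ℝ[X]}
    (hs : ∀ x ∈ Icc (-1 : ℝ) 1, |sv p x 0| ≤ 1 / 2) (w : ℝ[X]) :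
    Bq a p w ≤ 4 * ∫ x in (-1 : ℝ)..1, eDens a p w x := by
  have i : ∀ (l : ℕ) (q : ℝ[X]), IntervalIntegrable (fun x => dd x ^ l * (q.eval x) ^ 2) volume (-1) 1 :=
    fun l q => (continuous_wt l q).intervalIntegrable _ _
  have e : Bq a p w = ∫ x in (-1 : ℝ)..1, (dd x ^ 1 * p.eval x ^ 2
      + dd x ^ 6 * (derivative^[5] p).eval x ^ 2 + dd x ^ 7 * (derivative^[6] p).eval x ^ 2
      + a ^ 3 * (dd x ^ 1 * w.eval x ^ 2 + dd x ^ 6 * (derivative^[5] w).eval x ^ 2)) := by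
    rw [intervalIntegral.integral_add (((i _ _).add (i _ _)).add (i _ _))
      (((i _ _).add (i _ _)).const_mul _), intervalIntegral.integral_add ((i _ _).add (i _ _)) (i _ _),
      intervalIntegral.integral_add (i _ _) (i _ _), intervalIntegral.integral_const_mul,
      intervalIntegral.integral_add (i _ _) (i _ _)]
    rfl
  have c1 := fun k => continuousOn_sv p k (Icc (-1) 1)
  have c2 := continuousOn_yv hs
  have c3 : ContinuousOn (eDens a p w) (Icc (-1) 1) := by
    unfold eDens
    fun_prop
  rw [e, ← intervalIntegral.integral_const_mul]
  refine intervalIntegral.integral_mono_on neg_one_le_one'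
    (integrable_of_continuousOn (by fun_prop))
    (integrable_of_continuousOn (by fun_prop)) fun x hx => ?_
  have hd := dd_nonneg hx
  have hb := abs_le.1 (hs x hx)
  have hy : 2 / 3 ≤ yv p x := by
    rw [yv, le_inv_comm₀ (by norm_num) (by linarith [hb.1])]
    linarith [hb.2]
  have hy3 : 1 / 4 ≤ yv p x ^ 3 := by
    calc (1 / 4 : ℝ) ≤ (2 / 3) ^ 3 := by norm_num
      _ ≤ yv p x ^ 3 := by gcongr
  have hy0 : 0 ≤ yv p x := by linarith
  have t1 : 0 ≤ dd x ^ 2 * (sv p x 0 ^ 2 * yv p x) := by positivity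
  have t2 : dd x ^ 7 * sv p x 5 ^ 2 * (1 / 4) ≤ dd x ^ 7 * sv p x 5 ^ 2 * yv p x ^ 3 :=
    mul_le_mul_of_nonneg_left hy3 (by positivity)
  have t3 : 0 ≤ dd x ^ 6 * sv p x 4 ^ 2 := by positivity
  have t4 : 0 ≤ dd x * p.eval x ^ 2 := mul_nonneg hd (sq_nonneg _)
  have t5 : 0 ≤ a ^ 3 * (dd x * w.eval x ^ 2 + dd x ^ 6 * (derivative^[5] w).eval x ^ 2) :=
    mul_nonneg (pow_nonneg ha 3) (add_nonneg (mul_nonneg hd (sq_nonneg _))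
      (mul_nonneg (pow_nonneg hd 6) (sq_nonneg _)))
  have e5 : sv p x 4 = (derivative^[5] p).eval x := rfl
  have e6 : sv p x 5 = (derivative^[6] p).eval x := rfl
  unfold eDens
  rw [← e5, ← e6, pow_one]
  linarith

lemma hasDerivAt_inv_sqrt {t : ℝ} (ht : 0 < 1 + t) :
    HasDerivAt (fun t => (√(1 + t))⁻¹) (-(1 / 2) * ((1 + t) * √(1 + t))⁻¹) t := by
  have h := ((hasDerivAt_id' t).const_add 1).sqrt ht.ne'
  have hs : 0 < √(1 + t) := Real.sqrt_pos.2 ht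
  refine (h.fun_inv hs.ne').congr_deriv ?_
  rw [Real.sq_sqrt ht.le]
  field_simp

/-- A priori estimate: as long as the energy is small it is controlled by the data. -/
lemma exists_apriori {α α' : ℝ → ℝ} {c : ℝ} (hα : Scale α α' c) : ∃ δ > (0 : ℝ), δ ≤ 1 ∧
    (∀ p : ℝ[X], N6 p ≤ δ → ∀ x ∈ Icc (-1 : ℝ) 1, |sv p x 0| ≤ 1 / 2) ∧
    ∀ (N : ℕ) (T : ℝ) (P V Z : ℝ → ℝ[X]), 0 ≤ T → PolyDeriv T P V → PolyDeriv T V Z → P 0 = 0 →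
      (∀ t ∈ Icc 0 T, (V t).natDegree ≤ N) →
      (∀ t ∈ Icc 0 T, ∀ q : ℝ[X], q.natDegree ≤ N →
        ∫ x in (-1 : ℝ)..1,
          dd x * (C (α t ^ 3) * Z t + C (2 * α t ^ 2 * α' t) * V t + P t).eval x * q.eval x =
        ∫ x in (-1 : ℝ)..1, dd x ^ 2 * (yv (P t) x ^ 2 - 1) * (derivative q).eval x) →
      (∀ t ∈ Icc 0 T, Bq (α t) (P t) (V t) ≤ δ) →
      Bq (α T) (P T) (V T) ≤ 6 * N5 (V 0) := by
  obtain ⟨K, hK, κ₀, hκ₀, hflux⟩ := exists_flux_bound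
  obtain ⟨C₁, hC₁, htop⟩ := exists_topDens_bound
  set m := √(c ^ 3) with hm
  have hc := hα.c_pos
  have hm0 : 0 < m := Real.sqrt_pos.2 (by positivity)
  set L := 4 * K * C₁ * m⁻¹ with hL
  have hL0 : 0 < L := by positivity
  set κ := min (min κ₀ 1) (1 / (2 * L)) with hκ
  have hκ0 : 0 < κ := by positivity
  have hκ1 : κ ≤ κ₀ := (min_le_left _ _).trans (min_le_left _ _)
  have hκ2 : κ ≤ 1 := (min_le_left _ _).trans (min_le_right _ _)
  have hκ3 : κ * L ≤ 1 / 2 := by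
    calc κ * L ≤ 1 / (2 * L) * L := by gcongr; exact min_le_right _ _
      _ = 1 / 2 := by field_simp
  have hN0 : N5 (0 : ℝ[X]) = 0 := by simp [N5, J]
  have small : ∀ p : ℝ[X], N6 p ≤ κ ^ 2 → ∀ x ∈ Icc (-1 : ℝ) 1, |sv p x 0| ≤ 1 / 2 :=
    fun p hp x hx => (hflux p 0 1 κ one_pos hκ0.le hκ1 hp (by rw [hN0, mul_zero]; positivity) x hx).1
  refine ⟨κ ^ 2, by positivity, pow_le_one₀ hκ0.le hκ2, small, ?_⟩
  intro N T P V Z hT hP hV hP0 hdeg hweak hB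
  have hα0 : ∀ t ∈ Icc 0 T, 0 ≤ α t := fun t ht => zero_le_one.trans (hα.one_le t ht.1)
  have hN6 : ∀ t ∈ Icc 0 T, N6 (P t) ≤ κ ^ 2 := fun t ht => le_trans
    (le_add_of_nonneg_right (mul_nonneg (pow_nonneg (hα0 t ht) 3) (N5_nonneg _))) (hB t ht)
  have hN5 : ∀ t ∈ Icc 0 T, α t ^ 3 * N5 (V t) ≤ κ ^ 2 := fun t ht => le_trans
    (le_add_of_nonneg_left (N6_nonneg _)) (hB t ht)
  have hs : ∀ t ∈ Icc 0 T, ∀ x ∈ Icc (-1 : ℝ) 1, |sv (P t) x 0| ≤ 1 / 2 :=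
    fun t ht => small _ (hN6 t ht)
  have cα : ContinuousOn α (Icc 0 T) := hα.cont.mono Icc_subset_Ici_self
  have cα' : ContinuousOn α' (Icc 0 T) := hα.cont'.mono Icc_subset_Ici_self
  set En : ℝ → ℝ := fun t => ∫ x in (-1 : ℝ)..1, eDens (α t) (P t) (V t) x with hEn
  have cE : ContinuousOn En (Icc 0 T) := continuousOn_integral_param (continuousOn_eDens hP cα hs)
  have dE : ∀ t ∈ Ioo 0 T, HasDerivAt En
      (∫ x in (-1 : ℝ)..1, eDot (α t) (α' t) (P t) (V t) (Z t) x) t := fun t ht =>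
    hasDerivAt_integral_param ht (continuousOn_eDens hP cα hs)
      (continuousOn_eDot_param hP hV cα cα' hs) fun s hs' x hx =>
        hasDerivAt_eDens hP hV (fun r hr => hα.hasDerivAt hr.1) hs hs' hx
  have low : ∀ t ∈ Icc 0 T, Bq (α t) (P t) (V t) ≤ 4 * En t := fun t ht =>
    Bq_le_integral_eDens (hα0 t ht) (hs t ht) (V t)
  have hEn0 : ∀ t ∈ Icc 0 T, 0 ≤ En t := fun t ht => by
    have h1 := low t ht
    have h2 : 0 ≤ Bq (α t) (P t) (V t) :=
      add_nonneg (N6_nonneg _) (mul_nonneg (pow_nonneg (hα0 t ht) 3) (N5_nonneg _))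
    linarith
  have up : ∀ t ∈ Ioo 0 T, ∫ x in (-1 : ℝ)..1, eDot (α t) (α' t) (P t) (V t) (Z t) x ≤
      κ * L * ((1 + t) * √(1 + t))⁻¹ * En t := by
    intro t ht
    have ht' := Ioo_subset_Icc_self ht
    have ha := hα0 t ht'
    have ha1 := hα.one_le t ht'.1
    have ht1 : 0 < 1 + t := by linarith [ht.1]
    rw [integral_eDot (hdeg t ht') (hs t ht') (hweak t ht')]
    set lam := √(α t ^ 3)
    have hlam : 0 < lam := Real.sqrt_pos.2 (by positivity)
    have hlam2 : lam ^ 2 = α t ^ 3 := Real.sq_sqrt (by positivity)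
    have hlm : m * ((1 + t) * √(1 + t)) ≤ lam := by
      apply Real.le_sqrt_of_sq_le
      rw [mul_pow, mul_pow, Real.sq_sqrt ht1.le, hm, Real.sq_sqrt (by positivity)]
      calc c ^ 3 * ((1 + t) ^ 2 * (1 + t)) = (c * (1 + t)) ^ 3 := by ring
        _ ≤ _ := by
          have := hα.growth t ht'.1
          gcongr
    have hst : 0 < (1 + t) * √(1 + t) := mul_pos ht1 (Real.sqrt_pos.2 ht1)
    have hli : lam⁻¹ ≤ m⁻¹ * ((1 + t) * √(1 + t))⁻¹ := by
      rw [← mul_inv]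
      exact inv_anti₀ (by positivity) hlm
    have hfl : ∫ x in (-1 : ℝ)..1, flux (P t) (V t) x ≤
        ∫ x in (-1 : ℝ)..1, K * κ * lam⁻¹ * topDens lam (P t) (V t) x := by
      refine intervalIntegral.integral_mono_on neg_one_le_one'
        (integrable_of_continuousOn (continuousOn_flux (hs t ht') _))
        (integrable_of_continuousOn ?_) fun x hx => ?_
      · have c1 := fun k => continuousOn_sv (P t) k (Icc (-1) 1)
        unfold topDens
        fun_prop
      · exact (hflux (P t) (V t) lam κ hlam hκ0.le hκ1 (hN6 t ht')
          (by rw [hlam2]; exact hN5 t ht') x hx).2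
    rw [intervalIntegral.integral_const_mul] at hfl
    have h1 : 0 ≤ α t ^ 2 * α' t * (J 1 (V t) + J 6 (derivative^[5] (V t))) :=
      mul_nonneg (mul_nonneg (sq_nonneg _) (hα.nonneg' t ht'.1)) (add_nonneg (J_nonneg _ _) (J_nonneg _ _))
    have h2 := htop lam (P t) (V t)
    have h3 := low t ht'
    have hE := hEn0 t ht'
    calc _ ≤ K * κ * lam⁻¹ * ∫ x in (-1 : ℝ)..1, topDens lam (P t) (V t) x := by linarith
      _ ≤ K * κ * lam⁻¹ * (C₁ * (lam ^ 2 * N5 (V t) + N6 (P t))) := by gcongr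
      _ = K * κ * lam⁻¹ * (C₁ * Bq (α t) (P t) (V t)) := by rw [hlam2, Bq]; ring
      _ ≤ K * κ * lam⁻¹ * (C₁ * (4 * En t)) := by gcongr
      _ ≤ K * κ * (m⁻¹ * ((1 + t) * √(1 + t))⁻¹) * (C₁ * (4 * En t)) := by gcongr
      _ = _ := by rw [hL]; ring
  have anti : AntitoneOn (fun t => En t * Real.exp (2 * (κ * L) * (√(1 + t))⁻¹)) (Icc 0 T) := by
    have dG : ∀ t ∈ Ioo 0 T, HasDerivAt (fun t => En t * Real.exp (2 * (κ * L) * (√(1 + t))⁻¹))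
        _ t := fun t ht => (dE t ht).fun_mul
          (((hasDerivAt_inv_sqrt (by linarith [ht.1])).const_mul (2 * (κ * L))).exp)
    refine antitoneOn_of_deriv_nonpos (convex_Icc 0 T) (cE.mul ?_) ?_ ?_
    · refine (Real.continuous_exp.comp_continuousOn (ContinuousOn.mul continuousOn_const
        (ContinuousOn.inv₀ (by fun_prop) fun t ht => ?_)))
      exact (Real.sqrt_pos.2 (by linarith [ht.1])).ne'
    · rw [interior_Icc]
      exact fun t ht => (dG t ht).differentiableAt.differentiableWithinAt
    · rw [interior_Icc]
      intro t ht
      rw [(dG t ht).deriv]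
      have h1 := up t ht
      have h2 := mul_le_mul_of_nonneg_right h1 (Real.exp_pos (2 * (κ * L) * (√(1 + t))⁻¹)).le
      linarith
  have h1 := anti (left_mem_Icc.2 hT) (right_mem_Icc.2 hT) hT
  have h2 := low T (right_mem_Icc.2 hT)
  have h3 := hEn0 T (right_mem_Icc.2 hT)
  have h4 : En T ≤ En T * Real.exp (2 * (κ * L) * (√(1 + T))⁻¹) :=
    le_mul_of_one_le_right h3 (Real.one_le_exp (by positivity))
  have h5 : Real.exp (2 * (κ * L) * (√(1 + 0))⁻¹) ≤ 3 := by
    rw [add_zero, Real.sqrt_one, inv_one, mul_one]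
    calc Real.exp (2 * (κ * L)) ≤ Real.exp 1 := Real.exp_le_exp.2 (by linarith)
      _ ≤ 3 := by linarith [Real.exp_one_lt_d9]
  have h6 : En 0 = 1 / 2 * N5 (V 0) := by
    have i : ∀ (l : ℕ) (q : ℝ[X]), IntervalIntegrable (fun x => dd x ^ l * (q.eval x) ^ 2) volume (-1) 1 :=
      fun l q => (continuous_wt l q).intervalIntegrable _ _
    simp only [hEn, eDens, hP0, hα.init, sv]
    simp only [iterate_derivative_zero, eval_zero]
    rw [N5, J, J, ← intervalIntegral.integral_add (i _ _) (i _ _), ← intervalIntegral.integral_const_mul]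
    refine intervalIntegral.integral_congr fun x _ => ?_
    simp
  have h7 := mul_le_mul_of_nonneg_left h5 (hEn0 0 (left_mem_Icc.2 hT))
  simp only at h1
  linarith

/-- The weighted inner product of polynomials. -/
def ip : LinearMap.BilinForm ℝ ℝ[X] :=
  LinearMap.mk₂ ℝ (fun p q => ∫ x in (-1 : ℝ)..1, dd x * (p.eval x * q.eval x))
    (fun p q r => by
      rw [← intervalIntegral.integral_add (Continuous.intervalIntegrable (by fun_prop) _ _)
        (Continuous.intervalIntegrable (by fun_prop) _ _)]
      congr 1; ext x; simp only [eval_add]; ring)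
    (fun c p q => by
      rw [smul_eq_mul, ← intervalIntegral.integral_const_mul]
      congr 1; ext x; simp only [eval_smul, smul_eq_mul]; ring)
    (fun p q r => by
      rw [← intervalIntegral.integral_add (Continuous.intervalIntegrable (by fun_prop) _ _)
        (Continuous.intervalIntegrable (by fun_prop) _ _)]
      congr 1; ext x; simp only [eval_add]; ring)
    (fun c p q => by
      rw [smul_eq_mul, ← intervalIntegral.integral_const_mul]
      congr 1; ext x; simp only [eval_smul, smul_eq_mul]; ring)

lemma ip_apply (p q : ℝ[X]) : ip p q = ∫ x in (-1 : ℝ)..1, dd x * (p.eval x * q.eval x) := rfl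

lemma ip_comm (p q : ℝ[X]) : ip p q = ip q p := by
  simp only [ip_apply, mul_comm (p.eval _)]

lemma ip_self (p : ℝ[X]) : ip p p = J 1 p := by
  simp only [ip_apply, J, pow_one, sq]

lemma J_one_pos {p : ℝ[X]} (hp : p ≠ 0) : 0 < J 1 p := by
  refine intervalIntegral.integral_pos (by norm_num) (continuous_wt 1 p).continuousOn
    (fun x hx => ?_) ?_
  · have := dd_nonneg (Ioc_subset_Icc_self hx)
    positivity
  · by_contra! h
    apply hp
    refine p.eq_zero_of_infinite_isRoot ((Ioo_infinite (show (-1 : ℝ) < 1 by norm_num)).mono ?_)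
    intro x hx
    have h1 := h x (Ioo_subset_Icc_self hx)
    have h2 := dd_pos hx
    have h3 : p.eval x ^ 2 ≤ 0 := by
      by_contra! h4
      have : 0 < dd x ^ 1 * p.eval x ^ 2 := by positivity
      linarith
    exact pow_eq_zero_iff (two_ne_zero) |>.1 (le_antisymm h3 (sq_nonneg _))

/-- Polynomials of degree at most `N` have a weighted orthonormal basis. -/
lemma exists_orthonormal (N : ℕ) : ∃ (n : ℕ) (e : Fin n → ℝ[X]), (∀ i, (e i).natDegree ≤ N) ∧
    (∀ i j, ip (e i) (e j) = if i = j then 1 else 0) ∧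
    ∀ q : ℝ[X], q.natDegree ≤ N → q = ∑ i, C (ip q (e i)) * e i := by
  set W := degreeLT ℝ (N + 1) with hW
  have hdeg : ∀ q : ℝ[X], q ∈ W ↔ q.natDegree ≤ N := by
    intro q
    rw [hW, mem_degreeLT, ← Nat.lt_succ_iff]
    rcases eq_or_ne q 0 with rfl | hq
    · simp
    · exact (natDegree_lt_iff_degree_lt hq).symm
  let B : LinearMap.BilinForm ℝ W := ip.restrict W
  have hB : LinearMap.IsSymm B := ⟨fun p q => ip_comm p q⟩
  have : Invertible (2 : ℝ) := invertibleOfNonzero two_ne_zero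
  obtain ⟨v, hv⟩ := LinearMap.BilinForm.exists_orthogonal_basis hB
  have hv' : ∀ i j, i ≠ j → ip (v i : ℝ[X]) (v j) = 0 := fun i j h => hv h
  have hv0 : ∀ i, 0 < J 1 (v i : ℝ[X]) := fun i => J_one_pos (by
    simpa using v.ne_zero i)
  set r : Fin _ → ℝ := fun i => (√(J 1 (v i : ℝ[X])))⁻¹ with hr
  have hr2 : ∀ i, r i * r i * J 1 (v i : ℝ[X]) = 1 := by
    intro i
    simp only [hr]
    rw [← mul_inv, Real.mul_self_sqrt (hv0 i).le, inv_mul_cancel₀ (hv0 i).ne']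
  refine ⟨_, fun i => r i • (v i : ℝ[X]), fun i => ?_, fun i j => ?_, fun q hq => ?_⟩
  · exact (natDegree_smul_le _ _).trans ((hdeg _).1 (v i).2)
  · simp only [map_smul, LinearMap.smul_apply, smul_eq_mul]
    split_ifs with h
    · subst h
      rw [ip_self, ← hr2 i]; ring
    · rw [hv' i j h]; ring
  · have h1 := v.sum_repr ⟨q, (hdeg q).2 hq⟩
    have h2 : q = ∑ i, (v.repr ⟨q, (hdeg q).2 hq⟩ i) • (v i : ℝ[X]) := by
      have := congrArg (Subtype.val) h1
      rw [AddSubmonoidClass.coe_finsetSum] at this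
      exact this.symm
    set c := v.repr ⟨q, (hdeg q).2 hq⟩
    have h3 : ∀ i, ip q (v i) = c i * J 1 (v i : ℝ[X]) := by
      intro i
      conv_lhs => rw [h2]
      rw [map_sum, LinearMap.sum_apply, Finset.sum_eq_single i]
      · rw [map_smul, LinearMap.smul_apply, ip_self, smul_eq_mul]
      · intro j _ hj
        rw [map_smul, LinearMap.smul_apply, hv' j i hj, smul_zero]
      · simp
    conv_lhs => rw [h2]
    refine Finset.sum_congr rfl fun i _ => ?_
    rw [map_smul, h3, ← smul_eq_C_mul, smul_smul]
    congr 1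
    rw [smul_eq_mul]
    calc c i = c i * (r i * r i * J 1 (v i : ℝ[X])) := by rw [hr2, mul_one]
      _ = _ := by ring

/-- The polynomial with given coefficients in a family. -/
def pol {n : ℕ} (e : Fin n → ℝ[X]) (c : Fin n → ℝ) : ℝ[X] := ∑ i, C (c i) * e i

lemma natDegree_pol {n N : ℕ} {e : Fin n → ℝ[X]} (he : ∀ i, (e i).natDegree ≤ N) (c : Fin n → ℝ) :
    (pol e c).natDegree ≤ N := by
  refine natDegree_sum_le_of_forall_le _ _ fun i _ => ?_
  exact (natDegree_C_mul_le _ _).trans (he i)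

lemma iterate_derivative_pol {n : ℕ} (e : Fin n → ℝ[X]) (c : Fin n → ℝ) (k : ℕ) :
    derivative^[k] (pol e c) = pol (fun i => derivative^[k] (e i)) c := by
  simp only [pol, iterate_derivative_sum, iterate_derivative_C_mul]

lemma eval_pol {n : ℕ} (e : Fin n → ℝ[X]) (c : Fin n → ℝ) (x : ℝ) :
    (pol e c).eval x = ∑ i, c i * (e i).eval x := by
  simp [pol, eval_finsetSum]

lemma ip_pol {n : ℕ} {e : Fin n → ℝ[X]} (he : ∀ i j, ip (e i) (e j) = if i = j then 1 else 0)
    (c : Fin n → ℝ) (i : Fin n) : ip (pol e c) (e i) = c i := by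
  rw [pol, map_sum, LinearMap.sum_apply, Finset.sum_eq_single i]
  · rw [← smul_eq_C_mul, map_smul, LinearMap.smul_apply, he, if_pos rfl, smul_eq_mul, mul_one]
  · intro j _ hj
    rw [← smul_eq_C_mul, map_smul, LinearMap.smul_apply, he, if_neg hj, smul_zero]
  · simp

lemma sq_coeff_le {n : ℕ} {e : Fin n → ℝ[X]} (he : ∀ i j, ip (e i) (e j) = if i = j then 1 else 0)
    (c : Fin n → ℝ) (i : Fin n) : c i ^ 2 ≤ J 1 (pol e c) := by
  rw [← ip_self]
  have : ip (pol e c) (pol e c) = ∑ j, c j ^ 2 := by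
    conv_lhs => rw [pol, map_sum, ← pol]
    refine Finset.sum_congr rfl fun j _ => ?_
    rw [← smul_eq_C_mul, map_smul, ip_pol he, smul_eq_mul, sq]
  rw [this]
  exact Finset.single_le_sum (f := fun j => c j ^ 2) (fun j _ => sq_nonneg _) (Finset.mem_univ i)

/-- If the coefficient curves are differentiable the polynomial curve is. -/
lemma polyDeriv_pol {n : ℕ} (e : Fin n → ℝ[X]) {T : ℝ} {p v : ℝ → Fin n → ℝ}
    (hp : ∀ t ∈ Icc 0 T, HasDerivWithinAt p (v t) (Icc 0 T) t) (hv : ContinuousOn v (Icc 0 T)) :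
    PolyDeriv T (fun t => pol e (p t)) (fun t => pol e (v t)) := by
  have key : ∀ (c : ℝ → Fin n → ℝ), ContinuousOn c (Icc 0 T) → ∀ k : ℕ,
      ContinuousOn (fun z : ℝ × ℝ => (derivative^[k] (pol e (c z.1))).eval z.2)
        (Icc 0 T ×ˢ Icc (-1) 1) := by
    intro c hc k
    simp only [iterate_derivative_pol, eval_pol]
    refine continuousOn_finsetSum _ fun i _ => ContinuousOn.mul ?_ ?_
    · exact ((continuousOn_pi.1 hc i).comp continuousOn_fst fun z hz => hz.1)
    · exact (Polynomial.continuous _).comp_continuousOn continuousOn_snd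
  refine ⟨key p fun t ht => (hp t ht).continuousWithinAt, key v hv, fun k x t ht => ?_⟩
  simp only [iterate_derivative_pol, eval_pol]
  exact HasDerivWithinAt.fun_sum fun i _ => (hasDerivWithinAt_pi.1 (hp t ht) i).mul_const _

/-- Truncation of a real number to `[-M, M]`. -/
def clamp (M x : ℝ) : ℝ := max (min x M) (-M)

lemma abs_clamp_le {M : ℝ} (hM : 0 ≤ M) (x : ℝ) : |clamp M x| ≤ M := by
  rw [abs_le]
  exact ⟨le_max_right _ _, max_le (min_le_right _ _) (by linarith)⟩

lemma abs_clamp_sub_le (M x y : ℝ) : |clamp M x - clamp M y| ≤ |x - y| :=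
  by
  refine (abs_max_sub_max_le_abs _ _ _).trans ((abs_min_sub_min_le_max _ _ _ _).trans ?_)
  simp

lemma clamp_eq {M x : ℝ} (h : |x| ≤ M) : clamp M x = x := by
  rw [abs_le] at h
  rw [clamp, min_eq_left h.2, max_eq_left h.1]

@[fun_prop]
lemma continuous_clamp (M : ℝ) : Continuous (clamp M) := by
  unfold clamp; fun_prop

/-- Global existence for a bounded Lipschitz ordinary differential equation. -/
lemma exists_ode {E : Type*} [NormedAddCommGroup E] [NormedSpace ℝ E] [CompleteSpace E]
    {F : ℝ → E → E} {T L K : ℝ} (hT : 0 ≤ T) (x₀ : E)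
    (hlip : ∀ t ∈ Icc 0 T, ∀ z w, ‖F t z - F t w‖ ≤ K * ‖z - w‖)
    (hcont : ∀ z, ContinuousOn (fun t => F t z) (Icc 0 T))
    (hbd : ∀ t ∈ Icc 0 T, ∀ z, ‖F t z‖ ≤ L) :
    ∃ y : ℝ → E, y 0 = x₀ ∧ ∀ t ∈ Icc 0 T, HasDerivWithinAt y (F t (y t)) (Icc 0 T) t := by
  have h0 : (0 : ℝ) ∈ Icc 0 T := left_mem_Icc.2 hT
  have : IsPicardLindelof F (⟨0, h0⟩ : Icc (0 : ℝ) T) x₀ (L.toNNReal * T.toNNReal) 0 L.toNNReal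
      K.toNNReal := by
    refine ⟨fun t ht => ?_, fun z _ => hcont z, fun t ht z _ => (hbd t ht z).trans
      (Real.le_coe_toNNReal L), ?_⟩
    · refine LipschitzWith.lipschitzOnWith (LipschitzWith.of_dist_le_mul fun z w => ?_)
      rw [dist_eq_norm, dist_eq_norm]
      exact (hlip t ht z w).trans
        (mul_le_mul_of_nonneg_right (Real.le_coe_toNNReal K) (norm_nonneg _))
    · simp [hT]
  obtain ⟨y, hy0, hy⟩ := this.exists_eq_forall_mem_Icc_hasDerivWithinAt₀
  exact ⟨y, hy0, hy⟩

/-- The truncated nonlinear force tested against `e i`. -/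
def force {n : ℕ} (e : Fin n → ℝ[X]) (i : Fin n) (c : Fin n → ℝ) : ℝ :=
  ∫ x in (-1 : ℝ)..1, dd x ^ 2 * ((1 + clamp (1 / 2) (sv (pol e c) x 0))⁻¹ ^ 2 - 1) *
    (derivative (e i)).eval x

lemma sv_zero_eq {n : ℕ} (e : Fin n → ℝ[X]) (c : Fin n → ℝ) (x : ℝ) :
    sv (pol e c) x 0 = ∑ j, c j * (derivative (e j)).eval x := by
  rw [sv, iterate_derivative_pol, eval_pol]; rfl

lemma one_add_clamp (s : ℝ) : (1 / 2 : ℝ) ≤ 1 + clamp (1 / 2) s := by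
  have := (abs_le.1 (abs_clamp_le (M := 1 / 2) (by norm_num) s)).1
  linarith

lemma inv_clamp (s : ℝ) : 0 ≤ (1 + clamp (1 / 2) s)⁻¹ ∧ (1 + clamp (1 / 2) s)⁻¹ ≤ 2 := by
  have := one_add_clamp s
  constructor
  · positivity
  · rw [inv_le_comm₀ (by linarith) (by norm_num)]; linarith

lemma continuous_force_integrand {n : ℕ} (e : Fin n → ℝ[X]) (i : Fin n) (c : Fin n → ℝ) :
    Continuous fun x => dd x ^ 2 * ((1 + clamp (1 / 2) (sv (pol e c) x 0))⁻¹ ^ 2 - 1) *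
      (derivative (e i)).eval x := by
  have h : Continuous fun x => (1 + clamp (1 / 2) (sv (pol e c) x 0))⁻¹ := by
    refine Continuous.inv₀ ?_ fun x => by have := one_add_clamp (sv (pol e c) x 0); linarith
    unfold sv
    fun_prop
  fun_prop

lemma dd_sq_le {x : ℝ} (hx : x ∈ Icc (-1 : ℝ) 1) : |dd x ^ 2| ≤ 1 := by
  have h1 := dd_nonneg hx
  have h2 := dd_le (x := x)
  rw [abs_of_nonneg (by positivity)]
  nlinarith

lemma exists_eval_bound {n : ℕ} (e : Fin n → ℝ[X]) :
    ∃ R ≥ (0 : ℝ), ∀ i, ∀ x ∈ Icc (-1 : ℝ) 1, |(e i).eval x| ≤ R := by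
  have : ∀ i, ∃ R, ∀ x ∈ Icc (-1 : ℝ) 1, ‖(e i).eval x‖ ≤ R := fun i =>
    isCompact_Icc.exists_bound_of_continuousOn (e i).continuous.continuousOn
  choose R hR using this
  have hR0 : ∀ i, 0 ≤ R i := fun i => (norm_nonneg _).trans (hR i 0 (by norm_num))
  refine ⟨∑ i, R i, Finset.sum_nonneg fun i _ => hR0 i, fun i x hx => (hR i x hx).trans ?_⟩
  exact Finset.single_le_sum (fun j _ => hR0 j) (Finset.mem_univ i)

lemma exists_force_bound {n : ℕ} (e : Fin n → ℝ[X]) : ∃ L ≥ (0 : ℝ), ∀ i c c',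
    |force e i c| ≤ L ∧ |force e i c - force e i c'| ≤ L * ‖c - c'‖ := by
  obtain ⟨R, hR0, hR⟩ := exists_eval_bound (fun i => derivative (e i))
  have mem : ∀ x ∈ uIoc (-1 : ℝ) 1, x ∈ Icc (-1 : ℝ) 1 := by
    intro x hx
    rw [uIoc_of_le (by norm_num)] at hx
    exact Ioc_subset_Icc_self hx
  refine ⟨2 * (3 * R) + 2 * (16 * (n * R) * R), by positivity, fun i c c' => ⟨?_, ?_⟩⟩
  · have := intervalIntegral.norm_integral_le_of_norm_le_const (a := (-1 : ℝ)) (b := 1)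
      (C := 3 * R) (f := fun x => dd x ^ 2 * ((1 + clamp (1 / 2) (sv (pol e c) x 0))⁻¹ ^ 2 - 1) *
      (derivative (e i)).eval x) fun x hx => by
        obtain ⟨h1, h2⟩ := inv_clamp (sv (pol e c) x 0)
        rw [Real.norm_eq_abs, abs_mul, abs_mul]
        have h3 : |(1 + clamp (1 / 2) (sv (pol e c) x 0))⁻¹ ^ 2 - 1| ≤ 3 := by
          rw [abs_le]; constructor <;> nlinarith
        calc _ ≤ 1 * 3 * R := by
              gcongr
              · exact dd_sq_le (mem x hx)
              · exact hR i x (mem x hx)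
          _ = _ := by ring
    have h4 : |(1 : ℝ) - -1| = 2 := by norm_num
    rw [h4] at this
    refine this.trans ?_
    have : 0 ≤ 2 * (16 * (n * R) * R) := by positivity
    linarith
  · rw [force, force, ← intervalIntegral.integral_sub
      ((continuous_force_integrand e i c).intervalIntegrable _ _)
      ((continuous_force_integrand e i c').intervalIntegrable _ _)]
    have := intervalIntegral.norm_integral_le_of_norm_le_const (a := (-1 : ℝ)) (b := 1)
      (C := 16 * (n * R) * R * ‖c - c'‖) (f := fun x =>
      dd x ^ 2 * ((1 + clamp (1 / 2) (sv (pol e c) x 0))⁻¹ ^ 2 - 1) * (derivative (e i)).eval x -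
      dd x ^ 2 * ((1 + clamp (1 / 2) (sv (pol e c') x 0))⁻¹ ^ 2 - 1) * (derivative (e i)).eval x)
      fun x hx => by
        obtain ⟨h1, h2⟩ := inv_clamp (sv (pol e c) x 0)
        obtain ⟨h1', h2'⟩ := inv_clamp (sv (pol e c') x 0)
        have h5 := one_add_clamp (sv (pol e c) x 0)
        have h5' := one_add_clamp (sv (pol e c') x 0)
        have h6 := abs_clamp_sub_le (1 / 2) (sv (pol e c') x 0) (sv (pol e c) x 0)
        have h7 : |sv (pol e c') x 0 - sv (pol e c) x 0| ≤ n * R * ‖c - c'‖ := by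
          rw [sv_zero_eq, sv_zero_eq, ← Finset.sum_sub_distrib]
          refine (Finset.abs_sum_le_sum_abs _ _).trans ?_
          calc _ ≤ ∑ _j : Fin n, ‖c - c'‖ * R := by
                refine Finset.sum_le_sum fun j _ => ?_
                rw [← sub_mul, abs_mul]
                gcongr
                · rw [norm_sub_rev]; exact norm_le_pi_norm (c' - c) j
                · exact hR j x (mem x hx)
            _ = _ := by rw [Finset.sum_const, Finset.card_univ, Fintype.card_fin, nsmul_eq_mul]; ring
        generalize clamp (1 / 2) (sv (pol e c) x 0) = a at *
        generalize clamp (1 / 2) (sv (pol e c') x 0) = b at *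
        have h8 : (1 + a)⁻¹ ^ 2 - (1 + b)⁻¹ ^ 2 =
            (b - a) * ((1 + a)⁻¹ * (1 + b)⁻¹ * ((1 + a)⁻¹ + (1 + b)⁻¹)) := by
          have : 1 + a ≠ 0 := by linarith
          have : 1 + b ≠ 0 := by linarith
          field_simp; ring
        rw [← sub_mul, ← mul_sub, sub_sub_sub_cancel_right, h8, Real.norm_eq_abs, abs_mul, abs_mul,
          abs_mul]
        have h9 : |(1 + a)⁻¹ * (1 + b)⁻¹ * ((1 + a)⁻¹ + (1 + b)⁻¹)| ≤ 2 * 2 * (2 + 2) := by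
          rw [abs_of_nonneg (by positivity)]
          gcongr
        calc _ ≤ 1 * (n * R * ‖c - c'‖ * (2 * 2 * (2 + 2))) * R := by
              gcongr
              · exact dd_sq_le (mem x hx)
              · exact h6.trans h7
              · exact hR i x (mem x hx)
          _ = _ := by ring
    have h4 : |(1 : ℝ) - -1| = 2 := by norm_num
    rw [h4, Real.norm_eq_abs] at this
    refine this.trans ?_
    have : 0 ≤ 2 * (3 * R) * ‖c - c'‖ := by positivity
    linarith

/-- The right-hand side of the truncated momentum equation. -/
def accel {n : ℕ} (e : Fin n → ℝ[X]) (a b : ℝ) (p v : Fin n → ℝ) (i : Fin n) : ℝ :=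
  (a ^ 3)⁻¹ * (force e i p - 2 * a ^ 2 * b * clamp 1 (v i) - clamp 1 (p i))

lemma exists_truncated {α α' : ℝ → ℝ} {c : ℝ} (hα : Scale α α' c) {n : ℕ} (e : Fin n → ℝ[X])
    {T : ℝ} (hT : 0 ≤ T) (v₀ : Fin n → ℝ) : ∃ p v : ℝ → Fin n → ℝ, p 0 = 0 ∧ v 0 = v₀ ∧
      ∀ t ∈ Icc 0 T, HasDerivWithinAt p (fun i => clamp 1 (v t i)) (Icc 0 T) t ∧
        HasDerivWithinAt v (accel e (α t) (α' t) (p t) (v t)) (Icc 0 T) t := by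
  obtain ⟨L, hL0, hL⟩ := exists_force_bound e
  have sub : Icc 0 T ⊆ Ici (0 : ℝ) := Icc_subset_Ici_self
  have cα : ContinuousOn α (Icc 0 T) := hα.cont.mono sub
  have cα' : ContinuousOn α' (Icc 0 T) := hα.cont'.mono sub
  obtain ⟨M, hM⟩ := isCompact_Icc.exists_bound_of_continuousOn
    ((continuousOn_const (c := (2 : ℝ))).mul (cα.pow 2) |>.mul cα')
  have hM0 : 0 ≤ M := (norm_nonneg _).trans (hM 0 (left_mem_Icc.2 hT))
  have hinv : ∀ t ∈ Icc 0 T, |(α t ^ 3)⁻¹| ≤ 1 := by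
    intro t ht
    have h1 := hα.one_le t (sub ht)
    rw [abs_of_nonneg (by positivity)]
    exact inv_le_one_of_one_le₀ (one_le_pow₀ h1)
  let F : ℝ → (Fin n → ℝ) × (Fin n → ℝ) → (Fin n → ℝ) × (Fin n → ℝ) := fun t z =>
    (fun i => clamp 1 (z.2 i), accel e (α t) (α' t) z.1 z.2)
  suffices h : ∃ y : ℝ → (Fin n → ℝ) × (Fin n → ℝ), y 0 = (0, v₀) ∧
      ∀ t ∈ Icc 0 T, HasDerivWithinAt y (F t (y t)) (Icc 0 T) t by
    obtain ⟨y, hy0, hy⟩ := h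
    refine ⟨fun t => (y t).1, fun t => (y t).2, by simp [hy0], by simp [hy0], fun t ht => ?_⟩
    exact ⟨(hy t ht).fst, (hy t ht).snd⟩
  refine exists_ode (L := L + M + 1) (K := L + M + 1) hT (0, v₀)
    (fun t ht z w => ?_) (fun z => ?_) (fun t ht z => ?_)
  · have hM' := hM t ht
    rw [Real.norm_eq_abs] at hM'
    have n1 : ‖z.1 - w.1‖ ≤ ‖z - w‖ := norm_fst_le (z - w)
    have n2 : ‖z.2 - w.2‖ ≤ ‖z - w‖ := norm_snd_le (z - w)
    have hn := norm_nonneg (z - w)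
    have p1 : ∀ i, |z.1 i - w.1 i| ≤ ‖z - w‖ := fun i => (norm_le_pi_norm (z.1 - w.1) i).trans n1
    have p2 : ∀ i, |z.2 i - w.2 i| ≤ ‖z - w‖ := fun i => (norm_le_pi_norm (z.2 - w.2) i).trans n2
    have hK : 0 ≤ (L + M + 1) * ‖z - w‖ := by positivity
    refine max_le ((pi_norm_le_iff_of_nonneg hK).2 fun i => ?_)
      ((pi_norm_le_iff_of_nonneg hK).2 fun i => ?_)
    · refine (abs_clamp_sub_le _ _ _).trans ((p2 i).trans ?_)
      nlinarith
    · have e1 : (F t z - F t w).2 i = (α t ^ 3)⁻¹ * ((force e i z.1 - force e i w.1) -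
          2 * α t ^ 2 * α' t * (clamp 1 (z.2 i) - clamp 1 (w.2 i)) -
          (clamp 1 (z.1 i) - clamp 1 (w.1 i))) := by
        change accel e (α t) (α' t) z.1 z.2 i - accel e (α t) (α' t) w.1 w.2 i = _
        unfold accel; ring
      rw [e1, Real.norm_eq_abs, abs_mul]
      have q1 := (hL i z.1 w.1).2
      have q2 := (abs_clamp_sub_le 1 (z.2 i) (w.2 i)).trans (p2 i)
      have q3 := (abs_clamp_sub_le 1 (z.1 i) (w.1 i)).trans (p1 i)
      have q4 : L * ‖z.1 - w.1‖ ≤ L * ‖z - w‖ := mul_le_mul_of_nonneg_left n1 hL0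
      have q5 : |2 * α t ^ 2 * α' t * (clamp 1 (z.2 i) - clamp 1 (w.2 i))| ≤ M * ‖z - w‖ := by
        rw [abs_mul]; exact mul_le_mul hM' q2 (abs_nonneg _) hM0
      calc _ ≤ 1 * (L * ‖z - w‖ + M * ‖z - w‖ + ‖z - w‖) := by
            refine mul_le_mul (hinv t ht) ?_ (abs_nonneg _) zero_le_one
            refine (abs_sub _ _).trans (add_le_add ((abs_sub _ _).trans (add_le_add ?_ q5)) q3)
            linarith
        _ = _ := by ring
  · refine ContinuousOn.prodMk continuousOn_const (continuousOn_pi.2 fun i => ?_)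
    refine ContinuousOn.mul ((cα.pow 3).inv₀ fun t ht => ?_) ?_
    · have h1 := hα.one_le t (sub ht)
      exact pow_ne_zero 3 (by linarith)
    · exact (continuousOn_const.sub (((continuousOn_const.mul (cα.pow 2)).mul cα').mul
        continuousOn_const)).sub continuousOn_const
  · have hM' := hM t ht
    rw [Real.norm_eq_abs] at hM'
    have hK : 0 ≤ L + M + 1 := by positivity
    refine max_le ((pi_norm_le_iff_of_nonneg hK).2 fun i => ?_)
      ((pi_norm_le_iff_of_nonneg hK).2 fun i => ?_)
    · exact (abs_clamp_le zero_le_one _).trans (by linarith)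
    · change |accel e (α t) (α' t) z.1 z.2 i| ≤ _
      rw [accel, abs_mul]
      have q5 : |2 * α t ^ 2 * α' t * clamp 1 (z.2 i)| ≤ M * 1 := by
        rw [abs_mul]; exact mul_le_mul hM' (abs_clamp_le zero_le_one _) (abs_nonneg _) hM0
      calc _ ≤ 1 * (L + M * 1 + 1) := by
            refine mul_le_mul (hinv t ht) ?_ (abs_nonneg _) zero_le_one
            exact (abs_sub _ _).trans (add_le_add ((abs_sub _ _).trans
              (add_le_add (hL i z.1 z.1).1 q5)) (abs_clamp_le zero_le_one _))
        _ = _ := by ring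

lemma bootstrap {f : ℝ → ℝ} {T δ : ℝ} (hf : ContinuousOn f (Icc 0 T)) (hδ : 0 < δ)
    (h0 : f 0 ≤ δ / 2) (h : ∀ t ∈ Icc 0 T, (∀ s ∈ Icc 0 t, f s ≤ δ) → f t ≤ δ / 2) :
    ∀ t ∈ Icc 0 T, f t ≤ δ := by
  by_contra! hc
  obtain ⟨t₁, ht₁, hft⟩ := hc
  have sub : Icc 0 t₁ ⊆ Icc 0 T := Icc_subset_Icc_right ht₁.2
  have hcl : IsClosed (Icc 0 t₁ ∩ f ⁻¹' Ici δ) :=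
    (hf.mono sub).preimage_isClosed_of_isClosed isClosed_Icc isClosed_Ici
  have hcpt : IsCompact (Icc 0 t₁ ∩ f ⁻¹' Ici δ) :=
    isCompact_Icc.of_isClosed_subset hcl inter_subset_left
  obtain ⟨r, ⟨hr, hfr⟩, hmin⟩ := hcpt.exists_isLeast ⟨t₁, right_mem_Icc.2 ht₁.1, hft.le⟩
  have hfr' : δ ≤ f r := hfr
  obtain ⟨s, hs, hfs⟩ := intermediate_value_Icc hr.1
    (hf.mono (Icc_subset_Icc_right (hr.2.trans ht₁.2))) (show δ ∈ Icc (f 0) (f r) from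
      ⟨by linarith, hfr'⟩)
  have hsr : r ≤ s := hmin ⟨⟨hs.1, hs.2.trans hr.2⟩, hfs.ge⟩
  have hr' : f r ≤ δ := by rw [le_antisymm hsr hs.2]; exact hfs.le
  have := h r (sub hr) fun u hu => by
    rcases hu.2.eq_or_lt with rfl | hur
    · exact hr'
    · by_contra! hfu
      exact absurd (hmin ⟨⟨hu.1, hu.2.trans hr.2⟩, hfu.le⟩) (not_le.2 hur)
  linarith

lemma PolyDeriv.continuousOn_J {T : ℝ} {P V : ℝ → ℝ[X]} (h : PolyDeriv T P V) (l k : ℕ) :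
    ContinuousOn (fun t => J l (derivative^[k] (P t))) (Icc 0 T) :=
  continuousOn_integral_param (((continuous_dd.comp continuous_snd).pow l).continuousOn.mul
    ((h.cont k).pow 2))

lemma PolyDeriv.continuousOn_N5 {T : ℝ} {P V : ℝ → ℝ[X]} (h : PolyDeriv T P V) :
    ContinuousOn (fun t => N5 (P t)) (Icc 0 T) :=
  (h.continuousOn_J 1 0).add (h.continuousOn_J 6 5)

lemma PolyDeriv.continuousOn_N6 {T : ℝ} {P V : ℝ → ℝ[X]} (h : PolyDeriv T P V) :
    ContinuousOn (fun t => N6 (P t)) (Icc 0 T) :=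
  h.continuousOn_N5.add (h.continuousOn_J 7 6)

/-- Approximate solutions in the space of polynomials of degree at most `N`. -/
structure Galerkin (α α' : ℝ → ℝ) (N : ℕ) (T B : ℝ) (P V Z : ℝ → ℝ[X]) : Prop where
  deriv₁ : PolyDeriv T P V
  deriv₂ : PolyDeriv T V Z
  init : P 0 = 0
  natDegree_le : ∀ t ∈ Icc 0 T, (V t).natDegree ≤ N
  weak : ∀ t ∈ Icc 0 T, ∀ q : ℝ[X], q.natDegree ≤ N →
    ∫ x in (-1 : ℝ)..1,
      dd x * (C (α t ^ 3) * Z t + C (2 * α t ^ 2 * α' t) * V t + P t).eval x * q.eval x =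
    ∫ x in (-1 : ℝ)..1, dd x ^ 2 * (yv (P t) x ^ 2 - 1) * (derivative q).eval x
  bound : ∀ t ∈ Icc 0 T, Bq (α t) (P t) (V t) ≤ B

lemma J_zero (l : ℕ) : J l 0 = 0 := by simp [J]

lemma N6_zero : N6 0 = 0 := by simp [N6, N5, J_zero]

lemma force_linear {n : ℕ} (e : Fin n → ℝ[X]) (p : Fin n → ℝ) (b : Fin n → ℝ) :
    ∫ x in (-1 : ℝ)..1, dd x ^ 2 * ((1 + clamp (1 / 2) (sv (pol e p) x 0))⁻¹ ^ 2 - 1) *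
      (derivative (∑ i, C (b i) * e i)).eval x = ∑ i, b i * force e i p := by
  simp only [force, ← intervalIntegral.integral_const_mul]
  rw [← intervalIntegral.integral_finsetSum fun i _ =>
    ((continuous_force_integrand e i p).const_mul (b i)).intervalIntegrable _ _]
  congr 1; ext x
  simp only [derivative_sum, derivative_C_mul, eval_finsetSum, eval_mul, eval_C, Finset.mul_sum]
  exact Finset.sum_congr rfl fun i _ => by ring

lemma exists_galerkin_curve {α α' : ℝ → ℝ} {c : ℝ} (hα : Scale α α' c) : ∃ δ > (0 : ℝ),
    (∀ p : ℝ[X], N6 p ≤ δ → ∀ x ∈ Icc (-1 : ℝ) 1, |sv p x 0| ≤ 1 / 2) ∧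
    ∀ (N : ℕ) (T : ℝ) (w : ℝ[X]), 0 ≤ T → w.natDegree ≤ N → 12 * N5 w ≤ δ →
      ∃ P V Z : ℝ → ℝ[X], Galerkin α α' N T (6 * N5 w) P V Z ∧ V 0 = w := by
  obtain ⟨δ, hδ, hδ1, hsv, hap⟩ := exists_apriori hα
  refine ⟨δ, hδ, hsv, fun N T w hT hw hwδ => ?_⟩
  obtain ⟨n, e, heN, heo, hes⟩ := exists_orthonormal N
  have hw0 : pol e (fun i => ip w (e i)) = w := (hes w hw).symm
  obtain ⟨p, v, hp0, hv0, hpv⟩ := exists_truncated hα e hT (fun i => ip w (e i))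
  obtain ⟨L, hL0, hL⟩ := exists_force_bound e
  have sub : Icc 0 T ⊆ Ici (0 : ℝ) := Icc_subset_Ici_self
  have cα : ContinuousOn α (Icc 0 T) := hα.cont.mono sub
  have cα' : ContinuousOn α' (Icc 0 T) := hα.cont'.mono sub
  have cp : ContinuousOn p (Icc 0 T) := fun t ht => (hpv t ht).1.continuousWithinAt
  have cv : ContinuousOn v (Icc 0 T) := fun t ht => (hpv t ht).2.continuousWithinAt
  have cforce : ∀ i, Continuous (force e i) := by
    intro i
    refine (LipschitzWith.of_dist_le_mul (K := ⟨L, hL0⟩) fun z w => ?_).continuous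
    rw [dist_eq_norm, dist_eq_norm]
    exact (hL i z w).2
  have cz : ContinuousOn (fun t => accel e (α t) (α' t) (p t) (v t)) (Icc 0 T) := by
    refine continuousOn_pi.2 fun i => ContinuousOn.mul ((cα.pow 3).inv₀ fun t ht => ?_) ?_
    · have h1 := hα.one_le t (sub ht)
      exact pow_ne_zero 3 (by linarith)
    · exact (((cforce i).comp_continuousOn cp).sub (((continuousOn_const.mul (cα.pow 2)).mul
        cα').mul ((continuous_clamp 1).comp_continuousOn (continuousOn_pi.1 cv i)))).sub
        ((continuous_clamp 1).comp_continuousOn (continuousOn_pi.1 cp i))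
  have hV0 : pol e (v 0) = w := by rw [hv0, hw0]
  have hP0 : pol e (p 0) = 0 := by rw [hp0]; simp [pol]
  have key : ∀ t₁ ∈ Icc 0 T,
      (∀ t ∈ Icc 0 t₁, Bq (α t) (pol e (p t)) (pol e (v t)) ≤ δ) →
      PolyDeriv t₁ (fun t => pol e (p t)) (fun t => pol e (v t)) ∧
      PolyDeriv t₁ (fun t => pol e (v t))
        (fun t => pol e (accel e (α t) (α' t) (p t) (v t))) ∧
      (∀ t ∈ Icc 0 t₁, ∀ q : ℝ[X], q.natDegree ≤ N →
        ∫ x in (-1 : ℝ)..1, dd x * (C (α t ^ 3) * pol e (accel e (α t) (α' t) (p t) (v t)) +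
          C (2 * α t ^ 2 * α' t) * pol e (v t) + pol e (p t)).eval x * q.eval x =
        ∫ x in (-1 : ℝ)..1, dd x ^ 2 * (yv (pol e (p t)) x ^ 2 - 1) * (derivative q).eval x) ∧
      Bq (α t₁) (pol e (p t₁)) (pol e (v t₁)) ≤ 6 * N5 w := by
    intro t₁ ht₁ hB
    have sub₁ : Icc 0 t₁ ⊆ Icc 0 T := Icc_subset_Icc_right ht₁.2
    have hN6 : ∀ t ∈ Icc 0 t₁, N6 (pol e (p t)) ≤ δ := by
      intro t ht
      have h1 := hα.one_le t (sub (sub₁ ht))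
      have h2 := N5_nonneg (pol e (v t))
      have : 0 ≤ α t ^ 3 * N5 (pol e (v t)) := mul_nonneg (by positivity) h2
      have := hB t ht
      unfold Bq at this
      linarith
    have hpc : ∀ t ∈ Icc 0 t₁, ∀ i, clamp 1 (p t i) = p t i := by
      intro t ht i
      apply clamp_eq
      rw [← sq_le_one_iff_abs_le_one]
      have h1 := sq_coeff_le heo (p t) i
      have h2 : J 1 (pol e (p t)) ≤ N6 (pol e (p t)) :=
        (le_add_of_nonneg_right (J_nonneg _ _)).trans (N5_le_N6 _)
      linarith [hN6 t ht]
    have hvc : ∀ t ∈ Icc 0 t₁, ∀ i, clamp 1 (v t i) = v t i := by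
      intro t ht i
      apply clamp_eq
      rw [← sq_le_one_iff_abs_le_one]
      have h0 := sq_coeff_le heo (v t) i
      have h1 : 1 ≤ α t ^ 3 := one_le_pow₀ (hα.one_le t (sub (sub₁ ht)))
      have h2 : J 1 (pol e (v t)) ≤ N5 (pol e (v t)) := le_add_of_nonneg_right (J_nonneg _ _)
      have h3 := N5_nonneg (pol e (v t))
      have h4 := N6_nonneg (pol e (p t))
      have := hB t ht
      unfold Bq at this
      nlinarith
    have hD₁ : PolyDeriv t₁ (fun t => pol e (p t)) (fun t => pol e (v t)) := by
      refine polyDeriv_pol e (fun t ht => ?_) (cv.mono sub₁)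
      have := (hpv t (sub₁ ht)).1.mono sub₁
      simpa only [hvc t ht] using this
    have hD₂ : PolyDeriv t₁ (fun t => pol e (v t))
        (fun t => pol e (accel e (α t) (α' t) (p t) (v t))) :=
      polyDeriv_pol e (fun t ht => (hpv t (sub₁ ht)).2.mono sub₁) (cz.mono sub₁)
    have hW : ∀ t ∈ Icc 0 t₁, ∀ q : ℝ[X], q.natDegree ≤ N →
        ∫ x in (-1 : ℝ)..1, dd x * (C (α t ^ 3) * pol e (accel e (α t) (α' t) (p t) (v t)) +
          C (2 * α t ^ 2 * α' t) * pol e (v t) + pol e (p t)).eval x * q.eval x =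
        ∫ x in (-1 : ℝ)..1,
          dd x ^ 2 * (yv (pol e (p t)) x ^ 2 - 1) * (derivative q).eval x := by
      intro t ht q hq
      have hα1 := hα.one_le t (sub (sub₁ ht))
      set S := C (α t ^ 3) * pol e (accel e (α t) (α' t) (p t) (v t)) +
          C (2 * α t ^ 2 * α' t) * pol e (v t) + pol e (p t) with hS
      have h1 : (∫ x in (-1 : ℝ)..1, dd x * S.eval x * q.eval x) = ip S q := by
        simp only [ip_apply, mul_assoc]
      have h2 : ∀ i, ip S (e i) = force e i (p t) := by
        intro i
        rw [hS, map_add, map_add, ← smul_eq_C_mul, ← smul_eq_C_mul, map_smul, map_smul,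
          LinearMap.add_apply, LinearMap.add_apply, LinearMap.smul_apply, LinearMap.smul_apply,
          ip_pol heo, ip_pol heo, ip_pol heo, accel, hpc t ht, hvc t ht, smul_eq_mul, smul_eq_mul]
        have : α t ≠ 0 := by linarith
        field_simp
        ring
      have h3 : (∫ x in (-1 : ℝ)..1,
          dd x ^ 2 * (yv (pol e (p t)) x ^ 2 - 1) * (derivative q).eval x) =
          ∫ x in (-1 : ℝ)..1, dd x ^ 2 * ((1 + clamp (1 / 2) (sv (pol e (p t)) x 0))⁻¹ ^ 2 - 1) *
            (derivative (∑ i, C (ip q (e i)) * e i)).eval x := by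
        rw [← hes q hq]
        refine intervalIntegral.integral_congr fun x hx => ?_
        rw [uIcc_eq] at hx
        simp only [yv, clamp_eq (hsv _ (hN6 t ht) x hx)]
      rw [h1, h3, force_linear]
      conv_lhs => rw [hes q hq]
      rw [map_sum]
      refine Finset.sum_congr rfl fun i _ => ?_
      rw [← smul_eq_C_mul, map_smul, smul_eq_mul, h2]
    refine ⟨hD₁, hD₂, hW, ?_⟩
    have := hap N t₁ _ _ _ ht₁.1 hD₁ hD₂ hP0 (fun t _ => natDegree_pol heN _) hW hB
    rwa [hV0] at this
  have cB : ContinuousOn (fun t => Bq (α t) (pol e (p t)) (pol e (v t))) (Icc 0 T) := by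
    have hcp : PolyDeriv T (fun t => pol e (p t)) (fun t => pol e (fun i => clamp 1 (v t i))) :=
      polyDeriv_pol e (fun t ht => (hpv t ht).1) (continuousOn_pi.2 fun i =>
        (continuous_clamp 1).comp_continuousOn (continuousOn_pi.1 cv i))
    have hcv : PolyDeriv T (fun t => pol e (v t))
        (fun t => pol e (accel e (α t) (α' t) (p t) (v t))) :=
      polyDeriv_pol e (fun t ht => (hpv t ht).2) cz
    exact hcp.continuousOn_N6.add ((cα.pow 3).mul hcv.continuousOn_N5)
  have hall := bootstrap cB hδ (by
    have := N5_nonneg w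
    simp only [Bq, hP0, hV0, N6_zero, hα.init]
    linarith) fun t ht hB => by
      have := (key t ht hB).2.2.2
      linarith
  obtain ⟨h1, h2, h3, -⟩ := key T (right_mem_Icc.2 hT) hall
  refine ⟨_, _, _, ⟨h1, h2, hP0, fun t _ => natDegree_pol heN _, h3, fun t ht => ?_⟩, hV0⟩
  exact (key t ht fun s hs => hall s ⟨hs.1, hs.2.trans ht.2⟩).2.2.2

lemma interval_eq_setIntegral (f : ℝ → ℝ) :
    ∫ x in (-1 : ℝ)..1, f x = ∫ x in Ω₀, f x := by
  rw [intervalIntegral.integral_of_le (by norm_num), integral_Ioc_eq_integral_Ioo]; rfl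

/-- Absorbing the cross term: `∫ ρ q² = ∫ ρ f q` implies `∫ ρ q² ≤ ∫ ρ f²`. -/
lemma le_of_eq_cross {l : ℕ} {f q : ℝ → ℝ} (hf : ContinuousOn f (Icc (-1) 1))
    (hq : ContinuousOn q (Icc (-1) 1))
    (h : ∫ x in (-1 : ℝ)..1, dd x ^ l * q x ^ 2 = ∫ x in (-1 : ℝ)..1, dd x ^ l * f x * q x) :
    ∫ x in (-1 : ℝ)..1, dd x ^ l * q x ^ 2 ≤ ∫ x in (-1 : ℝ)..1, dd x ^ l * f x ^ 2 := by
  have hd : ContinuousOn (fun x => dd x ^ l) (Icc (-1 : ℝ) 1) := (continuous_dd.pow l).continuousOn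
  have i1 : IntervalIntegrable (fun x => dd x ^ l * q x ^ 2) volume (-1) 1 :=
    integrable_of_continuousOn (hd.mul (hq.pow 2))
  have i2 : IntervalIntegrable (fun x => dd x ^ l * f x * q x) volume (-1) 1 :=
    integrable_of_continuousOn ((hd.mul hf).mul hq)
  have i3 : IntervalIntegrable (fun x => dd x ^ l * f x ^ 2) volume (-1) 1 :=
    integrable_of_continuousOn (hd.mul (hf.pow 2))
  have h0 : 0 ≤ ∫ x in (-1 : ℝ)..1, (dd x ^ l * f x ^ 2 - 2 * (dd x ^ l * f x * q x) +
      dd x ^ l * q x ^ 2) := by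
    refine intervalIntegral.integral_nonneg (by norm_num) fun x hx => ?_
    have := dd_nonneg hx
    have e : dd x ^ l * f x ^ 2 - 2 * (dd x ^ l * f x * q x) + dd x ^ l * q x ^ 2 =
        dd x ^ l * (f x - q x) ^ 2 := by ring
    rw [e]; positivity
  rw [intervalIntegral.integral_add (i3.sub (i2.const_mul 2)) i1,
    intervalIntegral.integral_sub i3 (i2.const_mul 2), intervalIntegral.integral_const_mul] at h0
  linarith

lemma integral_iteratedDerivWithin {u : ℝ → ℝ} (hu : ∀ n : ℕ, ContDiffOn ℝ n u (Icc (-1) 1))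
    (l k : ℕ) : ∫ x in (-1 : ℝ)..1, dd x ^ l * iteratedDerivWithin k u (Icc (-1) 1) x ^ 2 =
      ∫ x in Ω₀, dd x ^ l * iteratedDeriv k u x ^ 2 := by
  rw [interval_eq_setIntegral]
  refine setIntegral_congr_fun measurableSet_Ioo fun x hx => ?_
  rw [iteratedDerivWithin_eq_iteratedDeriv (uniqueDiffOn_Icc (by norm_num))
    ((hu k).contDiffAt (Icc_mem_nhds hx.1 hx.2)) (Ioo_subset_Icc_self hx)]

/-- Polynomial approximation of the initial velocity, bounded in the energy norm. -/
lemma exists_projection {u : ℝ → ℝ} (hu : ∀ n : ℕ, ContDiffOn ℝ n u (Icc (-1) 1)) (N : ℕ) :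
    ∃ w : ℝ[X], w.natDegree ≤ N ∧
      (∀ q : ℝ[X], q.natDegree ≤ N → ∫ x in (-1 : ℝ)..1, dd x * (w.eval x * q.eval x) =
        ∫ x in (-1 : ℝ)..1, dd x * (u x * q.eval x)) ∧
      N5 w ≤ ∑ b ∈ Finset.range 6, ∫ x in Ω₀, dd x ^ (1 + b) * (iteratedDeriv b u x) ^ 2 := by
  have hun : UniqueDiffOn ℝ (Icc (-1 : ℝ) 1) := uniqueDiffOn_Icc (by norm_num)
  set F : ℕ → ℝ → ℝ := fun k => iteratedDerivWithin k u (Icc (-1) 1) with hF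
  have cF : ∀ k, ContinuousOn (F k) (Icc (-1) 1) := fun k =>
    (hu k).continuousOn_iteratedDerivWithin le_rfl hun
  have dF : ∀ k, ∀ x ∈ Ioo (-1 : ℝ) 1, HasDerivAt (F k) (F (k + 1) x) x := by
    intro k x hx
    have h1 := (hu (k + 1)).differentiableOn_iteratedDerivWithin (m := k)
      (by exact_mod_cast Nat.lt_succ_self k) hun x (Ioo_subset_Icc_self hx)
    have h2 := h1.hasDerivWithinAt.hasDerivAt (Icc_mem_nhds hx.1 hx.2)
    rwa [← iteratedDerivWithin_succ] at h2
  have F0 : F 0 = u := by ext x; simp [hF]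
  obtain ⟨n, e, heN, heo, hes⟩ := exists_orthonormal N
  have ci : ∀ q : ℝ[X], IntervalIntegrable (fun x => dd x * (u x * q.eval x)) volume (-1) 1 :=
    fun q => integrable_of_continuousOn (continuous_dd.continuousOn.mul
      ((F0 ▸ cF 0).mul q.continuous.continuousOn))
  set w := pol e (fun i => ∫ x in (-1 : ℝ)..1, dd x * (u x * (e i).eval x)) with hw
  have hwN : w.natDegree ≤ N := natDegree_pol heN _
  have hproj : ∀ q : ℝ[X], q.natDegree ≤ N → ∫ x in (-1 : ℝ)..1, dd x * (w.eval x * q.eval x) =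
        ∫ x in (-1 : ℝ)..1, dd x * (u x * q.eval x) := by
    intro q hq
    rw [← ip_apply]
    conv_lhs => rw [hes q hq, map_sum]
    have h1 : ∀ x, dd x * (u x * q.eval x) =
        ∑ i, ip q (e i) * (dd x * (u x * (e i).eval x)) := by
      intro x
      conv_lhs => rw [hes q hq, eval_finsetSum, Finset.mul_sum, Finset.mul_sum]
      exact Finset.sum_congr rfl fun i _ => by rw [eval_mul, eval_C]; ring
    simp only [h1]
    rw [intervalIntegral.integral_finsetSum fun i _ => (ci (e i)).const_mul _]
    refine Finset.sum_congr rfl fun i _ => ?_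
    rw [← smul_eq_C_mul, map_smul, smul_eq_mul, hw, ip_pol heo, intervalIntegral.integral_const_mul]
  refine ⟨w, hwN, hproj, ?_⟩
  have h1 : J 1 w ≤ ∫ x in Ω₀, dd x ^ 1 * iteratedDeriv 0 u x ^ 2 := by
    rw [← integral_iteratedDerivWithin hu]
    refine le_of_eq_cross (cF 0) w.continuous.continuousOn ?_
    have := hproj w hwN
    change _ = ∫ x in (-1 : ℝ)..1, dd x ^ 1 * F 0 x * w.eval x
    simp only [F0, pow_one, sq, mul_assoc]
    exact this
  have h5 : J 6 (derivative^[5] w) ≤ ∫ x in Ω₀, dd x ^ 6 * iteratedDeriv 5 u x ^ 2 := by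
    rw [← integral_iteratedDerivWithin hu]
    refine le_of_eq_cross (cF 5) (derivative^[5] w).continuous.continuousOn ?_
    change _ = ∫ x in (-1 : ℝ)..1, dd x ^ 6 * F 5 x * (derivative^[5] w).eval x
    rw [← integral_testPol _ F (fun k _ => cF k) (fun k _ => dF k)]
    have := hproj _ (natDegree_testPol_le hwN)
    rw [F0]
    simp only [mul_assoc]
    rw [← this]
    simp only [← mul_assoc]
    rw [integral_testPol_poly]
    simp only [sq, mul_assoc]
  have nn : ∀ b : ℕ, 0 ≤ ∫ x in Ω₀, dd x ^ (1 + b) * (iteratedDeriv b u x) ^ 2 := fun b =>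
    setIntegral_nonneg measurableSet_Ioo fun x hx => by
      have := dd_pos hx
      positivity
  simp only [Finset.sum_range_succ, Finset.sum_range_zero]
  have := nn 1; have := nn 2; have := nn 3; have := nn 4
  unfold N5
  simp only [add_zero] at h1 ⊢
  linarith

/-- A fixed nonprincipal ultrafilter, used to extract limits. -/
abbrev U : Filter ℕ := (hyperfilter ℕ : Ultrafilter ℕ)

/-- The limit along `U`. -/
def ul (a : ℕ → ℝ) : ℝ := limUnder U a

lemma tendsto_ul {a : ℕ → ℝ} {R : ℝ} (h : ∀ N, |a N| ≤ R) : Tendsto a U (𝓝 (ul a)) := by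
  have h1 : ((hyperfilter ℕ).map a : Filter ℝ) ≤ 𝓟 (Icc (-R) R) := by
    rw [le_principal_iff, Ultrafilter.coe_map, mem_map]
    exact univ_mem' fun N => abs_le.1 (h N)
  obtain ⟨b, -, hb⟩ := isCompact_Icc.ultrafilter_le_nhds _ h1
  exact tendsto_nhds_limUnder ⟨b, hb⟩

lemma eventually_U {p : ℕ → Prop} (n : ℕ) (h : ∀ N ≥ n, p N) : ∀ᶠ N in U, p N :=
  (Nat.hyperfilter_le_atTop : U ≤ atTop) (eventually_atTop.2 ⟨n, h⟩)

/-- Derivatives pass to pointwise limits under a common modulus of continuity. -/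
lemma hasDerivWithinAt_of_tendsto {S : Set ℝ} (hS : Convex ℝ S) {φ ψ : ℕ → ℝ → ℝ} {f g : ℝ → ℝ}
    {ω : ℝ → ℝ} (hmono : MonotoneOn ω (Ici 0)) (hω : Tendsto ω (𝓝 0) (𝓝 0))
    (hd : ∀ᶠ N in U, (∀ x ∈ S, HasDerivWithinAt (φ N) (ψ N x) S x) ∧
      ∀ x ∈ S, ∀ y ∈ S, |ψ N y - ψ N x| ≤ ω |y - x|)
    (hf : ∀ x ∈ S, Tendsto (fun N => φ N x) U (𝓝 (f x)))
    (hg : ∀ x ∈ S, Tendsto (fun N => ψ N x) U (𝓝 (g x))) {x : ℝ} (hx : x ∈ S) :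
    HasDerivWithinAt f (g x) S x := by
  have key : ∀ y ∈ S, |f y - f x - (y - x) * g x| ≤ ω |y - x| * |y - x| := by
    intro y hy
    have ht : Tendsto (fun N => |φ N y - φ N x - (y - x) * ψ N x|) U
        (𝓝 |f y - f x - (y - x) * g x|) :=
      (((hf y hy).sub (hf x hx)).sub ((hg x hx).const_mul _)).abs
    refine le_of_tendsto ht (hd.mono fun N hN => ?_)
    have seg : segment ℝ x y ⊆ S := hS.segment_subset hx hy
    have := (convex_segment x y).norm_image_sub_le_of_norm_hasDerivWithin_le
      (f := fun z => φ N z - z * ψ N x) (f' := fun z => ψ N z - 1 * ψ N x) (C := ω |y - x|)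
      (fun z hz => (((hN.1 z (seg hz)).mono seg).sub
        ((hasDerivWithinAt_id z _).mul_const (ψ N x))))
      (fun z hz => by
        rw [Real.norm_eq_abs, one_mul]
        refine (hN.2 x hx z (seg hz)).trans (hmono (mem_Ici.2 (abs_nonneg _))
          (mem_Ici.2 (abs_nonneg _)) ?_)
        rw [segment_eq_uIcc] at hz
        exact abs_sub_left_of_mem_uIcc hz)
      (left_mem_segment ℝ x y) (right_mem_segment ℝ x y)
    rw [Real.norm_eq_abs, Real.norm_eq_abs] at this
    refine le_trans (le_of_eq ?_) this
    congr 1; ring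
  rw [hasDerivWithinAt_iff_isLittleO, Asymptotics.isLittleO_iff]
  intro ε hε
  have h1 : Tendsto (fun y => ω |y - x|) (𝓝[S] x) (𝓝 0) := by
    refine hω.comp ?_
    have : Tendsto (fun y => |y - x|) (𝓝 x) (𝓝 |x - x|) := by
      exact (Continuous.tendsto (by fun_prop) x)
    rw [sub_self, abs_zero] at this
    exact this.mono_left nhdsWithin_le_nhds
  filter_upwards [self_mem_nhdsWithin, h1.eventually (gt_mem_nhds hε)] with y hy hy2
  rw [Real.norm_eq_abs, Real.norm_eq_abs, smul_eq_mul]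
  exact (key y hy).trans (mul_le_mul_of_nonneg_right hy2.le (abs_nonneg _))

/-- Cauchy–Schwarz for the increment of a polynomial. -/
lemma sq_sub_le_integral (p : ℝ[X]) {x y : ℝ} (h : x ≤ y) :
    (p.eval y - p.eval x) ^ 2 ≤ (y - x) * ∫ z in x..y, (derivative p).eval z ^ 2 := by
  rcases h.eq_or_lt with rfl | h
  · simp
  set m := (p.eval y - p.eval x) / (y - x) with hm
  have hxy : 0 < y - x := sub_pos.2 h
  have h0 : 0 ≤ ∫ z in x..y, ((derivative p).eval z - m) ^ 2 :=
    intervalIntegral.integral_nonneg h.le fun z _ => sq_nonneg _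
  have h1 : ∫ z in x..y, (derivative p).eval z = p.eval y - p.eval x :=
    intervalIntegral.integral_eq_sub_of_hasDerivAt (fun z _ => p.hasDerivAt z)
      (Continuous.intervalIntegrable (by fun_prop) _ _)
  have h2 : ∫ z in x..y, ((derivative p).eval z - m) ^ 2 =
      (∫ z in x..y, (derivative p).eval z ^ 2) - 2 * m * (p.eval y - p.eval x) +
        m ^ 2 * (y - x) := by
    have e : ∀ z, ((derivative p).eval z - m) ^ 2 =
        (derivative p).eval z ^ 2 - 2 * m * (derivative p).eval z + m ^ 2 := fun z => by ring
    simp only [e]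
    rw [intervalIntegral.integral_add (Continuous.intervalIntegrable (by fun_prop) _ _)
      (Continuous.intervalIntegrable (by fun_prop) _ _),
      intervalIntegral.integral_sub (Continuous.intervalIntegrable (by fun_prop) _ _)
      (Continuous.intervalIntegrable (by fun_prop) _ _), intervalIntegral.integral_const_mul, h1,
      intervalIntegral.integral_const, smul_eq_mul]
    ring
  have h3 : m * (y - x) = p.eval y - p.eval x := by rw [hm]; field_simp
  nlinarith

/-- The division points of `[-1, 1]` into `n` equal cells. -/
def node (n i : ℕ) : ℝ := -1 + 2 * i / n

lemma node_succ (n i : ℕ) : node n (i + 1) = node n i + 2 / n := by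
  unfold node; push_cast; ring

lemma node_lt_succ {n : ℕ} (hn : 0 < n) (i : ℕ) : node n i < node n (i + 1) := by
  rw [node_succ]
  have : (0 : ℝ) < 2 / n := by positivity
  linarith

lemma node_zero (n : ℕ) : node n 0 = -1 := by simp [node]

lemma node_self {n : ℕ} (hn : 0 < n) : node n n = 1 := by
  have : (n : ℝ) ≠ 0 := by positivity
  unfold node; field_simp; norm_num

lemma node_mono {n : ℕ} (hn : 0 < n) : StrictMono (node n) := strictMono_nat_of_lt_succ (node_lt_succ hn)

lemma node_mem {n i : ℕ} (hn : 0 < n) (hi : i ≤ n) : node n i ∈ Icc (-1 : ℝ) 1 := by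
  constructor
  · rw [← node_zero n]; exact (node_mono hn).monotone (Nat.zero_le i)
  · rw [← node_self hn]; exact (node_mono hn).monotone hi

/-- The weighted squared difference quotient of `g` over the `i`-th cell, zero at the two ends. -/
def cell (l : ℕ) (g : ℝ → ℝ) (n i : ℕ) : ℝ :=
  if 0 < i ∧ i + 1 < n then min (dd (node n i)) (dd (node n (i + 1))) ^ l *
    ((g (node n (i + 1)) - g (node n i)) / (2 / n)) ^ 2 else 0

lemma min_dd_nonneg {x y : ℝ} (hx : x ∈ Icc (-1 : ℝ) 1) (hy : y ∈ Icc (-1 : ℝ) 1) :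
    0 ≤ min (dd x) (dd y) := le_min (dd_nonneg hx) (dd_nonneg hy)

lemma cell_nonneg (l : ℕ) (g : ℝ → ℝ) (n i : ℕ) : 0 ≤ cell l g n i := by
  unfold cell
  split_ifs with h
  · have hn : 0 < n := by omega
    have := min_dd_nonneg (node_mem hn (show i ≤ n by omega)) (node_mem hn (show i + 1 ≤ n by omega))
    positivity
  · exact le_rfl

lemma min_dd_le {x y z : ℝ} (hz : z ∈ Icc x y) : min (dd x) (dd y) ≤ dd z := by
  have hxz := hz.1
  have hzy := hz.2
  unfold dd
  rcases le_total 0 z with h0 | h0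
  · exact (min_le_right _ _).trans (by nlinarith)
  · exact (min_le_left _ _).trans (by nlinarith)

lemma sum_cell_le (l : ℕ) (p : ℝ[X]) {n : ℕ} (hn : 0 < n) :
    ∑ i ∈ Finset.range n, cell l (fun x => p.eval x) n i * (2 / n) ≤ J l (derivative p) := by
  have h1 : J l (derivative p) = ∑ i ∈ Finset.range n,
      ∫ x in node n i..node n (i + 1), dd x ^ l * (derivative p).eval x ^ 2 := by
    rw [intervalIntegral.sum_integral_adjacent_intervals fun k _ =>
      (continuous_wt l (derivative p)).intervalIntegrable _ _, node_zero, node_self hn]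
    rfl
  rw [h1]
  refine Finset.sum_le_sum fun i hi => ?_
  rw [Finset.mem_range] at hi
  have m1 := node_mem hn hi.le
  have m2 := node_mem hn (Nat.succ_le_of_lt hi)
  have hlt := node_lt_succ hn i
  have hstep : node n (i + 1) - node n i = 2 / n := by rw [node_succ]; ring
  have hpos : (0 : ℝ) < 2 / n := by positivity
  unfold cell
  split_ifs with h
  · have h2 := sq_sub_le_integral p hlt.le
    rw [hstep] at h2
    have h3 := min_dd_nonneg m1 m2
    have h4 : min (dd (node n i)) (dd (node n (i + 1))) ^ l *
        ∫ z in node n i..node n (i + 1), (derivative p).eval z ^ 2 ≤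
        ∫ x in node n i..node n (i + 1), dd x ^ l * (derivative p).eval x ^ 2 := by
      rw [← intervalIntegral.integral_const_mul]
      refine intervalIntegral.integral_mono_on hlt.le (Continuous.intervalIntegrable (by fun_prop) _ _)
        ((continuous_wt l _).intervalIntegrable _ _) fun x hx => ?_
      exact mul_le_mul_of_nonneg_right (pow_le_pow_left₀ h3 (min_dd_le hx) l) (sq_nonneg _)
    refine le_trans ?_ h4
    rw [mul_assoc]
    refine mul_le_mul_of_nonneg_left ?_ (pow_nonneg h3 l)
    rw [div_pow, div_mul_eq_mul_div, div_le_iff₀ (by positivity)]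
    nlinarith
  · rw [zero_mul]
    refine intervalIntegral.integral_nonneg hlt.le fun x hx => ?_
    have := dd_nonneg (x := x) ⟨m1.1.trans hx.1, hx.2.trans m2.2⟩
    positivity

/-- The step function built from the cells. -/
def step (l : ℕ) (g : ℝ → ℝ) (n : ℕ) (x : ℝ) : ENNReal :=
  ∑ i ∈ Finset.range n, (Ico (node n i) (node n (i + 1))).indicator
    (fun _ => ENNReal.ofReal (cell l g n i)) x

lemma measurable_step (l : ℕ) (g : ℝ → ℝ) (n : ℕ) : Measurable (step l g n) := by
  unfold step
  exact Finset.measurable_fun_sum _ fun i _ => measurable_const.indicator measurableSet_Ico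

lemma lintegral_step (l : ℕ) (g : ℝ → ℝ) {n : ℕ} (hn : 0 < n) : ∫⁻ x, step l g n x =
    ENNReal.ofReal (∑ i ∈ Finset.range n, cell l g n i * (2 / n)) := by
  unfold step
  rw [lintegral_finsetSum _ fun i _ => measurable_const.indicator measurableSet_Ico,
    ENNReal.ofReal_sum_of_nonneg fun i _ => mul_nonneg (cell_nonneg _ _ _ _) (by positivity)]
  refine Finset.sum_congr rfl fun i _ => ?_
  rw [lintegral_indicator measurableSet_Ico, setLIntegral_const, Real.volume_Ico,
    ENNReal.ofReal_mul (cell_nonneg _ _ _ _), node_succ]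
  congr 2; ring

lemma tendsto_cell (l : ℕ) {g : ℝ → ℝ} {x : ℝ} (hx : x ∈ Ω₀) (hg : DifferentiableAt ℝ g x) :
    Tendsto (fun n : ℕ => cell l g n ⌊(x + 1) * n / 2⌋₊) atTop (𝓝 (dd x ^ l * deriv g x ^ 2)) := by
  have hx1 : 0 < x + 1 := by linarith [hx.1]
  set a : ℕ → ℝ := fun n => node n ⌊(x + 1) * n / 2⌋₊ with ha
  have bounds : ∀ n : ℕ, 0 < n → a n ≤ x ∧ x < a n + 2 / n := by
    intro n hn
    have h0 : (0 : ℝ) < n := by exact_mod_cast hn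
    have h1 := Nat.floor_le (show 0 ≤ (x + 1) * n / 2 by positivity)
    have h2 := Nat.lt_floor_add_one ((x + 1) * n / 2)
    simp only [ha, node]
    set k : ℝ := (⌊(x + 1) * n / 2⌋₊ : ℝ)
    constructor
    · have : 2 * k / n ≤ x + 1 := by rw [div_le_iff₀ h0]; linarith
      linarith
    · have : x + 1 < 2 * k / n + 2 / n := by rw [← add_div, lt_div_iff₀ h0]; linarith
      linarith
  have hstep : Tendsto (fun n : ℕ => (2 : ℝ) / n) atTop (𝓝 0) :=
    tendsto_const_div_atTop_nhds_zero_nat 2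
  have ta : Tendsto a atTop (𝓝 x) := by
    have : Tendsto (fun n : ℕ => x - 2 / (n : ℝ)) atTop (𝓝 x) := by
      simpa using hstep.const_sub x
    refine tendsto_of_tendsto_of_tendsto_of_le_of_le' this tendsto_const_nhds ?_ ?_
    · filter_upwards [eventually_gt_atTop 0] with n hn
      linarith [(bounds n hn).2]
    · filter_upwards [eventually_gt_atTop 0] with n hn
      exact (bounds n hn).1
  have tb : Tendsto (fun n => a n + 2 / (n : ℝ)) atTop (𝓝 x) := by simpa using ta.add hstep
  have tslope : Tendsto (fun n : ℕ => (g (a n + 2 / n) - g (a n)) / (2 / n)) atTop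
      (𝓝 (deriv g x)) := by
    rw [Metric.tendsto_atTop']
    intro ε hε
    have ho := (hasDerivAt_iff_isLittleO.1 hg.hasDerivAt)
    rw [Asymptotics.isLittleO_iff] at ho
    have ho' := ho (half_pos hε)
    have := ((ta.eventually ho').and (tb.eventually ho')).and (eventually_gt_atTop 0)
    obtain ⟨n₀, hn₀⟩ := eventually_atTop.1 this
    refine ⟨n₀, fun n hn => ?_⟩
    obtain ⟨⟨h1, h2⟩, h3⟩ := hn₀ n hn.le
    obtain ⟨b1, b2⟩ := bounds n h3
    have hp : (0 : ℝ) < 2 / n := by positivity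
    rw [Real.norm_eq_abs, Real.norm_eq_abs, smul_eq_mul] at h1 h2
    rw [abs_of_nonpos (by linarith : a n - x ≤ 0)] at h1
    rw [abs_of_nonneg (by linarith : 0 ≤ a n + 2 / n - x)] at h2
    rw [Real.dist_eq, div_sub' hp.ne', abs_div, abs_of_pos hp, div_lt_iff₀ hp]
    have h4 : g (a n + 2 / n) - g (a n) - 2 / n * deriv g x =
        (g (a n + 2 / n) - g x - (a n + 2 / n - x) * deriv g x) -
        (g (a n) - g x - (a n - x) * deriv g x) := by ring
    rw [h4]
    refine (abs_sub _ _).trans_lt ?_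
    nlinarith
  have cdd := hasDerivAt_dd x |>.continuousAt
  have tmin : Tendsto (fun n : ℕ => min (dd (a n)) (dd (a n + 2 / n))) atTop (𝓝 (dd x)) := by
    have := (cdd.tendsto.comp ta).min (cdd.tendsto.comp tb)
    rwa [min_self] at this
  refine ((tmin.pow l).mul (tslope.pow 2)).congr' ?_
  have e1 : ∀ᶠ n in atTop, -1 < a n := ta.eventually (lt_mem_nhds hx.1)
  have e2 : ∀ᶠ n : ℕ in atTop, a n + 2 / n < 1 := tb.eventually (gt_mem_nhds hx.2)
  filter_upwards [e1, e2, eventually_gt_atTop 0] with n h1 h2 hn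
  have c1 : 0 < ⌊(x + 1) * n / 2⌋₊ := by
    rw [← node_zero n] at h1
    exact (node_mono hn).lt_iff_lt.1 h1
  have c2 : ⌊(x + 1) * n / 2⌋₊ + 1 < n := by
    refine (node_mono hn).lt_iff_lt.1 ?_
    rw [node_succ, node_self hn]
    exact h2
  rw [cell, if_pos ⟨c1, c2⟩, node_succ]

/-- Weighted `L²` bounds on derivatives of polynomials pass to the derivative of the limit. -/
lemma integral_deriv_sq_le {l : ℕ} {M : ℝ} {g : ℝ → ℝ} {p : ℕ → ℝ[X]}
    (hJ : ∀ N, J l (derivative (p N)) ≤ M)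
    (hg : ∀ x ∈ Ω₀, Tendsto (fun N => (p N).eval x) U (𝓝 (g x))) :
    ∫ x in Ω₀, dd x ^ l * deriv g x ^ 2 ≤ M := by
  have hM : 0 ≤ M := (J_nonneg _ _).trans (hJ 0)
  have hsum : ∀ n : ℕ, 0 < n → ∑ i ∈ Finset.range n, cell l g n i * (2 / n) ≤ M := by
    intro n hn
    refine le_of_tendsto (x := U)
      (f := fun N => ∑ i ∈ Finset.range n, cell l (fun x => (p N).eval x) n i * (2 / n)) ?_
      (Eventually.of_forall fun N => (sum_cell_le l (p N) hn).trans (hJ N))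
    refine tendsto_finsetSum _ fun i _ => Tendsto.mul_const _ ?_
    unfold cell
    split_ifs with h
    · have m : ∀ j : ℕ, 0 < j → j < n → node n j ∈ Ω₀ := fun j h1 h2 =>
        ⟨by rw [← node_zero n]; exact node_mono hn h1, by
          rw [← node_self hn]; exact node_mono hn h2⟩
      exact ((((hg _ (m _ (by omega) h.2)).sub (hg _ (m _ h.1 (by omega)))).div_const _).pow
        2).const_mul _
    · exact tendsto_const_nhds
  rw [integral_eq_lintegral_of_nonneg_ae]
  rotate_left
  · refine (ae_restrict_iff' measurableSet_Ioo).2 (ae_of_all _ fun x hx => ?_)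
    have := dd_pos hx
    simp only [Pi.zero_apply]; positivity
  · exact (((continuous_dd.pow l).measurable).mul ((measurable_deriv g).pow_const 2)).aestronglyMeasurable
  refine ENNReal.toReal_le_of_le_ofReal hM ?_
  calc ∫⁻ x in Ω₀, ENNReal.ofReal (dd x ^ l * deriv g x ^ 2)
      ≤ ∫⁻ x in Ω₀, liminf (fun n => step l g n x) atTop := by
        refine setLIntegral_mono' measurableSet_Ioo fun x hx => ?_
        by_cases hd : DifferentiableAt ℝ g x
        · have t := (ENNReal.continuous_ofReal.tendsto _).comp (tendsto_cell l hx hd)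
          rw [← t.liminf_eq]
          refine liminf_le_liminf ?_
          filter_upwards [eventually_gt_atTop 0] with n hn
          have hx1 : 0 < x + 1 := by linarith [hx.1]
          have h0 : (0 : ℝ) < n := by exact_mod_cast hn
          have h1 := Nat.floor_le (show 0 ≤ (x + 1) * n / 2 by positivity)
          have h2 := Nat.lt_floor_add_one ((x + 1) * n / 2)
          set k := ⌊(x + 1) * n / 2⌋₊
          have hk : x ∈ Ico (node n k) (node n (k + 1)) := by
            rw [node_succ]; unfold node
            constructor
            · have : 2 * (k : ℝ) / n ≤ x + 1 := by rw [div_le_iff₀ h0]; linarith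
              linarith
            · have : x + 1 < 2 * (k : ℝ) / n + 2 / n := by
                rw [← add_div, lt_div_iff₀ h0]; linarith
              linarith
          have hkn : k ∈ Finset.range n := by
            rw [Finset.mem_range]
            refine (node_mono hn).lt_iff_lt.1 (hk.1.trans_lt ?_)
            rw [node_self hn]; exact hx.2
          simp only [Function.comp_apply, step]
          refine le_trans ?_ (Finset.single_le_sum (fun _ _ => zero_le) hkn)
          rw [indicator_of_mem hk]
        · rw [deriv_zero_of_not_differentiableAt hd]; simp
    _ ≤ ∫⁻ x, liminf (fun n => step l g n x) atTop := setLIntegral_le_lintegral _ _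
    _ ≤ liminf (fun n => ∫⁻ x, step l g n x) atTop := lintegral_liminf_le fun n => measurable_step l g n
    _ ≤ ENNReal.ofReal M := by
        refine liminf_le_of_frequently_le' (Eventually.frequently ?_)
        filter_upwards [eventually_gt_atTop 0] with n hn
        rw [lintegral_step l g hn]
        exact ENNReal.ofReal_le_ofReal (hsum n hn)

lemma dd_le_dd_of_mem {r x : ℝ} (hx : x ∈ Icc (-r) r) : dd r ≤ dd x := by
  have : x ^ 2 ≤ r ^ 2 := sq_le_sq' hx.1 hx.2
  unfold dd; linarith

/-- Interior Hölder continuity from a weighted bound on the derivative. -/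
lemma abs_sub_le_sqrt {L : ℕ} {M r : ℝ} {p : ℝ[X]} (hr : r ∈ Ioo (0 : ℝ) 1)
    (hJ : J L (derivative p) ≤ M) {x y : ℝ} (hx : x ∈ Icc (-r) r) (hy : y ∈ Icc (-r) r) :
    |p.eval y - p.eval x| ≤ √(M / dd r ^ L * |y - x|) := by
  wlog h : x ≤ y generalizing x y
  · rw [abs_sub_comm, abs_sub_comm y]; exact this hy hx (le_of_not_ge h)
  have hd : 0 < dd r := dd_pos ⟨by linarith [hr.1], hr.2⟩
  refine Real.abs_le_sqrt ((sq_sub_le_integral p h).trans ?_)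
  rw [abs_of_nonneg (sub_nonneg.2 h), mul_comm]
  refine mul_le_mul_of_nonneg_right ?_ (sub_nonneg.2 h)
  rw [le_div_iff₀ (by positivity), mul_comm, ← intervalIntegral.integral_const_mul]
  refine le_trans ?_ hJ
  calc ∫ z in x..y, dd r ^ L * (derivative p).eval z ^ 2
      ≤ ∫ z in x..y, dd z ^ L * (derivative p).eval z ^ 2 := by
        refine intervalIntegral.integral_mono_on h (Continuous.intervalIntegrable (by fun_prop) _ _)
          ((continuous_wt _ _).intervalIntegrable _ _) fun z hz => ?_
        have := dd_le_dd_of_mem (r := r) (x := z) ⟨hx.1.trans hz.1, hz.2.trans hy.2⟩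
        gcongr
    _ ≤ J L (derivative p) := by
        refine intervalIntegral.integral_mono_interval (by linarith [hx.1, hr.2]) h
          (by linarith [hy.2, hr.2]) ?_ ((continuous_wt _ _).intervalIntegrable _ _)
        refine (ae_restrict_iff' measurableSet_Ioc).2 (ae_of_all _ fun z hz => ?_)
        have := dd_nonneg (x := z) ⟨hz.1.le, hz.2⟩
        simp only [Pi.zero_apply]; positivity

lemma abs_eval_le_sqrt {L : ℕ} {M : ℝ} {p : ℝ[X]} (h0 : J L p ≤ M)
    (h1 : J L (derivative p) ≤ M) {x : ℝ} (hx : x ∈ Ω₀) :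
    |p.eval x| ≤ √((L + 2) * (2 * M) / dd x ^ (L + 1)) := by
  have hd : 0 < dd x := dd_pos hx
  refine Real.abs_le_sqrt ?_
  rw [le_div_iff₀ (by positivity), mul_comm]
  refine (sup_wt L p (Ioo_subset_Icc_self hx)).trans ?_
  have := (J_anti (show L ≤ L + 2 by omega) (derivative p)).trans h1
  gcongr
  linarith

lemma exists_primitive (p : ℝ[X]) : ∃ q : ℝ[X], derivative q = p ∧ q.eval 0 = 0 := by
  induction p using Polynomial.induction_on' with
  | add p q hp hq =>
    obtain ⟨a, ha, ha'⟩ := hp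
    obtain ⟨b, hb, hb'⟩ := hq
    exact ⟨a + b, by rw [derivative_add, ha, hb], by rw [eval_add, ha', hb', add_zero]⟩
  | monomial n c =>
    refine ⟨monomial (n + 1) (c / (n + 1)), ?_, by simp⟩
    rw [derivative_monomial]
    congr 1
    push_cast
    field_simp

lemma exists_radius {x : ℝ} (hx : x ∈ Ω₀) : ∃ r ∈ Ioo (0 : ℝ) 1, x ∈ Ioo (-r) r := by
  have h : |x| < 1 := abs_lt.2 hx
  refine ⟨(1 + |x|) / 2, ⟨by positivity, by linarith⟩, abs_lt.1 (by linarith)⟩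

/-- Interior limits of polynomials under uniform weighted bounds. -/
lemma hasDerivAt_of_bounds {L : ℕ} {M : ℝ} {p : ℕ → ℝ[X]} {f g : ℝ → ℝ}
    (hJ : ∀ N, J L (derivative (derivative (p N))) ≤ M)
    (hf : ∀ x ∈ Ω₀, Tendsto (fun N => (p N).eval x) U (𝓝 (f x)))
    (hg : ∀ x ∈ Ω₀, Tendsto (fun N => (derivative (p N)).eval x) U (𝓝 (g x))) {x : ℝ}
    (hx : x ∈ Ω₀) : HasDerivAt f (g x) x := by
  obtain ⟨r, hr, hxr⟩ := exists_radius hx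
  have hsub : Ioo (-r) r ⊆ Ω₀ := Ioo_subset_Ioo (by linarith [hr.2]) hr.2.le
  have hd : 0 < dd r := dd_pos ⟨by linarith [hr.1], hr.2⟩
  have hM : 0 ≤ M := (J_nonneg _ _).trans (hJ 0)
  refine (hasDerivWithinAt_of_tendsto (convex_Ioo (-r) r)
    (φ := fun N x => (p N).eval x) (ψ := fun N x => (derivative (p N)).eval x)
    (ω := fun s => √(M / dd r ^ L * s)) ?_ ?_ (Eventually.of_forall fun N => ⟨fun z _ =>
      ((p N).hasDerivAt z).hasDerivWithinAt, fun z hz y hy =>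
      abs_sub_le_sqrt hr (hJ N) (Ioo_subset_Icc_self hz) (Ioo_subset_Icc_self hy)⟩)
    (fun z hz => hf z (hsub hz)) (fun z hz => hg z (hsub hz)) hxr).hasDerivAt
    (Ioo_mem_nhds hxr.1 hxr.2)
  · intro a _ b _ hab
    have : 0 ≤ M / dd r ^ L := by positivity
    exact Real.sqrt_le_sqrt (by gcongr)
  · have : Continuous fun s => √(M / dd r ^ L * s) := by fun_prop
    simpa using this.tendsto 0

lemma integral_sq_le {L l : ℕ} {M M' : ℝ} {p : ℕ → ℝ[X]} {f : ℝ → ℝ}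
    (h0 : ∀ N, J L (p N) ≤ M) (h1 : ∀ N, J L (derivative (p N)) ≤ M) (hl : ∀ N, J l (p N) ≤ M')
    (hf : ∀ x ∈ Ω₀, Tendsto (fun N => (p N).eval x) U (𝓝 (f x))) :
    ∫ x in Ω₀, dd x ^ l * f x ^ 2 ≤ M' := by
  choose G hG hG0 using fun N => exists_primitive (p N)
  have hGt : ∀ x ∈ Ω₀, Tendsto (fun N => (G N).eval x) U (𝓝 (ul fun N => (G N).eval x)) := by
    intro x hx
    obtain ⟨r, hr, hxr⟩ := exists_radius hx
    refine tendsto_ul (R := √(M / dd r ^ L * |x - 0|)) fun N => ?_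
    have := abs_sub_le_sqrt (p := G N) (M := M) (L := L) hr (by rw [hG]; exact h0 N)
      (x := 0) ⟨by linarith [hr.1], hr.1.le⟩ (Ioo_subset_Icc_self hxr)
    rwa [hG0, sub_zero] at this
  have hder : ∀ x ∈ Ω₀, HasDerivAt (fun x => ul fun N => (G N).eval x) (f x) x := fun x hx =>
    hasDerivAt_of_bounds (L := L) (M := M) (p := G) (fun N => by rw [hG]; exact h1 N) hGt
      (fun z hz => by simpa only [hG] using hf z hz) hx
  refine le_trans (le_of_eq ?_)
    (integral_deriv_sq_le (l := l) (M := M') (p := G) (fun N => by rw [hG]; exact hl N) hGt)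
  refine setIntegral_congr_fun measurableSet_Ioo fun x hx => ?_
  simp only [(hder x hx).deriv]

/-- Weighted bounds, convergence and differentiability pass to the interior limit. -/
lemma limit_bounds {h : ℕ → ℝ[X]} {f : ℝ → ℝ} {m : ℕ} (hm : 1 ≤ m) {l : ℕ → ℕ} {M : ℕ → ℝ}
    (hJ : ∀ k ≤ m, ∀ N, J (l k) (derivative^[k] (h N)) ≤ M k)
    (hf : ∀ x ∈ Ω₀, Tendsto (fun N => (h N).eval x) U (𝓝 (f x))) :
    (∀ k < m, ∀ x ∈ Ω₀,
      Tendsto (fun N => (derivative^[k] (h N)).eval x) U (𝓝 (iteratedDeriv k f x))) ∧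
    (∀ k, k + 1 < m → ∀ x ∈ Ω₀, DifferentiableAt ℝ (iteratedDeriv k f) x) ∧
    ∀ k ≤ m, ∫ x in Ω₀, dd x ^ l k * iteratedDeriv k f x ^ 2 ≤ M k := by
  set L := ∑ k ∈ Finset.range (m + 1), l k with hL
  set K := ∑ k ∈ Finset.range (m + 1), M k with hK
  have hM : ∀ k ≤ m, 0 ≤ M k := fun k hk => (J_nonneg _ _).trans (hJ k hk 0)
  have hJL : ∀ k ≤ m, ∀ N, J L (derivative^[k] (h N)) ≤ K := by
    intro k hk N
    have hk' : k ∈ Finset.range (m + 1) := Finset.mem_range.2 (by omega)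
    exact (J_anti (Finset.single_le_sum (fun _ _ => Nat.zero_le _) hk') _).trans
      ((hJ k hk N).trans (Finset.single_le_sum (f := M)
        (fun i hi => hM i (by have := Finset.mem_range.1 hi; omega)) hk'))
  set g : ℕ → ℝ → ℝ := fun k x => ul fun N => (derivative^[k] (h N)).eval x with hg
  have ht : ∀ k < m, ∀ x ∈ Ω₀,
      Tendsto (fun N => (derivative^[k] (h N)).eval x) U (𝓝 (g k x)) := fun k hk x hx =>
    tendsto_ul fun N => abs_eval_le_sqrt (hJL k hk.le N)
      (by rw [derivative_iter]; exact hJL (k + 1) hk N) hx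
  have hd : ∀ k, k + 1 < m → ∀ x ∈ Ω₀, HasDerivAt (g k) (g (k + 1) x) x := fun k hk x hx =>
    hasDerivAt_of_bounds (L := L) (M := K) (p := fun N => derivative^[k] (h N))
      (fun N => by rw [derivative_iter, derivative_iter]; exact hJL (k + 2) hk N)
      (ht k (by omega)) (fun z hz => by simpa only [derivative_iter] using ht (k + 1) hk z hz) hx
  have heq : ∀ k < m, ∀ x ∈ Ω₀, iteratedDeriv k f x = g k x := by
    intro k
    induction k with
    | zero =>
      intro _ x hx
      rw [iteratedDeriv_zero]
      exact tendsto_nhds_unique (hf x hx) (ht 0 (by omega) x hx)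
    | succ k ih =>
      intro hk x hx
      have : iteratedDeriv k f =ᶠ[𝓝 x] g k := by
        filter_upwards [isOpen_Ioo.mem_nhds hx] with z hz using ih (by omega) z hz
      rw [iteratedDeriv_succ, this.deriv_eq, (hd k hk x hx).deriv]
  have ht' : ∀ k < m, ∀ x ∈ Ω₀,
      Tendsto (fun N => (derivative^[k] (h N)).eval x) U (𝓝 (iteratedDeriv k f x)) :=
    fun k hk x hx => by rw [heq k hk x hx]; exact ht k hk x hx
  refine ⟨ht', fun k hk x hx => ?_, fun k hk => ?_⟩
  · have : iteratedDeriv k f =ᶠ[𝓝 x] g k := by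
      filter_upwards [isOpen_Ioo.mem_nhds hx] with z hz using heq k (by omega) z hz
    exact (hd k hk x hx).differentiableAt.congr_of_eventuallyEq this
  · cases k with
    | zero =>
      simp only [iteratedDeriv_zero]
      exact integral_sq_le (hJL 0 (by omega)) (hJL 1 hm) (hJ 0 hk) hf
    | succ k =>
      rw [iteratedDeriv_succ]
      exact integral_deriv_sq_le (fun N => by rw [derivative_iter]; exact hJ (k + 1) hk N)
        (ht' k hk)

lemma integrable_mul_poly {f : ℝ → ℝ} (hf : ContinuousOn f (Icc (-1) 1)) (q : ℝ[X]) :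
    IntervalIntegrable (fun x => f x * q.eval x) volume (-1) 1 :=
  integrable_of_continuousOn (hf.mul q.continuous.continuousOn)

lemma le_of_integral_le {e : ℝ → ℝ} {c : ℝ} (he : ContinuousOn e (Icc (-1) 1)) (hc : 0 ≤ c)
    (h : ∀ q : ℝ[X], ∫ x in (-1 : ℝ)..1, e x * q.eval x ≤ c * ∫ x in (-1 : ℝ)..1, |q.eval x|)
    {x : ℝ} (hx : x ∈ Icc (-1 : ℝ) 1) : e x ≤ c := by
  by_contra! hlt
  set f : ℝ → ℝ := fun x => max (e x - c) 0 with hf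
  have hfc : ContinuousOn f (Icc (-1) 1) := (he.sub continuousOn_const).sup continuousOn_const
  have hf0 : ∀ x, 0 ≤ f x := fun x => le_max_right _ _
  have hpos : 0 < ∫ x in (-1 : ℝ)..1, f x ^ 2 := by
    refine intervalIntegral.integral_pos (by norm_num) (hfc.pow 2) (fun x _ => sq_nonneg _)
      ⟨x, hx, ?_⟩
    have : 0 < f x := lt_max_of_lt_left (sub_pos.2 hlt)
    positivity
  have hsq : ∀ x, f x ^ 2 = e x * f x - c * f x := by
    intro x
    simp only [hf]
    rcases le_total (e x - c) 0 with h | h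
    · rw [max_eq_right h]; ring
    · rw [max_eq_left h]; ring
  have ie : IntervalIntegrable (fun x => |e x|) volume (-1) 1 := integrable_of_continuousOn he.abs
  have ief : IntervalIntegrable (fun x => e x * f x) volume (-1) 1 :=
    integrable_of_continuousOn (he.mul hfc)
  have iF : IntervalIntegrable f volume (-1) 1 := integrable_of_continuousOn hfc
  set E := ∫ x in (-1 : ℝ)..1, |e x| with hE
  have hE0 : 0 ≤ E := intervalIntegral.integral_nonneg (by norm_num) fun _ _ => abs_nonneg _
  have main : ∀ ε > 0, ∫ x in (-1 : ℝ)..1, f x ^ 2 ≤ ε * (E + 2 * c) := by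
    intro ε hε
    obtain ⟨p, hp⟩ := exists_polynomial_near_of_continuousOn (-1) 1 f hfc ε hε
    have h1 : ∫ x in (-1 : ℝ)..1, e x * f x ≤ ∫ x in (-1 : ℝ)..1, (e x * p.eval x + ε * |e x|) := by
      refine intervalIntegral.integral_mono_on (by norm_num) ief
        ((integrable_mul_poly he p).add (ie.const_mul _)) fun x hx => ?_
      have := abs_mul (e x) (f x - p.eval x)
      have h2 := (abs_le.1 this.le).2
      have h3 : |f x - p.eval x| ≤ ε := by rw [abs_sub_comm]; exact (hp x hx).le
      have h4 := mul_le_mul_of_nonneg_left h3 (abs_nonneg (e x))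
      have h5 := le_abs_self (e x * (f x - p.eval x))
      nlinarith
    have h2 : ∫ x in (-1 : ℝ)..1, |p.eval x| ≤ ∫ x in (-1 : ℝ)..1, (f x + ε) := by
      refine intervalIntegral.integral_mono_on (by norm_num)
        (Continuous.intervalIntegrable (by fun_prop) _ _) (iF.add (by simp)) fun x hx => ?_
      have h3 := abs_le.1 (hp x hx).le
      exact abs_le.2 ⟨by linarith [hf0 x], by linarith⟩
    rw [intervalIntegral.integral_add (integrable_mul_poly he p) (ie.const_mul _),
      intervalIntegral.integral_const_mul] at h1
    rw [intervalIntegral.integral_add iF (by simp), intervalIntegral.integral_const] at h2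
    simp only [hsq]
    rw [intervalIntegral.integral_sub ief (iF.const_mul _), intervalIntegral.integral_const_mul]
    have h3 := h p
    have h4 := mul_le_mul_of_nonneg_left h2 hc
    norm_num at h4
    nlinarith
  set I := ∫ x in (-1 : ℝ)..1, f x ^ 2 with hI
  have h6 := main (I / (2 * (E + 2 * c + 1))) (by positivity)
  have h7 : I / (2 * (E + 2 * c + 1)) * (E + 2 * c) ≤ I / 2 := by
    rw [div_mul_eq_mul_div, div_le_div_iff₀ (by positivity) (by norm_num)]
    nlinarith
  linarith

/-- A continuous function dominated weakly against polynomials is dominated pointwise. -/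
lemma abs_le_of_integral_le {e : ℝ → ℝ} {c : ℝ} (he : ContinuousOn e (Icc (-1) 1)) (hc : 0 ≤ c)
    (h : ∀ q : ℝ[X], |∫ x in (-1 : ℝ)..1, e x * q.eval x| ≤ c * ∫ x in (-1 : ℝ)..1, |q.eval x|)
    {x : ℝ} (hx : x ∈ Icc (-1 : ℝ) 1) : |e x| ≤ c := by
  refine abs_le'.2 ⟨le_of_integral_le he hc (fun q => (le_abs_self _).trans (h q)) hx,
    le_of_integral_le (e := fun x => -e x) he.neg hc (fun q => ?_) hx⟩
  refine le_trans ?_ (h q)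
  simp only [neg_mul, intervalIntegral.integral_neg]
  exact neg_le_abs _

lemma continuousOn_of_lipschitz {f : ℝ → ℝ} {K : ℝ} {S : Set ℝ}
    (h : ∀ x ∈ S, ∀ y ∈ S, |f x - f y| ≤ K * |x - y|) : ContinuousOn f S := by
  have : LipschitzOnWith (Real.toNNReal K) f S := LipschitzOnWith.of_dist_le_mul fun x hx y hy => by
    rw [Real.dist_eq, Real.dist_eq]
    exact (h x hx y hy).trans (mul_le_mul_of_nonneg_right (Real.le_coe_toNNReal K) (abs_nonneg _))
  exact this.continuousOn

lemma lipschitz_limit {f : ℕ → ℝ → ℝ} {g : ℝ → ℝ} {K : ℝ} {S : Set ℝ}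
    (h : ∀ᶠ N in U, ∀ x ∈ S, ∀ y ∈ S, |f N x - f N y| ≤ K * |x - y|)
    (hg : ∀ x ∈ S, Tendsto (fun N => f N x) U (𝓝 (g x))) :
    ∀ x ∈ S, ∀ y ∈ S, |g x - g y| ≤ K * |x - y| := fun x hx y hy =>
  le_of_tendsto ((hg x hx).sub (hg y hy)).abs (h.mono fun _ hN => hN x hx y hy)

/-- Pointwise limits of uniformly Lipschitz functions converge weakly. -/
lemma tendsto_integral {f : ℕ → ℝ → ℝ} {g : ℝ → ℝ} {K : ℝ}
    (h : ∀ᶠ N in U, ∀ x ∈ Icc (-1 : ℝ) 1, ∀ y ∈ Icc (-1 : ℝ) 1, |f N x - f N y| ≤ K * |x - y|)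
    (hg : ∀ x ∈ Icc (-1 : ℝ) 1, Tendsto (fun N => f N x) U (𝓝 (g x))) (q : ℝ[X]) :
    Tendsto (fun N => ∫ x in (-1 : ℝ)..1, f N x * q.eval x) U
      (𝓝 (∫ x in (-1 : ℝ)..1, g x * q.eval x)) := by
  have hK : 0 ≤ K := by
    obtain ⟨N, hN⟩ := h.exists
    have := (abs_nonneg _).trans (hN 1 (by simp) 0 (by simp))
    simpa using this
  have hL := lipschitz_limit h hg
  have hu : TendstoUniformlyOn f g U (Icc (-1) 1) := by
    rw [← tendstoLocallyUniformlyOn_iff_tendstoUniformlyOn_of_compact isCompact_Icc,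
      Metric.tendstoLocallyUniformlyOn_iff]
    intro ε hε x hx
    refine ⟨Metric.ball x (ε / (3 * (K + 1))) ∩ Icc (-1) 1,
      inter_mem (mem_nhdsWithin_of_mem_nhds (Metric.ball_mem_nhds _ (by positivity)))
        self_mem_nhdsWithin, ?_⟩
    filter_upwards [h, (Metric.tendsto_nhds.1 (hg x hx)) (ε / 3) (by positivity)] with N hN hN2 y hy
    have hyx : K * |y - x| ≤ ε / 3 := by
      have h1 : |y - x| < ε / (3 * (K + 1)) := by rw [← Real.dist_eq]; exact hy.1
      have h2 : K * (ε / (3 * (K + 1))) ≤ ε / 3 := by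
        rw [mul_div_assoc', div_le_div_iff₀ (by positivity) (by norm_num)]
        nlinarith
      exact (mul_le_mul_of_nonneg_left h1.le hK).trans h2
    have h1 := abs_le.1 ((hL y hy.2 x hx).trans hyx)
    have h2 := abs_le.1 ((hN y hy.2 x hx).trans hyx)
    rw [Real.dist_eq] at hN2 ⊢
    have h3 := abs_lt.1 hN2
    exact abs_lt.2 ⟨by linarith [h1.1, h2.2, h3.2], by linarith [h1.2, h2.1, h3.1]⟩
  obtain ⟨R, hR⟩ := isCompact_Icc.exists_bound_of_continuousOn
    (q.continuous.continuousOn (s := Icc (-1 : ℝ) 1))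
  have hR0 : 0 ≤ R := (norm_nonneg _).trans (hR 0 (by simp))
  rw [Metric.tendsto_nhds]
  intro ε hε
  filter_upwards [h, Metric.tendstoUniformlyOn_iff.1 hu (ε / (4 * (R + 1))) (by positivity)]
    with N hN hN2
  rw [Real.dist_eq, ← intervalIntegral.integral_sub
    (integrable_mul_poly (continuousOn_of_lipschitz hN) q)
    (integrable_mul_poly (continuousOn_of_lipschitz hL) q), ← Real.norm_eq_abs]
  refine lt_of_le_of_lt (intervalIntegral.norm_integral_le_of_norm_le_const
    (C := ε / (4 * (R + 1)) * R) fun x hx => ?_) ?_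
  · rw [uIoc_of_le (by norm_num)] at hx
    rw [← sub_mul, norm_mul]
    have := hN2 x (Ioc_subset_Icc_self hx)
    rw [dist_comm, dist_eq_norm] at this
    gcongr
    exact hR x (Ioc_subset_Icc_self hx)
  · norm_num
    rw [div_mul_eq_mul_div, div_mul_eq_mul_div, div_lt_iff₀ (by positivity)]
    nlinarith

/-- A weak time derivative along a sequence is a pointwise time derivative of the limit. -/
lemma hasDerivWithinAt_of_weak {S : Set ℝ} (hS : Convex ℝ S) {a b : ℕ → ℝ → ℝ → ℝ}
    {A B : ℝ → ℝ → ℝ} {K : ℝ} (hK : 0 ≤ K)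
    (ha : ∀ᶠ N in U, ∀ t ∈ S, ∀ x ∈ Icc (-1 : ℝ) 1, ∀ y ∈ Icc (-1 : ℝ) 1,
      |a N t x - a N t y| ≤ K * |x - y|)
    (hb : ∀ᶠ N in U, ∀ t ∈ S, ∀ x ∈ Icc (-1 : ℝ) 1, ∀ y ∈ Icc (-1 : ℝ) 1,
      |b N t x - b N t y| ≤ K * |x - y|)
    (hder : ∀ q : ℝ[X], ∀ᶠ N in U, (∀ t ∈ S,
      HasDerivWithinAt (fun t => ∫ x in (-1 : ℝ)..1, a N t x * q.eval x)
        (∫ x in (-1 : ℝ)..1, b N t x * q.eval x) S t) ∧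
      ∀ t ∈ S, ∀ s ∈ S, |(∫ x in (-1 : ℝ)..1, b N t x * q.eval x) -
        ∫ x in (-1 : ℝ)..1, b N s x * q.eval x| ≤ K * |t - s| * ∫ x in (-1 : ℝ)..1, |q.eval x|)
    (hA : ∀ t ∈ S, ∀ x ∈ Icc (-1 : ℝ) 1, Tendsto (fun N => a N t x) U (𝓝 (A t x)))
    (hB : ∀ t ∈ S, ∀ x ∈ Icc (-1 : ℝ) 1, Tendsto (fun N => b N t x) U (𝓝 (B t x)))
    {x : ℝ} (hx : x ∈ Icc (-1 : ℝ) 1) {t : ℝ} (ht : t ∈ S) :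
    HasDerivWithinAt (fun t => A t x) (B t x) S t := by
  have ca : ∀ t ∈ S, ContinuousOn (A t) (Icc (-1) 1) := fun t ht => continuousOn_of_lipschitz
    (lipschitz_limit (ha.mono fun N hN => hN t ht) (hA t ht))
  have cb : ∀ t ∈ S, ContinuousOn (B t) (Icc (-1) 1) := fun t ht => continuousOn_of_lipschitz
    (lipschitz_limit (hb.mono fun N hN => hN t ht) (hB t ht))
  have key : ∀ s ∈ S, |A s x - A t x - (s - t) * B t x| ≤ K * |s - t| * |s - t| := by
    intro s hs
    refine abs_le_of_integral_le (e := fun x => A s x - A t x - (s - t) * B t x)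
      (((ca s hs).sub (ca t ht)).sub (continuousOn_const.mul (cb t ht))) (by positivity)
      (fun q => ?_) hx
    have e1 : ∫ x in (-1 : ℝ)..1, (A s x - A t x - (s - t) * B t x) * q.eval x =
        (∫ x in (-1 : ℝ)..1, A s x * q.eval x) - (∫ x in (-1 : ℝ)..1, A t x * q.eval x) -
          (s - t) * ∫ x in (-1 : ℝ)..1, B t x * q.eval x := by
      rw [← intervalIntegral.integral_sub (integrable_mul_poly (ca s hs) q)
        (integrable_mul_poly (ca t ht) q), ← intervalIntegral.integral_const_mul,
        ← intervalIntegral.integral_sub ((integrable_mul_poly (ca s hs) q).sub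
          (integrable_mul_poly (ca t ht) q)) ((integrable_mul_poly (cb t ht) q).const_mul _)]
      refine intervalIntegral.integral_congr fun x _ => ?_
      ring
    rw [e1]
    have hlim := (((tendsto_integral (ha.mono fun N hN => hN s hs) (hA s hs) q).sub
      (tendsto_integral (ha.mono fun N hN => hN t ht) (hA t ht) q)).sub
      ((tendsto_integral (hb.mono fun N hN => hN t ht) (hB t ht) q).const_mul (s - t))).abs
    refine le_of_tendsto hlim ((hder q).mono fun N hN => ?_)
    have seg : segment ℝ t s ⊆ S := hS.segment_subset ht hs
    set Q := ∫ x in (-1 : ℝ)..1, |q.eval x| with hQ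
    have hQ0 : 0 ≤ Q := intervalIntegral.integral_nonneg (by norm_num) fun _ _ => abs_nonneg _
    have := (convex_segment t s).norm_image_sub_le_of_norm_hasDerivWithin_le
      (f := fun z => (∫ x in (-1 : ℝ)..1, a N z x * q.eval x) -
        z * ∫ x in (-1 : ℝ)..1, b N t x * q.eval x)
      (f' := fun z => (∫ x in (-1 : ℝ)..1, b N z x * q.eval x) -
        1 * ∫ x in (-1 : ℝ)..1, b N t x * q.eval x) (C := K * |s - t| * Q)
      (fun z hz => (((hN.1 z (seg hz)).mono seg).sub
        ((hasDerivWithinAt_id z _).mul_const _)))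
      (fun z hz => by
        rw [Real.norm_eq_abs, one_mul]
        refine (hN.2 z (seg hz) t ht).trans ?_
        rw [segment_eq_uIcc] at hz
        have := abs_sub_left_of_mem_uIcc hz
        gcongr)
      (left_mem_segment ℝ t s) (right_mem_segment ℝ t s)
    rw [Real.norm_eq_abs, Real.norm_eq_abs] at this
    refine (le_of_eq ?_).trans (this.trans (le_of_eq (by ring)))
    congr 1; ring
  rw [hasDerivWithinAt_iff_isLittleO, Asymptotics.isLittleO_iff]
  intro ε hε
  have h1 : Tendsto (fun y => K * |y - t|) (𝓝[S] t) (𝓝 0) := by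
    have : Tendsto (fun y => K * |y - t|) (𝓝 t) (𝓝 (K * |t - t|)) :=
      Continuous.tendsto (by fun_prop) t
    rw [sub_self, abs_zero, mul_zero] at this
    exact this.mono_left nhdsWithin_le_nhds
  filter_upwards [self_mem_nhdsWithin, h1.eventually (gt_mem_nhds hε)] with y hy hy2
  rw [Real.norm_eq_abs, Real.norm_eq_abs, smul_eq_mul]
  exact (key y hy).trans (mul_le_mul_of_nonneg_right hy2.le (abs_nonneg _))

lemma abs_le_add_one {z M : ℝ} (h : z ^ 2 ≤ M) : |z| ≤ M + 1 :=
  abs_le_of_sq_le_sq (by nlinarith [sq_nonneg z]) (by nlinarith [sq_nonneg z])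

lemma exists_pointwise_bound (B : ℝ) (hB : 0 ≤ B) : ∃ R ≥ (1 : ℝ),
    (∀ p : ℝ[X], N5 p ≤ B → ∀ x ∈ Icc (-1 : ℝ) 1,
      |p.eval x| ≤ R ∧ |sv p x 0| ≤ R ∧ |dd x * sv p x 1| ≤ R) ∧
    ∀ p : ℝ[X], N6 p ≤ B → ∀ x ∈ Icc (-1 : ℝ) 1, |dd x ^ 2 * sv p x 2| ≤ R := by
  obtain ⟨C, hC, h⟩ := exists_staticBd
  refine ⟨C * B + 1, by nlinarith, fun p hp x hx => ?_, fun p hp x hx => ?_⟩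
  · have hp' : C * N5 p ≤ C * B := by gcongr
    have hd := dd_nonneg hx
    have hd1 : dd x ≤ 1 := dd_le.trans (by norm_num)
    refine ⟨abs_le_add_one (((h p).s0 x hx).trans hp'),
      abs_le_add_one (((h p).s1 x hx).trans hp'), abs_le_add_one (le_trans ?_ hp')⟩
    have h2 := (h p).s2 x hx
    have : 0 ≤ dd x * sv p x 1 ^ 2 := by positivity
    change dd x * sv p x 1 ^ 2 ≤ _ at h2
    nlinarith
  · have hp' : C * N6 p ≤ C * B := by gcongr
    have hd := dd_nonneg hx
    have hd1 : dd x ≤ 1 := dd_le.trans (by norm_num)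
    refine abs_le_add_one (le_trans ?_ hp')
    have h3 := (h p).t3 x hx
    change dd x ^ 2 * sv p x 2 ^ 2 ≤ _ at h3
    have h4 : dd x ^ 2 ≤ 1 := pow_le_one₀ hd hd1
    have : 0 ≤ dd x ^ 2 * sv p x 2 ^ 2 := by positivity
    nlinarith

/-- The weighted force density. -/
def gE (p : ℝ[X]) (x : ℝ) : ℝ := dd x * (p.eval x + fB x (yv p x) (sv p x) 0)

lemma gE_eq (p : ℝ[X]) (x : ℝ) : gE p x = dd x * (p.eval x +
    (dd x * (-2 * yv p x ^ 3 * sv p x 1) - x * (yv p x ^ 2 - 1))) := by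
  simp [gE, fB, gB]

lemma yv_mem {p : ℝ[X]} {x : ℝ} (h : |sv p x 0| ≤ 1 / 2) : yv p x ∈ Icc (0 : ℝ) 2 := by
  have h1 := (abs_le.1 h).1
  unfold yv
  refine ⟨inv_nonneg.2 (by linarith), ?_⟩
  rw [inv_le_comm₀ (by linarith) (by norm_num)]
  linarith

lemma abs_mul_le {a b A B : ℝ} (ha : |a| ≤ A) (hb : |b| ≤ B) : |a * b| ≤ A * B := by
  rw [abs_mul]
  exact mul_le_mul ha hb (abs_nonneg _) ((abs_nonneg _).trans ha)

lemma abs_add_le' {a b A B : ℝ} (ha : |a| ≤ A) (hb : |b| ≤ B) : |a + b| ≤ A + B :=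
  (abs_add_le a b).trans (add_le_add ha hb)

lemma abs_sub_le' {a b A B : ℝ} (ha : |a| ≤ A) (hb : |b| ≤ B) : |a - b| ≤ A + B :=
  (abs_sub a b).trans (add_le_add ha hb)

lemma abs_dd_le_one {x : ℝ} (hx : x ∈ Icc (-1 : ℝ) 1) : |dd x| ≤ 1 := by
  rw [abs_of_nonneg (dd_nonneg hx)]; exact dd_le.trans (by norm_num)

lemma lipschitz_of_hasDerivAt {f f' : ℝ → ℝ} {K : ℝ}
    (hf : ∀ x ∈ Icc (-1 : ℝ) 1, HasDerivAt f (f' x) x) (h : ∀ x ∈ Icc (-1 : ℝ) 1, |f' x| ≤ K) :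
    ∀ x ∈ Icc (-1 : ℝ) 1, ∀ y ∈ Icc (-1 : ℝ) 1, |f x - f y| ≤ K * |x - y| := fun _ hx _ hy =>
  (convex_Icc (-1 : ℝ) 1).norm_image_sub_le_of_norm_hasDerivWithin_le
    (fun z hz => (hf z hz).hasDerivWithinAt) h hy hx

lemma lipschitz_dd_mul {p : ℝ[X]} {R : ℝ} (h0 : ∀ x ∈ Icc (-1 : ℝ) 1, |p.eval x| ≤ R)
    (h1 : ∀ x ∈ Icc (-1 : ℝ) 1, |sv p x 0| ≤ R) :
    ∀ x ∈ Icc (-1 : ℝ) 1, ∀ y ∈ Icc (-1 : ℝ) 1,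
      |dd x * p.eval x - dd y * p.eval y| ≤ 2 * R * |x - y| := by
  refine lipschitz_of_hasDerivAt (f := fun x => dd x * p.eval x)
    (fun x hx => (hasDerivAt_dd x).fun_mul (p.hasDerivAt x)) fun x hx => ?_
  have hx2 : |(-x / 2)| ≤ 1 := by rw [abs_le]; constructor <;> linarith [hx.1, hx.2]
  have := abs_add_le' (abs_mul_le hx2 (h0 x hx)) (abs_mul_le (abs_dd_le_one hx) (h1 x hx))
  exact this.trans (by linarith)

lemma lipschitz_gE {p : ℝ[X]} {R : ℝ} (hR : 1 ≤ R)
    (hs : ∀ x ∈ Icc (-1 : ℝ) 1, |sv p x 0| ≤ 1 / 2)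
    (h0 : ∀ x ∈ Icc (-1 : ℝ) 1, |p.eval x| ≤ R)
    (h2 : ∀ x ∈ Icc (-1 : ℝ) 1, |dd x * sv p x 1| ≤ R)
    (h3 : ∀ x ∈ Icc (-1 : ℝ) 1, |dd x ^ 2 * sv p x 2| ≤ R) :
    ∀ x ∈ Icc (-1 : ℝ) 1, ∀ y ∈ Icc (-1 : ℝ) 1, |gE p x - gE p y| ≤ 300 * R ^ 2 * |x - y| := by
  refine lipschitz_of_hasDerivAt (f' := fun x => (-x / 2) * (p.eval x +
      (dd x * (-2 * yv p x ^ 3 * sv p x 1) - x * (yv p x ^ 2 - 1))) + dd x * (sv p x 0 +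
      (dd x * (-2 * yv p x ^ 3 * sv p x 2 + 6 * yv p x ^ 4 * sv p x 1 ^ 2) -
      (3 / 2 * x) * (-2 * yv p x ^ 3 * sv p x 1) - (yv p x ^ 2 - 1)))) (fun x hx => ?_)
      fun x hx => ?_
  · have hd := (hasDerivAt_dd x).fun_mul ((p.hasDerivAt x).fun_add
      (hasDerivAt_fB (hasDerivAt_sv p x) (hasDerivAt_yv (hs x hx)) 0 (by norm_num)))
    refine hd.congr_deriv ?_
    simp only [fB, gB, sv]
    norm_num
  · set y := yv p x with hy
    have hy' := yv_mem (hs x hx)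
    have hya : |y| ≤ 2 := by rw [abs_of_nonneg hy'.1]; exact hy'.2
    have hyp : ∀ n : ℕ, |y ^ n| ≤ 2 ^ n := fun n => by
      rw [abs_pow]; exact pow_le_pow_left₀ (abs_nonneg _) hya n
    have hx2 : |x| ≤ 1 := abs_le.2 hx
    have b1 : |y ^ 2 - 1| ≤ 3 := abs_le.2 ⟨by nlinarith [sq_nonneg y], by nlinarith [hy'.1, hy'.2]⟩
    have e1 : |2 * y ^ 3 * (dd x * sv p x 1)| ≤ 16 * R :=
      (abs_mul_le (abs_mul_le (a := 2) (A := 2) (by norm_num) (hyp 3)) (h2 x hx)).trans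
        (by linarith)
    have e2 : |2 * y ^ 3 * (dd x ^ 2 * sv p x 2)| ≤ 16 * R :=
      (abs_mul_le (abs_mul_le (a := 2) (A := 2) (by norm_num) (hyp 3)) (h3 x hx)).trans
        (by linarith)
    have e3 : |6 * y ^ 4 * ((dd x * sv p x 1) * (dd x * sv p x 1))| ≤ 96 * R ^ 2 :=
      (abs_mul_le (abs_mul_le (a := 6) (A := 6) (by norm_num) (hyp 4))
        (abs_mul_le (h2 x hx) (h2 x hx))).trans (by nlinarith)
    have e4 : |x * (y ^ 2 - 1)| ≤ 3 := (abs_mul_le hx2 b1).trans (by norm_num)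
    have e5 : |x * (2 * y ^ 3 * (dd x * sv p x 1))| ≤ 16 * R :=
      (abs_mul_le hx2 e1).trans (by linarith)
    have e6 : |dd x * sv p x 0| ≤ 1 :=
      (abs_mul_le (abs_dd_le_one hx) (hs x hx)).trans (by norm_num)
    have e7 : |dd x * (y ^ 2 - 1)| ≤ 3 := (abs_mul_le (abs_dd_le_one hx) b1).trans (by norm_num)
    have e8 : |x * p.eval x| ≤ R := (abs_mul_le hx2 (h0 x hx)).trans (by linarith)
    have e9 : |x * (x * (y ^ 2 - 1))| ≤ 3 := (abs_mul_le hx2 e4).trans (by norm_num)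
    have hR2 : R ≤ R ^ 2 := by nlinarith
    rw [show (-x / 2) * (p.eval x + (dd x * (-2 * y ^ 3 * sv p x 1) - x * (y ^ 2 - 1))) +
      dd x * (sv p x 0 + (dd x * (-2 * y ^ 3 * sv p x 2 + 6 * y ^ 4 * sv p x 1 ^ 2) -
      (3 / 2 * x) * (-2 * y ^ 3 * sv p x 1) - (y ^ 2 - 1))) =
      -(x * p.eval x) / 2 + (x * (2 * y ^ 3 * (dd x * sv p x 1))) / 2 +
      (x * (x * (y ^ 2 - 1))) / 2 + dd x * sv p x 0 - 2 * y ^ 3 * (dd x ^ 2 * sv p x 2) +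
      6 * y ^ 4 * ((dd x * sv p x 1) * (dd x * sv p x 1)) +
      3 / 2 * (x * (2 * y ^ 3 * (dd x * sv p x 1))) - dd x * (y ^ 2 - 1) by ring]
    rw [abs_le] at *
    constructor <;> linarith [e2.1, e2.2, e3.1, e3.2, e5.1, e5.2, e6.1, e6.2, e7.1, e7.2, e8.1,
      e8.2, e9.1, e9.2]

lemma abs_gE_le {p : ℝ[X]} {R x : ℝ} (hR : 1 ≤ R) (hx : x ∈ Icc (-1 : ℝ) 1)
    (hs : |sv p x 0| ≤ 1 / 2) (h0 : |p.eval x| ≤ R) (h2 : |dd x * sv p x 1| ≤ R) :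
    |gE p x| ≤ 20 * R := by
  rw [gE_eq]
  set y := yv p x with hy
  have hy' := yv_mem hs
  have hya : |y| ≤ 2 := by rw [abs_of_nonneg hy'.1]; exact hy'.2
  have hyp : ∀ n : ℕ, |y ^ n| ≤ 2 ^ n := fun n => by
    rw [abs_pow]; exact pow_le_pow_left₀ (abs_nonneg _) hya n
  have b1 : |y ^ 2 - 1| ≤ 3 := abs_le.2 ⟨by nlinarith [sq_nonneg y], by nlinarith [hy'.1, hy'.2]⟩
  have e1 : |2 * y ^ 3 * (dd x * sv p x 1)| ≤ 16 * R :=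
    (abs_mul_le (abs_mul_le (a := 2) (A := 2) (by norm_num) (hyp 3)) h2).trans (by linarith)
  have e4 : |x * (y ^ 2 - 1)| ≤ 1 * 3 := abs_mul_le (abs_le.2 hx) b1
  refine (abs_mul_le (A := 1) (B := 20 * R) (abs_dd_le_one hx) ?_).trans (by linarith)
  rw [show p.eval x + (dd x * (-2 * y ^ 3 * sv p x 1) - x * (y ^ 2 - 1)) =
    p.eval x - 2 * y ^ 3 * (dd x * sv p x 1) - x * (y ^ 2 - 1) by ring]
  refine (abs_sub_le' (abs_sub_le' h0 e1) e4).trans (by linarith)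

lemma lipschitz_gE_time {T : ℝ} {P V : ℝ → ℝ[X]} {R x : ℝ} (hx : x ∈ Icc (-1 : ℝ) 1)
    (hR : 1 ≤ R) (hP : PolyDeriv T P V)
    (hs : ∀ t ∈ Icc 0 T, |sv (P t) x 0| ≤ 1 / 2)
    (h2 : ∀ t ∈ Icc 0 T, |dd x * sv (P t) x 1| ≤ R)
    (v0 : ∀ t ∈ Icc 0 T, |(V t).eval x| ≤ R) (v1 : ∀ t ∈ Icc 0 T, |sv (V t) x 0| ≤ R)
    (v2 : ∀ t ∈ Icc 0 T, |dd x * sv (V t) x 1| ≤ R) :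
    ∀ t ∈ Icc 0 T, ∀ s ∈ Icc 0 T, |gE (P t) x - gE (P s) x| ≤ 300 * R ^ 2 * |t - s| := by
  intro t ht s hst
  refine (convex_Icc 0 T).norm_image_sub_le_of_norm_hasDerivWithin_le
    (f := fun t => gE (P t) x) (f' := fun t => dd x * ((V t).eval x +
      (dd x * (-2 * yv (P t) x ^ 3 * sv (V t) x 1 +
        6 * yv (P t) x ^ 4 * sv (V t) x 0 * sv (P t) x 1) +
      x * (2 * yv (P t) x ^ 3 * sv (V t) x 0)))) (fun z hz => ?_) (fun z hz => ?_) hst ht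
  · have d0 := hP.deriv 0 x z hz
    have d1 := hP.deriv 1 x z hz
    have d2 := hP.deriv 2 x z hz
    have h1 := (abs_le.1 (hs z hz)).1
    have hy : HasDerivWithinAt (fun t => yv (P t) x) (-(yv (P z) x) ^ 2 * sv (V z) x 0)
        (Icc 0 T) z := by
      refine ((d1.const_add 1).fun_inv (by change 1 + sv (P z) x 0 ≠ 0; linarith)).congr_deriv ?_
      rw [yv, inv_pow]
      simp only [sv, zero_add]
      ring
    simp only [gE_eq]
    refine HasDerivWithinAt.congr_deriv ((d0.fun_add (((((hy.fun_pow 3).const_mul (-2)).fun_mul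
      d2).const_mul (dd x)).fun_sub (((hy.fun_pow 2).sub_const 1).const_mul x))).const_mul (dd x)) ?_
    simp only [sv, Function.iterate_zero, id_eq]
    norm_num
    left
    ring
  · set y := yv (P z) x with hy
    have hy' := yv_mem (hs z hz)
    have hya : |y| ≤ 2 := by rw [abs_of_nonneg hy'.1]; exact hy'.2
    have hyp : ∀ n : ℕ, |y ^ n| ≤ 2 ^ n := fun n => by
      rw [abs_pow]; exact pow_le_pow_left₀ (abs_nonneg _) hya n
    have e1 : |2 * y ^ 3 * (dd x * sv (V z) x 1)| ≤ 16 * R :=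
      (abs_mul_le (abs_mul_le (a := 2) (A := 2) (by norm_num) (hyp 3)) (v2 z hz)).trans
        (by linarith)
    have e2 : |6 * y ^ 4 * (sv (V z) x 0 * (dd x * sv (P z) x 1))| ≤ 96 * R ^ 2 :=
      (abs_mul_le (abs_mul_le (a := 6) (A := 6) (by norm_num) (hyp 4))
        (abs_mul_le (v1 z hz) (h2 z hz))).trans (by nlinarith)
    have e3 : |2 * y ^ 3 * sv (V z) x 0| ≤ 16 * R :=
      (abs_mul_le (abs_mul_le (a := 2) (A := 2) (by norm_num) (hyp 3)) (v1 z hz)).trans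
        (by linarith)
    have e4 : |x * (2 * y ^ 3 * sv (V z) x 0)| ≤ 1 * (16 * R) := abs_mul_le (abs_le.2 hx) e3
    have hR2 : R ≤ R ^ 2 := by nlinarith
    rw [Real.norm_eq_abs]
    refine (abs_mul_le (A := 1) (B := 300 * R ^ 2) (abs_dd_le_one hx) ?_).trans (by linarith)
    rw [show (V z).eval x + (dd x * (-2 * y ^ 3 * sv (V z) x 1 +
      6 * y ^ 4 * sv (V z) x 0 * sv (P z) x 1) + x * (2 * y ^ 3 * sv (V z) x 0)) =
      (V z).eval x - 2 * y ^ 3 * (dd x * sv (V z) x 1) +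
      6 * y ^ 4 * (sv (V z) x 0 * (dd x * sv (P z) x 1)) +
      x * (2 * y ^ 3 * sv (V z) x 0) by ring]
    refine (abs_add_le' (abs_add_le' (abs_sub_le' (v0 z hz) e1) e2) e4).trans (by linarith)

/-- Interior derivatives with continuous extension are one-sided derivatives at the ends. -/
lemma hasDerivWithinAt_Icc {f f' : ℝ → ℝ} {a b : ℝ} (hab : a < b) (hf : ContinuousOn f (Icc a b))
    (hf' : ContinuousOn f' (Icc a b)) (h : ∀ t ∈ Ioo a b, HasDerivAt f (f' t) t) :
    ∀ t ∈ Icc a b, HasDerivWithinAt f (f' t) (Icc a b) t := by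
  have dif : DifferentiableOn ℝ f (Ioo a b) := fun t ht =>
    (h t ht).differentiableAt.differentiableWithinAt
  intro t ht
  rcases ht.1.eq_or_lt with rfl | h1
  · have m : Ioo a b ∈ 𝓝[>] a := Ioo_mem_nhdsGT hab
    refine (hasDerivWithinAt_Ici_of_tendsto_deriv dif
      ((hf a ht).mono Ioo_subset_Icc_self) m ?_).mono Icc_subset_Ici_self
    have : Tendsto f' (𝓝[>] a) (𝓝 (f' a)) :=
      (hf' a ht).tendsto.mono_left (by
        rw [← nhdsWithin_Ioo_eq_nhdsGT hab]; exact nhdsWithin_mono _ Ioo_subset_Icc_self)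
    refine this.congr' ?_
    filter_upwards [m] with z hz using (h z hz).deriv.symm
  rcases ht.2.eq_or_lt with rfl | h2
  · have m : Ioo a t ∈ 𝓝[<] t := Ioo_mem_nhdsLT hab
    refine (hasDerivWithinAt_Iic_of_tendsto_deriv dif
      ((hf t ht).mono Ioo_subset_Icc_self) m ?_).mono Icc_subset_Iic_self
    have : Tendsto f' (𝓝[<] t) (𝓝 (f' t)) :=
      (hf' t ht).tendsto.mono_left (by
        rw [← nhdsWithin_Ioo_eq_nhdsLT hab]; exact nhdsWithin_mono _ Ioo_subset_Icc_self)
    refine this.congr' ?_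
    filter_upwards [m] with z hz using (h z hz).deriv.symm
  · exact (h t ⟨h1, h2⟩).hasDerivWithinAt

lemma PolyDeriv.hasDerivWithinAt_integral {T : ℝ} {P V : ℝ → ℝ[X]} (hT : 0 < T)
    (h : PolyDeriv T P V) (q : ℝ[X]) : ∀ t ∈ Icc 0 T,
    HasDerivWithinAt (fun t => ∫ x in (-1 : ℝ)..1, dd x * (P t).eval x * q.eval x)
      (∫ x in (-1 : ℝ)..1, dd x * (V t).eval x * q.eval x) (Icc 0 T) t := by
  have c : ∀ {Q : ℝ → ℝ[X]}, ContinuousOn (fun z : ℝ × ℝ => (derivative^[0] (Q z.1)).eval z.2)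
      (Icc 0 T ×ˢ Icc (-1) 1) → ContinuousOn (fun z : ℝ × ℝ => dd z.2 * (Q z.1).eval z.2 *
        q.eval z.2) (Icc 0 T ×ˢ Icc (-1) 1) := fun hQ =>
    (((continuous_dd.comp continuous_snd).continuousOn).mul hQ).mul
      (q.continuous.comp continuous_snd).continuousOn
  have c1 := c (h.cont 0)
  have c2 := c (h.cont' 0)
  refine hasDerivWithinAt_Icc hT
    (continuousOn_integral_param (F := fun t x => dd x * (P t).eval x * q.eval x) c1)
    (continuousOn_integral_param (F := fun t x => dd x * (V t).eval x * q.eval x) c2)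
    fun t ht => hasDerivAt_integral_param (F := fun t x => dd x * (P t).eval x * q.eval x) ht c1 c2
      fun s hs x _ => ((h.hasDerivAt 0 x hs).const_mul (dd x)).mul_const (q.eval x)

lemma PolyDeriv.mono {T T' : ℝ} {P V : ℝ → ℝ[X]} (h : PolyDeriv T' P V) (hT : T ≤ T') :
    PolyDeriv T P V where
  cont k := (h.cont k).mono (prod_mono_left (Icc_subset_Icc_right hT))
  cont' k := (h.cont' k).mono (prod_mono_left (Icc_subset_Icc_right hT))
  deriv k x t ht := (h.deriv k x t (Icc_subset_Icc_right hT ht)).mono (Icc_subset_Icc_right hT)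

lemma Galerkin.mono {α α' : ℝ → ℝ} {N : ℕ} {T T' B : ℝ} {P V Z : ℝ → ℝ[X]}
    (h : Galerkin α α' N T' B P V Z) (hT : T ≤ T') : Galerkin α α' N T B P V Z where
  deriv₁ := h.deriv₁.mono hT
  deriv₂ := h.deriv₂.mono hT
  init := h.init
  natDegree_le t ht := h.natDegree_le t (Icc_subset_Icc_right hT ht)
  weak t ht := h.weak t (Icc_subset_Icc_right hT ht)
  bound t ht := h.bound t (Icc_subset_Icc_right hT ht)

lemma exists_lipschitz {f f' : ℝ → ℝ} (T : ℝ)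
    (hf : ∀ t ∈ Ici (0 : ℝ), HasDerivWithinAt f (f' t) (Ici 0) t) (hc : ContinuousOn f' (Ici 0)) :
    ∃ A ≥ (0 : ℝ), ∀ t ∈ Icc 0 T, |f t| ≤ A ∧ ∀ s ∈ Icc 0 T, |f t - f s| ≤ A * |t - s| := by
  have cf : ContinuousOn f (Icc 0 T) := fun t ht =>
    (hf t ht.1).continuousWithinAt.mono Icc_subset_Ici_self
  obtain ⟨a, ha⟩ := isCompact_Icc.exists_bound_of_continuousOn cf
  obtain ⟨b, hb⟩ := isCompact_Icc.exists_bound_of_continuousOn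
    (hc.mono (fun x (hx : x ∈ Icc 0 T) => hx.1))
  refine ⟨max 0 (max a b), le_max_left _ _, fun t ht => ⟨(ha t ht).trans
    ((le_max_left _ _).trans (le_max_right _ _)), fun s hs => ?_⟩⟩
  refine (convex_Icc 0 T).norm_image_sub_le_of_norm_hasDerivWithin_le
    (fun z hz => (hf z hz.1).mono Icc_subset_Ici_self) (fun z hz => (hb z hz).trans
      ((le_max_right _ _).trans (le_max_right _ _))) hs ht

lemma exists_coeff_bound {α α' : ℝ → ℝ} {c : ℝ} (hα : Scale α α' c)
    (hα' : ∀ t ∈ Ici (0 : ℝ), HasDerivWithinAt α' ((α t ^ 2)⁻¹) (Ici 0) t) (T : ℝ) :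
    ∃ A ≥ (1 : ℝ), ∀ t ∈ Icc 0 T, |2 * α' t / α t| ≤ A ∧ |(α t ^ 3)⁻¹| ≤ A ∧
      ∀ s ∈ Icc 0 T, |2 * α' t / α t - 2 * α' s / α s| ≤ A * |t - s| ∧
        |(α t ^ 3)⁻¹ - (α s ^ 3)⁻¹| ≤ A * |t - s| := by
  have h0 : ∀ t ∈ Ici (0 : ℝ), α t ≠ 0 := fun t ht => by linarith [hα.one_le t ht]
  obtain ⟨a, ha, h1⟩ := exists_lipschitz T (f := fun t => 2 * α' t / α t)
    (fun t ht => ((hα' t ht).const_mul 2).fun_div (hα.deriv t ht) (h0 t ht))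
    ((((continuousOn_const.mul ((hα.cont.pow 2).inv₀ fun t ht => pow_ne_zero 2 (h0 t ht))).mul
      hα.cont).sub ((continuousOn_const.mul hα.cont').mul hα.cont')).div (hα.cont.pow 2)
      fun t ht => pow_ne_zero 2 (h0 t ht))
  obtain ⟨b, hb, h2⟩ := exists_lipschitz T (f := fun t => (α t ^ 3)⁻¹)
    (fun t ht => ((hα.deriv t ht).fun_pow 3).fun_inv (pow_ne_zero 3 (h0 t ht)))
    ((((continuousOn_const.mul (hα.cont.pow _)).mul hα.cont').neg).div ((hα.cont.pow 3).pow 2)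
      fun t ht => pow_ne_zero 2 (pow_ne_zero 3 (h0 t ht)))
  refine ⟨1 + a + b, by linarith, fun t ht => ⟨((h1 t ht).1).trans (by linarith),
    ((h2 t ht).1).trans (by linarith), fun s hs => ⟨((h1 t ht).2 s hs).trans ?_,
    ((h2 t ht).2 s hs).trans ?_⟩⟩⟩
  all_goals exact mul_le_mul_of_nonneg_right (by linarith) (abs_nonneg _)

lemma abs_integral_mul_le {f : ℝ → ℝ} {M : ℝ} (hf : ContinuousOn f (Icc (-1) 1))
    (h : ∀ x ∈ Icc (-1 : ℝ) 1, |f x| ≤ M) (q : ℝ[X]) :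
    |∫ x in (-1 : ℝ)..1, f x * q.eval x| ≤ M * ∫ x in (-1 : ℝ)..1, |q.eval x| := by
  refine (intervalIntegral.abs_integral_le_integral_abs neg_one_le_one').trans ?_
  rw [← intervalIntegral.integral_const_mul]
  refine intervalIntegral.integral_mono_on neg_one_le_one' (integrable_mul_poly hf q).abs
    (Continuous.intervalIntegrable (by fun_prop) _ _) fun x hx => ?_
  rw [abs_mul]
  exact mul_le_mul_of_nonneg_right (h x hx) (abs_nonneg _)

lemma continuousOn_gE {p : ℝ[X]} (hs : ∀ x ∈ Icc (-1 : ℝ) 1, |sv p x 0| ≤ 1 / 2) :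
    ContinuousOn (gE p) (Icc (-1) 1) :=
  continuous_dd.continuousOn.mul (p.continuous.continuousOn.add (continuousOn_fB hs 0 (by norm_num)))

/-- The density of the weak acceleration. -/
def accDens (α α' : ℝ → ℝ) (P V : ℝ → ℝ[X]) (t x : ℝ) : ℝ :=
  -(2 * α' t / α t) * (dd x * (V t).eval x) - (α t ^ 3)⁻¹ * gE (P t) x

lemma integral_accDens {α α' : ℝ → ℝ} {P V : ℝ → ℝ[X]} {t : ℝ}
    (hs : ∀ x ∈ Icc (-1 : ℝ) 1, |sv (P t) x 0| ≤ 1 / 2) (q : ℝ[X]) :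
    ∫ x in (-1 : ℝ)..1, accDens α α' P V t x * q.eval x =
      -(2 * α' t / α t) * (∫ x in (-1 : ℝ)..1, dd x * (V t).eval x * q.eval x) -
        (α t ^ 3)⁻¹ * ∫ x in (-1 : ℝ)..1, gE (P t) x * q.eval x := by
  rw [← intervalIntegral.integral_const_mul, ← intervalIntegral.integral_const_mul,
    ← intervalIntegral.integral_sub (Continuous.intervalIntegrable (by fun_prop) _ _)
      ((integrable_mul_poly (continuousOn_gE hs) q).const_mul _)]
  refine intervalIntegral.integral_congr fun x _ => ?_
  simp only [accDens]
  ring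

lemma integral_accel {a a' : ℝ} {p v z q : ℝ[X]} (ha : a ≠ 0)
    (hs : ∀ x ∈ Icc (-1 : ℝ) 1, |sv p x 0| ≤ 1 / 2)
    (hw : ∫ x in (-1 : ℝ)..1, dd x * (C (a ^ 3) * z + C (2 * a ^ 2 * a') * v + p).eval x * q.eval x =
      ∫ x in (-1 : ℝ)..1, dd x ^ 2 * (yv p x ^ 2 - 1) * (derivative q).eval x) :
    ∫ x in (-1 : ℝ)..1, dd x * z.eval x * q.eval x =
      -(2 * a' / a) * (∫ x in (-1 : ℝ)..1, dd x * v.eval x * q.eval x) -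
        (a ^ 3)⁻¹ * ∫ x in (-1 : ℝ)..1, gE p x * q.eval x := by
  rw [integral_force hs] at hw
  have h1 : ∫ x in (-1 : ℝ)..1, dd x * (C (a ^ 3) * z + C (2 * a ^ 2 * a') * v + p).eval x * q.eval x =
      a ^ 3 * (∫ x in (-1 : ℝ)..1, dd x * z.eval x * q.eval x) +
      2 * a ^ 2 * a' * (∫ x in (-1 : ℝ)..1, dd x * v.eval x * q.eval x) +
      ∫ x in (-1 : ℝ)..1, dd x * p.eval x * q.eval x := by
    rw [← intervalIntegral.integral_const_mul, ← intervalIntegral.integral_const_mul,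
      ← intervalIntegral.integral_add (Continuous.intervalIntegrable (by fun_prop) _ _)
      (Continuous.intervalIntegrable (by fun_prop) _ _),
      ← intervalIntegral.integral_add (Continuous.intervalIntegrable (by fun_prop) _ _)
      (Continuous.intervalIntegrable (by fun_prop) _ _)]
    refine intervalIntegral.integral_congr fun x _ => ?_
    simp only [eval_add, eval_mul, eval_C]
    ring
  have h2 : ∫ x in (-1 : ℝ)..1, gE p x * q.eval x =
      (∫ x in (-1 : ℝ)..1, dd x * p.eval x * q.eval x) +
      ∫ x in (-1 : ℝ)..1, dd x * fB x (yv p x) (sv p x) 0 * q.eval x := by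
    have i1 : IntervalIntegrable (fun x => dd x * p.eval x * q.eval x) volume (-1) 1 :=
      Continuous.intervalIntegrable (by fun_prop) _ _
    have i2 : IntervalIntegrable (fun x => dd x * fB x (yv p x) (sv p x) 0 * q.eval x)
        volume (-1) 1 := integrable_mul_poly (f := fun x => dd x * fB x (yv p x) (sv p x) 0)
      (continuous_dd.continuousOn.mul (continuousOn_fB hs 0 (by norm_num))) q
    rw [← intervalIntegral.integral_add i1 i2]
    refine intervalIntegral.integral_congr fun x _ => ?_
    simp only [gE]
    ring
  rw [h1] at hw
  rw [h2]
  field_simp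
  linarith

/-- Uniform bounds for Galerkin approximations. -/
structure CurveBd (T R : ℝ) (P V : ℝ → ℝ[X]) : Prop where
  s : ∀ t ∈ Icc 0 T, ∀ x ∈ Icc (-1 : ℝ) 1, |sv (P t) x 0| ≤ 1 / 2
  p0 : ∀ t ∈ Icc 0 T, ∀ x ∈ Icc (-1 : ℝ) 1, |(P t).eval x| ≤ R
  p2 : ∀ t ∈ Icc 0 T, ∀ x ∈ Icc (-1 : ℝ) 1, |dd x * sv (P t) x 1| ≤ R
  p3 : ∀ t ∈ Icc 0 T, ∀ x ∈ Icc (-1 : ℝ) 1, |dd x ^ 2 * sv (P t) x 2| ≤ R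
  v0 : ∀ t ∈ Icc 0 T, ∀ x ∈ Icc (-1 : ℝ) 1, |(V t).eval x| ≤ R
  v1 : ∀ t ∈ Icc 0 T, ∀ x ∈ Icc (-1 : ℝ) 1, |sv (V t) x 0| ≤ R
  v2 : ∀ t ∈ Icc 0 T, ∀ x ∈ Icc (-1 : ℝ) 1, |dd x * sv (V t) x 1| ≤ R

lemma Galerkin.weak_lipschitz {α α' : ℝ → ℝ} {c : ℝ} (hα : Scale α α' c) {N : ℕ} {T B R A : ℝ}
    {P V Z : ℝ → ℝ[X]} (hT : 0 < T) (hR : 1 ≤ R) (hA1 : 1 ≤ A)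
    (hA : ∀ t ∈ Icc 0 T, |2 * α' t / α t| ≤ A ∧ |(α t ^ 3)⁻¹| ≤ A ∧
      ∀ s ∈ Icc 0 T, |2 * α' t / α t - 2 * α' s / α s| ≤ A * |t - s| ∧
        |(α t ^ 3)⁻¹ - (α s ^ 3)⁻¹| ≤ A * |t - s|)
    (hG : Galerkin α α' N T B P V Z) (hb : CurveBd T R P V) (q : ℝ[X]) (hq : q.natDegree ≤ N) :
    (∀ t ∈ Icc 0 T, HasDerivWithinAt (fun t => ∫ x in (-1 : ℝ)..1, dd x * (V t).eval x * q.eval x)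
      (∫ x in (-1 : ℝ)..1, accDens α α' P V t x * q.eval x) (Icc 0 T) t) ∧
    (∀ t ∈ Icc 0 T, ∀ s ∈ Icc 0 T, |(∫ x in (-1 : ℝ)..1, dd x * (V t).eval x * q.eval x) -
      ∫ x in (-1 : ℝ)..1, dd x * (V s).eval x * q.eval x| ≤
        400 * A ^ 2 * R ^ 2 * |t - s| * ∫ x in (-1 : ℝ)..1, |q.eval x|) ∧
    ∀ t ∈ Icc 0 T, ∀ s ∈ Icc 0 T, |(∫ x in (-1 : ℝ)..1, accDens α α' P V t x * q.eval x) -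
      ∫ x in (-1 : ℝ)..1, accDens α α' P V s x * q.eval x| ≤
        400 * A ^ 2 * R ^ 2 * |t - s| * ∫ x in (-1 : ℝ)..1, |q.eval x| := by
  set Q := ∫ x in (-1 : ℝ)..1, |q.eval x| with hQ
  have hQ0 : 0 ≤ Q := intervalIntegral.integral_nonneg (by norm_num) fun _ _ => abs_nonneg _
  have h1 : ∀ t ∈ Icc 0 T, HasDerivWithinAt
      (fun t => ∫ x in (-1 : ℝ)..1, dd x * (V t).eval x * q.eval x)
      (∫ x in (-1 : ℝ)..1, accDens α α' P V t x * q.eval x) (Icc 0 T) t := by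
    intro t ht
    refine (hG.deriv₂.hasDerivWithinAt_integral hT q t ht).congr_deriv ?_
    rw [integral_accDens (hb.s t ht)]
    exact integral_accel (by linarith [hα.one_le t ht.1]) (hb.s t ht) (hG.weak t ht q hq)
  have bv : ∀ t ∈ Icc 0 T, |∫ x in (-1 : ℝ)..1, dd x * (V t).eval x * q.eval x| ≤ R * Q :=
    fun t ht => abs_integral_mul_le (f := fun x => dd x * (V t).eval x) (by fun_prop)
      (fun x hx => (abs_mul_le (abs_dd_le_one hx) (hb.v0 t ht x hx)).trans (one_mul R).le) q
  have bg : ∀ t ∈ Icc 0 T, |∫ x in (-1 : ℝ)..1, gE (P t) x * q.eval x| ≤ 20 * R * Q :=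
    fun t ht => abs_integral_mul_le (continuousOn_gE (hb.s t ht))
      (fun x hx => abs_gE_le hR hx (hb.s t ht x hx) (hb.p0 t ht x hx) (hb.p2 t ht x hx)) q
  have lg : ∀ t ∈ Icc 0 T, ∀ s ∈ Icc 0 T, |(∫ x in (-1 : ℝ)..1, gE (P t) x * q.eval x) -
      ∫ x in (-1 : ℝ)..1, gE (P s) x * q.eval x| ≤ 300 * R ^ 2 * |t - s| * Q := by
    intro t ht s hs
    have ct := continuousOn_gE (hb.s t ht)
    have cs := continuousOn_gE (hb.s s hs)
    rw [← intervalIntegral.integral_sub (integrable_mul_poly ct q) (integrable_mul_poly cs q)]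
    simp only [← sub_mul]
    exact abs_integral_mul_le (ct.sub cs) (fun x hx => lipschitz_gE_time hx hR hG.deriv₁
      (fun t ht => hb.s t ht x hx) (fun t ht => hb.p2 t ht x hx) (fun t ht => hb.v0 t ht x hx)
      (fun t ht => hb.v1 t ht x hx) (fun t ht => hb.v2 t ht x hx) t ht s hs) q
  have hAA : A ≤ A ^ 2 := by nlinarith
  have hRR : R ≤ R ^ 2 := by nlinarith
  have ba : ∀ t ∈ Icc 0 T, |∫ x in (-1 : ℝ)..1, accDens α α' P V t x * q.eval x| ≤
      21 * A * R * Q := by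
    intro t ht
    rw [integral_accDens (hb.s t ht)]
    have h3 : |-(2 * α' t / α t)| ≤ A := (abs_neg _).trans_le (hA t ht).1
    exact (abs_sub_le' (abs_mul_le h3 (bv t ht))
      (abs_mul_le (hA t ht).2.1 (bg t ht))).trans (le_of_eq (by ring))
  have lv : ∀ t ∈ Icc 0 T, ∀ s ∈ Icc 0 T, |(∫ x in (-1 : ℝ)..1, dd x * (V t).eval x * q.eval x) -
      ∫ x in (-1 : ℝ)..1, dd x * (V s).eval x * q.eval x| ≤ 21 * A * R * Q * |t - s| :=
    fun t ht s hs => (convex_Icc 0 T).norm_image_sub_le_of_norm_hasDerivWithin_le h1 ba hs ht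
  refine ⟨h1, fun t ht s hs => (lv t ht s hs).trans ?_, fun t ht s hs => ?_⟩
  · have : 21 * A * R ≤ 400 * A ^ 2 * R ^ 2 := by
      have : A * R ≤ A ^ 2 * R ^ 2 := by gcongr
      nlinarith
    calc 21 * A * R * Q * |t - s| ≤ 400 * A ^ 2 * R ^ 2 * Q * |t - s| := by gcongr
      _ = _ := by ring
  · rw [integral_accDens (hb.s t ht), integral_accDens (hb.s s hs)]
    have e1 := abs_mul_le ((hA t ht).2.2 s hs).1 (bv t ht)
    have e2 := abs_mul_le (hA s hs).1 (lv t ht s hs)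
    have e3 := abs_mul_le ((hA t ht).2.2 s hs).2 (bg t ht)
    have e4 := abs_mul_le (hA s hs).2.1 (lg t ht s hs)
    set v := ∫ x in (-1 : ℝ)..1, dd x * (V t).eval x * q.eval x
    set w := ∫ x in (-1 : ℝ)..1, dd x * (V s).eval x * q.eval x
    set g := ∫ x in (-1 : ℝ)..1, gE (P t) x * q.eval x
    set h := ∫ x in (-1 : ℝ)..1, gE (P s) x * q.eval x
    rw [show -(2 * α' t / α t) * v - (α t ^ 3)⁻¹ * g - (-(2 * α' s / α s) * w - (α s ^ 3)⁻¹ * h) =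
      -((2 * α' t / α t - 2 * α' s / α s) * v) - 2 * α' s / α s * (v - w) -
      ((α t ^ 3)⁻¹ - (α s ^ 3)⁻¹) * g - (α s ^ 3)⁻¹ * (g - h) by ring]
    rw [← abs_neg] at e1
    refine (abs_sub_le' (abs_sub_le' (abs_sub_le' e1 e2) e3) e4).trans ?_
    have hm : A * R + A * (21 * A * R) + A * (20 * R) + A * (300 * R ^ 2) ≤
        400 * A ^ 2 * R ^ 2 := by
      have r0 : 0 ≤ R := by linarith
      have k1 : A * R ≤ A ^ 2 * R ^ 2 := by gcongr
      have k2 : A ^ 2 * R ≤ A ^ 2 * R ^ 2 := by gcongr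
      have k3 : A * R ^ 2 ≤ A ^ 2 * R ^ 2 := by gcongr
      nlinarith
    calc A * |t - s| * (R * Q) + A * (21 * A * R * Q * |t - s|) + A * |t - s| * (20 * R * Q) +
        A * (300 * R ^ 2 * |t - s| * Q)
        = (A * R + A * (21 * A * R) + A * (20 * R) + A * (300 * R ^ 2)) * |t - s| * Q := by ring
      _ ≤ 400 * A ^ 2 * R ^ 2 * |t - s| * Q := by gcongr

lemma lipschitz_accDens {α α' : ℝ → ℝ} {T R A : ℝ} {P V : ℝ → ℝ[X]} (hR : 1 ≤ R) (hA1 : 1 ≤ A)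
    (hb : CurveBd T R P V) {t : ℝ} (ht : t ∈ Icc 0 T) (h1 : |2 * α' t / α t| ≤ A)
    (h2 : |(α t ^ 3)⁻¹| ≤ A) : ∀ x ∈ Icc (-1 : ℝ) 1, ∀ y ∈ Icc (-1 : ℝ) 1,
    |accDens α α' P V t x - accDens α α' P V t y| ≤ 400 * A ^ 2 * R ^ 2 * |x - y| := by
  intro x hx y hy
  have e1 := abs_mul_le h1 (lipschitz_dd_mul (hb.v0 t ht) (hb.v1 t ht) x hx y hy)
  have e2 := abs_mul_le h2 (lipschitz_gE hR (hb.s t ht) (hb.p0 t ht) (hb.p2 t ht) (hb.p3 t ht)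
    x hx y hy)
  unfold accDens
  rw [show ∀ a b c d e f : ℝ, -a * b - c * d - (-a * e - c * f) = -(a * (b - e)) - c * (d - f) by
    intros; ring]
  rw [← abs_neg] at e1
  refine (abs_sub_le' e1 e2).trans ?_
  have hAA : A ≤ A ^ 2 := by nlinarith
  have hRR : R ≤ R ^ 2 := by nlinarith
  have k1 : A * R ≤ A ^ 2 * R ^ 2 := by gcongr
  have k3 : A * R ^ 2 ≤ A ^ 2 * R ^ 2 := by gcongr
  calc A * (2 * R * |x - y|) + A * (300 * R ^ 2 * |x - y|)
      = (2 * (A * R) + 300 * (A * R ^ 2)) * |x - y| := by ring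
    _ ≤ _ := by gcongr; nlinarith [mul_nonneg (sq_nonneg A) (sq_nonneg R)]

lemma tendsto_ul_of_eventually {a : ℕ → ℝ} {R : ℝ} (h : ∀ᶠ N in U, |a N| ≤ R) :
    Tendsto a U (𝓝 (ul a)) := by
  obtain ⟨N₀, hN₀⟩ := h.exists
  have h1 : ∀ N, |if |a N| ≤ R then a N else 0| ≤ R := fun N => by
    split_ifs with hc
    · exact hc
    · simpa using (abs_nonneg _).trans hN₀
  have h2 := (tendsto_ul h1).congr' (f₂ := a) (h.mono fun N hN => if_pos hN)
  exact tendsto_nhds_limUnder ⟨_, h2⟩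

lemma limit_bounds_of_eventually {h : ℕ → ℝ[X]} {f : ℝ → ℝ} {m : ℕ} (hm : 1 ≤ m) {l : ℕ → ℕ}
    {M : ℕ → ℝ} (hJ : ∀ᶠ N in U, ∀ k ≤ m, J (l k) (derivative^[k] (h N)) ≤ M k)
    (hf : ∀ x ∈ Ω₀, Tendsto (fun N => (h N).eval x) U (𝓝 (f x))) :
    (∀ k < m, ∀ x ∈ Ω₀, Tendsto (fun N => (derivative^[k] (h N)).eval x) U
      (𝓝 (iteratedDeriv k f x))) ∧
    (∀ k, k + 1 < m → ∀ x ∈ Ω₀, DifferentiableAt ℝ (iteratedDeriv k f) x) ∧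
    ∀ k ≤ m, ∫ x in Ω₀, dd x ^ l k * iteratedDeriv k f x ^ 2 ≤ M k := by
  classical
  set g : ℕ → ℝ[X] := fun N =>
    if ∀ k ≤ m, J (l k) (derivative^[k] (h N)) ≤ M k then h N else 0 with hg
  have hgh : ∀ᶠ N in U, g N = h N := hJ.mono fun N hN => if_pos hN
  obtain ⟨N₀, hN₀⟩ := hJ.exists
  have hgJ : ∀ k ≤ m, ∀ N, J (l k) (derivative^[k] (g N)) ≤ M k := by
    intro k hk N
    simp only [hg]
    split_ifs with hc
    · exact hc k hk
    · rw [iterate_derivative_zero, J_zero]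
      exact (J_nonneg _ _).trans (hN₀ k hk)
  obtain ⟨h1, h2, h3⟩ := limit_bounds hm hgJ
    (fun x hx => (hf x hx).congr' (hgh.mono fun N hN => by simp only [hN]))
  exact ⟨fun k hk x hx => (h1 k hk x hx).congr' (hgh.mono fun N hN => by simp only [hN]), h2, h3⟩

/-- The pointwise limit of a sequence of polynomial curves. -/
def lim (P : ℕ → ℝ → ℝ[X]) (t x : ℝ) : ℝ := ul fun N => (P N t).eval x

/-- A sequence of Galerkin approximations on exhausting time intervals. -/
def Approx (α α' : ℝ → ℝ) (B : ℝ) (P V : ℕ → ℝ → ℝ[X]) : Prop :=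
  ∀ T, ∀ᶠ N in U, (∃ Z, Galerkin α α' N T B (P N) (V N) Z) ∧
    ∀ t ∈ Icc 0 T, ∀ x ∈ Icc (-1 : ℝ) 1, |sv (P N t) x 0| ≤ 1 / 2

lemma le_of_Bq_le {a B : ℝ} {p v : ℝ[X]} (ha : 1 ≤ a) (h : Bq a p v ≤ B) :
    N6 p ≤ B ∧ N5 p ≤ B ∧ N5 v ≤ B ∧ a ^ 3 * N5 v ≤ B := by
  have h1 := N6_nonneg p
  have h2 := N5_nonneg v
  have h3 := N5_le_N6 p
  have h4 : 1 * N5 v ≤ a ^ 3 * N5 v := mul_le_mul_of_nonneg_right (one_le_pow₀ ha) h2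
  unfold Bq at h
  refine ⟨?_, ?_, ?_, ?_⟩ <;> linarith

section
variable {α α' : ℝ → ℝ} {c B : ℝ} {P V : ℕ → ℝ → ℝ[X]}

lemma Approx.norms (h : Approx α α' B P V) (hα : Scale α α' c) {t : ℝ} (ht : 0 ≤ t) :
    ∀ᶠ N in U, N6 (P N t) ≤ B ∧ N5 (P N t) ≤ B ∧ N5 (V N t) ≤ B ∧ α t ^ 3 * N5 (V N t) ≤ B := by
  filter_upwards [h t] with N ⟨⟨Z, hZ⟩, _⟩
  exact le_of_Bq_le (hα.one_le t ht) (hZ.bound t ⟨ht, le_rfl⟩)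

lemma Approx.nonneg (h : Approx α α' B P V) (hα : Scale α α' c) : 0 ≤ B := by
  obtain ⟨N, hN⟩ := (h.norms hα le_rfl).exists
  exact (N6_nonneg _).trans hN.1

lemma Approx.curveBd (h : Approx α α' B P V) (hα : Scale α α' c) :
    ∃ R ≥ (1 : ℝ), ∀ T, ∀ᶠ N in U, CurveBd T R (P N) (V N) := by
  obtain ⟨R, hR, h1, h2⟩ := exists_pointwise_bound B (h.nonneg hα)
  refine ⟨R, hR, fun T => ?_⟩
  filter_upwards [h T] with N ⟨⟨Z, hZ⟩, hs⟩
  have hb := fun t ht => le_of_Bq_le (hα.one_le t (mem_Icc.1 ht).1) (hZ.bound t ht)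
  exact
    { s := hs
      p0 := fun t ht x hx => (h1 _ (hb t ht).2.1 x hx).1
      p2 := fun t ht x hx => (h1 _ (hb t ht).2.1 x hx).2.2
      p3 := fun t ht x hx => h2 _ (hb t ht).1 x hx
      v0 := fun t ht x hx => (h1 _ (hb t ht).2.2.1 x hx).1
      v1 := fun t ht x hx => (h1 _ (hb t ht).2.2.1 x hx).2.1
      v2 := fun t ht x hx => (h1 _ (hb t ht).2.2.1 x hx).2.2 }

lemma Approx.tendsto (h : Approx α α' B P V) (hα : Scale α α' c) {t x : ℝ} (ht : 0 ≤ t)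
    (hx : x ∈ Icc (-1 : ℝ) 1) :
    Tendsto (fun N => (P N t).eval x) U (𝓝 (lim P t x)) ∧
    Tendsto (fun N => (V N t).eval x) U (𝓝 (lim V t x)) ∧
    Tendsto (fun N => gE (P N t) x) U (𝓝 (ul fun N => gE (P N t) x)) := by
  obtain ⟨R, hR, hb⟩ := h.curveBd hα
  have htt : t ∈ Icc 0 t := ⟨ht, le_rfl⟩
  exact ⟨tendsto_ul_of_eventually ((hb t).mono fun N hN => hN.p0 t htt x hx),
    tendsto_ul_of_eventually ((hb t).mono fun N hN => hN.v0 t htt x hx),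
    tendsto_ul_of_eventually ((hb t).mono fun N hN =>
      abs_gE_le hR hx (hN.s t htt x hx) (hN.p0 t htt x hx) (hN.p2 t htt x hx))⟩

lemma Approx.hasDerivWithinAt_dd (h : Approx α α' B P V) (hα : Scale α α' c)
    (hα' : ∀ t ∈ Ici (0 : ℝ), HasDerivWithinAt α' ((α t ^ 2)⁻¹) (Ici 0) t)
    {t x : ℝ} (ht : 0 ≤ t) (hx : x ∈ Icc (-1 : ℝ) 1) :
    HasDerivWithinAt (fun t => dd x * lim P t x) (dd x * lim V t x) (Icc 0 (t + 1)) t ∧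
    HasDerivWithinAt (fun t => dd x * lim V t x) (-(2 * α' t / α t) * (dd x * lim V t x) -
      (α t ^ 3)⁻¹ * ul fun N => gE (P N t) x) (Icc 0 (t + 1)) t := by
  obtain ⟨R, hR, hb⟩ := h.curveBd hα
  have hT : 0 < t + 1 := by linarith
  obtain ⟨A, hA1, hA⟩ := exists_coeff_bound hα hα' (t + 1)
  have hAA : 1 ≤ A ^ 2 := one_le_pow₀ hA1
  have hRR : R ≤ R ^ 2 := by nlinarith
  have h2R : 2 * R ≤ 400 * A ^ 2 * R ^ 2 := by nlinarith
  have hK : (0 : ℝ) ≤ 400 * A ^ 2 * R ^ 2 := by positivity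
  have htT : t ∈ Icc 0 (t + 1) := ⟨ht, by linarith⟩
  have lV : ∀ᶠ N in U, ∀ s ∈ Icc 0 (t + 1), ∀ x ∈ Icc (-1 : ℝ) 1, ∀ y ∈ Icc (-1 : ℝ) 1,
      |dd x * (V N s).eval x - dd y * (V N s).eval y| ≤ 400 * A ^ 2 * R ^ 2 * |x - y| :=
    (hb (t + 1)).mono fun N hN s hs x hx y hy =>
      (lipschitz_dd_mul (hN.v0 s hs) (hN.v1 s hs) x hx y hy).trans
        (mul_le_mul_of_nonneg_right h2R (abs_nonneg _))
  have lP : ∀ᶠ N in U, ∀ s ∈ Icc 0 (t + 1), ∀ x ∈ Icc (-1 : ℝ) 1, ∀ y ∈ Icc (-1 : ℝ) 1,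
      |dd x * (P N s).eval x - dd y * (P N s).eval y| ≤ 400 * A ^ 2 * R ^ 2 * |x - y| :=
    (hb (t + 1)).mono fun N hN s hs x hx y hy =>
      (lipschitz_dd_mul (hN.p0 s hs) (fun x hx => (hN.s s hs x hx).trans (by linarith))
        x hx y hy).trans (mul_le_mul_of_nonneg_right h2R (abs_nonneg _))
  have lA : ∀ᶠ N in U, ∀ s ∈ Icc 0 (t + 1), ∀ x ∈ Icc (-1 : ℝ) 1, ∀ y ∈ Icc (-1 : ℝ) 1,
      |accDens α α' (P N) (V N) s x - accDens α α' (P N) (V N) s y| ≤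
        400 * A ^ 2 * R ^ 2 * |x - y| :=
    (hb (t + 1)).mono fun N hN s hs => lipschitz_accDens hR hA1 hN hs (hA s hs).1 (hA s hs).2.1
  have wk : ∀ q : ℝ[X], ∀ᶠ N in U, (∃ Z, Galerkin α α' N (t + 1) B (P N) (V N) Z) ∧
      CurveBd (t + 1) R (P N) (V N) ∧ q.natDegree ≤ N := fun q =>
    ((h (t + 1)).mono fun N hN => hN.1).and
      ((hb (t + 1)).and (eventually_U q.natDegree fun N hN => hN))
  have tP : ∀ s ∈ Icc 0 (t + 1), ∀ x ∈ Icc (-1 : ℝ) 1,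
      Tendsto (fun N => dd x * (P N s).eval x) U (𝓝 (dd x * lim P s x)) :=
    fun s hs x hx => (h.tendsto hα hs.1 hx).1.const_mul _
  have tV : ∀ s ∈ Icc 0 (t + 1), ∀ x ∈ Icc (-1 : ℝ) 1,
      Tendsto (fun N => dd x * (V N s).eval x) U (𝓝 (dd x * lim V s x)) :=
    fun s hs x hx => (h.tendsto hα hs.1 hx).2.1.const_mul _
  constructor
  · refine hasDerivWithinAt_of_weak (convex_Icc 0 (t + 1)) (A := fun t x => dd x * lim P t x)
      (B := fun t x => dd x * lim V t x) hK lP lV (fun q => ?_) tP tV hx htT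
    filter_upwards [wk q] with N ⟨⟨Z, hZ⟩, hN, hq⟩
    exact ⟨hZ.deriv₁.hasDerivWithinAt_integral hT q,
      (hZ.weak_lipschitz hα hT hR hA1 hA hN q hq).2.1⟩
  · refine hasDerivWithinAt_of_weak (convex_Icc 0 (t + 1)) (A := fun t x => dd x * lim V t x)
      (B := fun t x => -(2 * α' t / α t) * (dd x * lim V t x) -
        (α t ^ 3)⁻¹ * ul fun N => gE (P N t) x) hK lV lA (fun q => ?_) tV
      (fun s hs x hx => ((tV s hs x hx).const_mul _).sub
        ((h.tendsto hα hs.1 hx).2.2.const_mul _)) hx htT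
    filter_upwards [wk q] with N ⟨⟨Z, hZ⟩, hN, hq⟩
    have hw := hZ.weak_lipschitz hα hT hR hA1 hA hN q hq
    exact ⟨hw.1, hw.2.2⟩

lemma Ω₀_subset {x : ℝ} (hx : x ∈ Ω₀) : x ∈ Icc (-1 : ℝ) 1 := Ioo_subset_Icc_self hx

lemma Approx.limit_position (h : Approx α α' B P V) (hα : Scale α α' c) {C : ℝ} (hC1 : 1 ≤ C)
    (hC : ∀ p, StaticBd C p) {t : ℝ} (ht : 0 ≤ t) :
    (∀ k < 6, ∀ x ∈ Ω₀, Tendsto (fun N => (derivative^[k] (P N t)).eval x) U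
      (𝓝 (iteratedDeriv k (lim P t) x))) ∧
    (∀ k, k + 1 < 6 → ∀ x ∈ Ω₀, DifferentiableAt ℝ (iteratedDeriv k (lim P t)) x) ∧
    ∀ k ≤ 6, ∫ x in Ω₀, dd x ^ (1 + k) * iteratedDeriv k (lim P t) x ^ 2 ≤ C * B := by
  have hB := h.nonneg hα
  refine limit_bounds_of_eventually (l := fun k => 1 + k) (M := fun _ => C * B) (by norm_num) ?_
    fun x hx => (h.tendsto hα ht (Ω₀_subset hx)).1
  filter_upwards [h.norms hα ht] with N hN k hk
  rcases hk.lt_or_eq with h6 | rfl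
  · rw [add_comm]
    exact ((hC _).j1 k (by omega)).trans (by gcongr; exact hN.2.1)
  · have h1 := hN.1
    have h2 := N5_nonneg (P N t)
    unfold N6 at h1
    have h3 : J (1 + 6) (derivative^[6] (P N t)) ≤ B := by
      simp only [Nat.reduceAdd]
      linarith
    nlinarith

lemma Approx.limit_velocity (h : Approx α α' B P V) (hα : Scale α α' c) {C : ℝ} (hC1 : 1 ≤ C)
    (hC : ∀ p, StaticBd C p) {t : ℝ} (ht : 0 ≤ t) :
    (∀ k < 5, ∀ x ∈ Ω₀, Tendsto (fun N => (derivative^[k] (V N t)).eval x) U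
      (𝓝 (iteratedDeriv k (lim V t) x))) ∧
    ∀ k ≤ 5, α t ^ 3 * ∫ x in Ω₀, dd x ^ (1 + k) * iteratedDeriv k (lim V t) x ^ 2 ≤ C * B := by
  have ha : 0 < α t ^ 3 := pow_pos (by linarith [hα.one_le t ht]) 3
  have key := limit_bounds_of_eventually (h := fun N => V N t) (f := lim V t) (m := 5)
    (l := fun k => 1 + k) (M := fun _ => C * B / α t ^ 3) (by norm_num)
    (by
      filter_upwards [h.norms hα ht] with N hN k hk
      rw [le_div_iff₀ ha, add_comm]
      calc _ ≤ C * N5 (V N t) * α t ^ 3 := by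
            gcongr
            exact (hC _).j1 k hk
        _ = C * (α t ^ 3 * N5 (V N t)) := by ring
        _ ≤ C * B := by
            gcongr
            exact hN.2.2.2)
    fun x hx => (h.tendsto hα ht (Ω₀_subset hx)).2.1
  refine ⟨key.1, fun k hk => ?_⟩
  rw [mul_comm, ← le_div_iff₀ ha]
  exact key.2.2 k hk

lemma HSq_le_of_tendsto {h : ℕ → ℝ[X]} {f : ℝ → ℝ} {b : ℕ} (hb : b ≤ 3) {C M : ℝ}
    (hC : ∀ k ≤ 2 + b, ∀ p : ℝ[X], J 0 (derivative^[k] (dPol ^ b * p)) ≤ C * N5 p)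
    (hC0 : 0 ≤ C) (hM : ∀ᶠ N in U, N5 (h N) ≤ M)
    (hf : ∀ x ∈ Ω₀, Tendsto (fun N => (h N).eval x) U (𝓝 (f x))) :
    HSq (2 + b) (fun y => dd y ^ b * f y) ≤ 6 * (C * M) := by
  have key := (limit_bounds_of_eventually (h := fun N => dPol ^ b * h N)
    (f := fun y => dd y ^ b * f y) (m := 2 + b) (l := fun _ => 0) (M := fun _ => C * M) (by omega)
    (hM.mono fun N hN k hk => (hC k hk _).trans (by gcongr))
    fun x hx => by
      simp only [eval_mul, eval_pow, eval_dPol]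
      exact (hf x hx).const_mul _).2.2
  simp only [pow_zero, one_mul] at key
  have hCM : 0 ≤ C * M := by
    obtain ⟨N, hN⟩ := hM.exists
    exact mul_nonneg hC0 ((N5_nonneg _).trans hN)
  calc HSq (2 + b) (fun y => dd y ^ b * f y) ≤ ∑ _j ∈ Finset.range (2 + b + 1), C * M :=
        Finset.sum_le_sum fun j hj => key j (by have := Finset.mem_range.1 hj; omega)
    _ = (2 + b + 1 : ℕ) * (C * M) := by simp
    _ ≤ 6 * (C * M) := by
        gcongr
        exact_mod_cast (by omega : 2 + b + 1 ≤ 6)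

lemma W1InfSq_le {f : ℝ → ℝ} {M : ℝ} (h0 : ∀ x ∈ Ω₀, f x ^ 2 ≤ M)
    (h1 : ∀ x ∈ Ω₀, deriv f x ^ 2 ≤ M) : W1InfSq f ≤ 2 * M := by
  have key : ∀ g : ℝ → ℝ, (∀ x ∈ Ω₀, g x ^ 2 ≤ M) → sSup ((fun x => |g x|) '' Ω₀) ^ 2 ≤ M := by
    intro g hg
    have hM : 0 ≤ M := (sq_nonneg _).trans (hg 0 (by constructor <;> norm_num))
    have hs : sSup ((fun x => |g x|) '' Ω₀) ≤ √M := by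
      refine Real.sSup_le ?_ (Real.sqrt_nonneg _)
      rintro _ ⟨x, hx, rfl⟩
      exact Real.abs_le_sqrt (hg x hx)
    have h0 : 0 ≤ sSup ((fun x => |g x|) '' Ω₀) := by
      refine Real.sSup_nonneg ?_
      rintro _ ⟨x, hx, rfl⟩
      exact abs_nonneg _
    calc _ ≤ √M ^ 2 := by gcongr
      _ = M := Real.sq_sqrt hM
  have := key f h0
  have := key _ h1
  unfold W1InfSq
  linarith

lemma W1InfSq_le_of_tendsto {h : ℕ → ℝ[X]} {f : ℝ → ℝ} {C M : ℝ} (hC : ∀ p, StaticBd C p)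
    (hC0 : 0 ≤ C) (hM : ∀ᶠ N in U, N5 (h N) ≤ M)
    (hf : ∀ k < 2, ∀ x ∈ Ω₀, Tendsto (fun N => (derivative^[k] (h N)).eval x) U
      (𝓝 (iteratedDeriv k f x))) :
    W1InfSq f ≤ 2 * (C * M) := by
  have key : ∀ k < 2, ∀ x ∈ Ω₀, iteratedDeriv k f x ^ 2 ≤ C * M := by
    intro k hk x hx
    refine le_of_tendsto ((hf k hk x hx).pow 2) (hM.mono fun N hN => ?_)
    have hN' : C * N5 (h N) ≤ C * M := by gcongr
    interval_cases k
    · exact ((hC _).s0 x (Ω₀_subset hx)).trans hN'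
    · exact ((hC _).s1 x (Ω₀_subset hx)).trans hN'
  refine W1InfSq_le (fun x hx => ?_) fun x hx => ?_
  · simpa using key 0 (by norm_num) x hx
  · simpa [iteratedDeriv_one] using key 1 (by norm_num) x hx

lemma Approx.E2_le (h : Approx α α' B P V) (hα : Scale α α' c) {C D : ℝ} (hC1 : 1 ≤ C)
    (hC : ∀ p, StaticBd C p) (hD0 : 0 ≤ D) (hD : ∀ b ≤ 3, ∀ k ≤ 2 + b, ∀ p : ℝ[X],
      J 0 (derivative^[k] (dPol ^ b * p)) ≤ D * N5 p) {t : ℝ} (ht : 0 ≤ t) :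
    E2 α (fun x t => x + lim P t x) (fun x t => lim V t x) t ≤ (17 * C + 48 * D) * B := by
  have ha : 0 < α t ^ 3 := pow_pos (by linarith [hα.one_le t ht]) 3
  obtain ⟨p1, -, p3⟩ := h.limit_position hα hC1 hC ht
  obtain ⟨v1, v3⟩ := h.limit_velocity hα hC1 hC ht
  have nP : ∀ᶠ N in U, N5 (P N t) ≤ B := (h.norms hα ht).mono fun N hN => hN.2.1
  have nV : ∀ᶠ N in U, N5 (V N t) ≤ B / α t ^ 3 := (h.norms hα ht).mono fun N hN => by
    rw [le_div_iff₀ ha, mul_comm]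
    exact hN.2.2.2
  have scale : ∀ {X K : ℝ}, X ≤ K * (B / α t ^ 3) → α t ^ 3 * X ≤ K * B := fun {X K} hX => by
    calc α t ^ 3 * X ≤ α t ^ 3 * (K * (B / α t ^ 3)) := by gcongr
      _ = K * B := by rw [mul_left_comm, mul_div_cancel₀ _ ha.ne']
  have w1 : α t ^ 3 * W1InfSq (lim V t) ≤ 2 * C * B := scale ((W1InfSq_le_of_tendsto
    (h := fun N => V N t) hC (by linarith) nV fun k hk => v1 k (by omega)).trans
      (by rw [mul_assoc]))
  have w2 : W1InfSq (lim P t) ≤ 2 * (C * B) := W1InfSq_le_of_tendsto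
    (h := fun N => P N t) hC (by linarith) nP fun k hk => p1 k (by omega)
  have s1 : ∀ b ∈ Finset.range 4, α t ^ 3 * HSq (2 + b) (fun y => dd y ^ b * lim V t y) +
      HSq (2 + b) (fun y => dd y ^ b * lim P t y) ≤ 12 * D * B := by
    intro b hb
    have hb : b ≤ 3 := by have := Finset.mem_range.1 hb; omega
    have e1 : α t ^ 3 * HSq (2 + b) (fun y => dd y ^ b * lim V t y) ≤ 6 * D * B :=
      scale ((HSq_le_of_tendsto (h := fun N => V N t) hb (hD b hb) hD0 nV
        fun x hx => (h.tendsto hα ht (Ω₀_subset hx)).2.1).trans (by rw [mul_assoc]))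
    have e2 : HSq (2 + b) (fun y => dd y ^ b * lim P t y) ≤ 6 * (D * B) :=
      HSq_le_of_tendsto (h := fun N => P N t) hb (hD b hb) hD0 nP
        fun x hx => (h.tendsto hα ht (Ω₀_subset hx)).1
    linarith
  have s2 : ∀ b ∈ Finset.range 6,
      (α t ^ 3 * ∫ x in Ω₀, dd x ^ (1 + b) * iteratedDeriv b (lim V t) x ^ 2) +
        ∫ x in Ω₀, dd x ^ (1 + b) * iteratedDeriv b (lim P t) x ^ 2 ≤ 2 * (C * B) := by
    intro b hb
    have hb : b < 6 := Finset.mem_range.1 hb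
    linarith [v3 b (by omega), p3 b (by omega)]
  have t1 := Finset.sum_le_sum s1
  have t2 := Finset.sum_le_sum s2
  have t3 := p3 6 le_rfl
  simp only [Finset.sum_const, Finset.card_range, nsmul_eq_mul, Nat.cast_ofNat] at t1 t2
  unfold E2 e2
  simp only [add_sub_cancel_left]
  simp only [Nat.reduceAdd] at t3
  change _ + _ + α t ^ 3 * W1InfSq (lim V t) + W1InfSq (lim P t) + _ ≤ _
  linarith

end

lemma contDiffOn_two {f : ℝ → ℝ} (h : ∀ k < 3, ∀ x ∈ Ω₀, DifferentiableAt ℝ (iteratedDeriv k f) x) :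
    ContDiffOn ℝ 2 f Ω₀ := by
  have key : ∀ k ≤ 3, ∀ x ∈ Ω₀, iteratedDerivWithin k f Ω₀ x = iteratedDeriv k f x := by
    intro k
    induction k with
    | zero => intro _ x _; simp
    | succ k ih =>
      intro hk x hx
      rw [iteratedDerivWithin_succ, iteratedDeriv_succ,
        derivWithin_congr (ih (by omega)) (ih (by omega) x hx)]
      exact derivWithin_of_isOpen isOpen_Ioo hx
  refine contDiffOn_of_differentiableOn_deriv fun k hk => ?_
  have hk2 : k ≤ 2 := by exact_mod_cast hk
  have hd : DifferentiableOn ℝ (iteratedDeriv k f) Ω₀ :=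
    fun x hx => (h k (by omega) x hx).differentiableWithinAt
  exact hd.congr (key k (by omega))

lemma deriv_dd (x : ℝ) : deriv dd x = -x / 2 := (hasDerivAt_dd x).deriv

section
variable {α α' : ℝ → ℝ} {c B : ℝ} {P V : ℕ → ℝ → ℝ[X]}

lemma Approx.abs_deriv_le (h : Approx α α' B P V) {t x : ℝ} (ht : 0 ≤ t) (hx : x ∈ Ω₀)
    (h1 : Tendsto (fun N => (derivative^[1] (P N t)).eval x) U
      (𝓝 (iteratedDeriv 1 (lim P t) x))) : |iteratedDeriv 1 (lim P t) x| ≤ 1 / 2 :=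
  le_of_tendsto h1.abs ((h t).mono fun _ hN => hN.2 t ⟨ht, le_rfl⟩ x (Ω₀_subset hx))

lemma Approx.force_eq (h : Approx α α' B P V) (hα : Scale α α' c) {t x : ℝ} (ht : 0 ≤ t)
    (hx : x ∈ Ω₀)
    (hP : ∀ k < 3, Tendsto (fun N => (derivative^[k] (P N t)).eval x) U
      (𝓝 (iteratedDeriv k (lim P t) x))) :
    ul (fun N => gE (P N t) x) = dd x * (lim P t x +
      (dd x * (-2 * (1 + iteratedDeriv 1 (lim P t) x)⁻¹ ^ 3 * iteratedDeriv 2 (lim P t) x) -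
        x * ((1 + iteratedDeriv 1 (lim P t) x)⁻¹ ^ 2 - 1))) := by
  have hx' := Ω₀_subset hx
  obtain ⟨t0, -, tg⟩ := h.tendsto hα ht hx'
  have h1 := (abs_le.1 (h.abs_deriv_le ht hx (hP 1 (by norm_num)))).1
  have ty : Tendsto (fun N => yv (P N t) x) U (𝓝 (1 + iteratedDeriv 1 (lim P t) x)⁻¹) :=
    ((hP 1 (by norm_num)).const_add 1).inv₀ (by linarith)
  refine tendsto_nhds_unique tg ?_
  simp only [gE_eq]
  exact (t0.add (((((ty.pow 3).const_mul (-2)).mul (hP 2 (by norm_num))).const_mul _).sub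
    (((ty.pow 2).sub_const 1).const_mul _))).const_mul _

lemma Approx.hasDerivWithinAt (h : Approx α α' B P V) (hα : Scale α α' c)
    (hα' : ∀ t ∈ Ici (0 : ℝ), HasDerivWithinAt α' ((α t ^ 2)⁻¹) (Ici 0) t)
    {t x : ℝ} (ht : 0 ≤ t) (hx : x ∈ Ω₀) :
    HasDerivWithinAt (fun t => lim P t x) (lim V t x) (Ici 0) t ∧
    HasDerivWithinAt (fun t => lim V t x) (-(2 * α' t / α t) * lim V t x -
      (α t ^ 3)⁻¹ * ((dd x)⁻¹ * ul fun N => gE (P N t) x)) (Ici 0) t := by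
  have hd : dd x ≠ 0 := (dd_pos hx).ne'
  have hn : Icc 0 (t + 1) ∈ 𝓝[Ici 0] t :=
    inter_mem_nhdsWithin _ (Iic_mem_nhds (by linarith))
  obtain ⟨h1, h2⟩ := h.hasDerivWithinAt_dd hα hα' ht (Ω₀_subset hx)
  have e1 := (h1.mono_of_mem_nhdsWithin hn).const_mul (dd x)⁻¹
  have e2 := (h2.mono_of_mem_nhdsWithin hn).const_mul (dd x)⁻¹
  simp only [inv_mul_cancel_left₀ hd] at e1 e2
  refine ⟨e1, e2.congr_deriv ?_⟩
  field_simp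

lemma Approx.isSol2 (h : Approx α α' B P V) (hα : Scale α α' c)
    (hα' : ∀ t ∈ Ici (0 : ℝ), HasDerivWithinAt α' ((α t ^ 2)⁻¹) (Ici 0) t) :
    IsSol2 α α' (fun x t => x + lim P t x) (fun x t => lim V t x) := by
  obtain ⟨C, hC1, hC⟩ := exists_staticBd
  have p1 := fun (t : ℝ) (ht : 0 ≤ t) => (h.limit_position hα hC1 hC ht).1
  have p2 := fun (t : ℝ) (ht : 0 ≤ t) => (h.limit_position hα hC1 hC ht).2.1
  have d1 : ∀ t ≥ (0 : ℝ), ∀ x ∈ Ω₀, HasDerivAt (fun y => y + lim P t y)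
      (1 + iteratedDeriv 1 (lim P t) x) x := by
    intro t ht x hx
    have := (p2 t ht 0 (by norm_num) x hx).hasDerivAt
    rw [iteratedDeriv_zero, ← iteratedDeriv_one] at this
    exact (hasDerivAt_id x).add this
  have d2 : ∀ t ≥ (0 : ℝ), ∀ x ∈ Ω₀, iteratedDeriv 2 (fun y => y + lim P t y) x =
      iteratedDeriv 2 (lim P t) x := by
    intro t ht x hx
    have he : deriv (fun y => y + lim P t y) =ᶠ[𝓝 x] fun y => 1 + iteratedDeriv 1 (lim P t) y :=
      Filter.eventually_of_mem (isOpen_Ioo.mem_nhds hx) fun y hy => (d1 t ht y hy).deriv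
    rw [iteratedDeriv_succ, iteratedDeriv_one, he.deriv_eq, iteratedDeriv_succ (n := 1),
      deriv_const_add]
  have hs := fun t ht x hx => h.abs_deriv_le ht hx (p1 t ht 1 (by norm_num) x hx)
  have dt := fun t (ht : 0 ≤ t) x hx => h.hasDerivWithinAt hα hα' ht (x := x) hx
  refine ⟨fun t ht => ?_, fun x hx t ht => ?_, fun x hx t ht => (dt t ht x hx).1.const_add x,
    fun x hx t ht => ((dt t ht.le x hx).2.hasDerivAt (Ici_mem_nhds ht)).differentiableAt,
    fun x hx t ht => ?_⟩
  · exact contDiffOn_id.add (contDiffOn_two fun k hk => p2 t ht k (by omega))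
  · rw [(d1 t ht x hx).deriv]
    linarith [(abs_le.1 (hs t ht x hx)).1]
  · have ha : α t ≠ 0 := by linarith [hα.one_le t ht.le]
    have hd : dd x ≠ 0 := (dd_pos hx).ne'
    have hy : 1 + iteratedDeriv 1 (lim P t) x ≠ 0 := by linarith [(abs_le.1 (hs t ht.le x hx)).1]
    rw [((dt t ht.le x hx).2.hasDerivAt (Ici_mem_nhds ht)).deriv, (d1 t ht.le x hx).deriv,
      d2 t ht.le x hx, deriv_dd, h.force_eq hα ht.le hx fun k hk => p1 t ht.le k (by omega) x hx,
      inv_mul_cancel_left₀ hd]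
    field_simp
    ring

lemma Approx.initial (h : Approx α α' B P V) (hα : Scale α α' c) {u : ℝ → ℝ}
    (hu : ContinuousOn u (Icc (-1) 1))
    (hV : ∀ q : ℝ[X], ∀ᶠ N in U, ∫ x in (-1 : ℝ)..1, dd x * ((V N 0).eval x * q.eval x) =
        ∫ x in (-1 : ℝ)..1, dd x * (u x * q.eval x)) :
    ∀ x ∈ Ω₀, lim P 0 x = 0 ∧ lim V 0 x = u x := by
  intro x hx
  have hx' := Ω₀_subset hx
  constructor
  · refine tendsto_nhds_unique (h.tendsto hα le_rfl hx').1 (tendsto_const_nhds.congr' ?_)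
    filter_upwards [h 0] with N ⟨⟨Z, hZ⟩, _⟩
    rw [hZ.init, eval_zero]
  · obtain ⟨R, hR, hb⟩ := h.curveBd hα
    have h0 : (0 : ℝ) ∈ Icc (0 : ℝ) 0 := by simp
    have lV : ∀ᶠ N in U, ∀ x ∈ Icc (-1 : ℝ) 1, ∀ y ∈ Icc (-1 : ℝ) 1,
        |dd x * (V N 0).eval x - dd y * (V N 0).eval y| ≤ 2 * R * |x - y| :=
      (hb 0).mono fun N hN => lipschitz_dd_mul (hN.v0 0 h0) (hN.v1 0 h0)
    have tV : ∀ x ∈ Icc (-1 : ℝ) 1,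
        Tendsto (fun N => dd x * (V N 0).eval x) U (𝓝 (dd x * lim V 0 x)) :=
      fun x hx => (h.tendsto hα le_rfl hx).2.1.const_mul _
    have c1 : ContinuousOn (fun x => dd x * lim V 0 x) (Icc (-1) 1) :=
      continuousOn_of_lipschitz (lipschitz_limit lV tV)
    have c2 : ContinuousOn (fun x => dd x * u x) (Icc (-1) 1) := continuous_dd.continuousOn.mul hu
    have key := abs_le_of_integral_le (e := fun x => dd x * lim V 0 x - dd x * u x) (c1.sub c2)
      le_rfl (fun q => by
        simp only [sub_mul]
        rw [intervalIntegral.integral_sub (integrable_mul_poly c1 q) (integrable_mul_poly c2 q),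
          zero_mul, abs_nonpos_iff, sub_eq_zero]
        refine tendsto_nhds_unique (tendsto_integral lV tV q) (tendsto_const_nhds.congr' ?_)
        filter_upwards [hV q] with N hN
        simp only [← mul_assoc] at hN
        exact hN.symm) hx'
    rw [abs_nonpos_iff, ← mul_sub, mul_eq_zero, sub_eq_zero] at key
    exact key.resolve_left (dd_pos hx).ne'

end

lemma HSq_nonneg (n : ℕ) (f : ℝ → ℝ) : 0 ≤ HSq n f :=
  Finset.sum_nonneg fun _ _ => integral_nonneg fun _ => sq_nonneg _

lemma W1InfSq_nonneg (f : ℝ → ℝ) : 0 ≤ W1InfSq f := by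
  unfold W1InfSq
  positivity

lemma setIntegral_weight_nonneg (n : ℕ) (f : ℝ → ℝ) : 0 ≤ ∫ x in Ω₀, dd x ^ n * f x ^ 2 :=
  setIntegral_nonneg measurableSet_Ioo fun _ hx =>
    mul_nonneg (pow_nonneg (dd_pos hx).le n) (sq_nonneg _)

lemma W1InfSq_le_E2 {α : ℝ → ℝ} {η v : ℝ → ℝ → ℝ} {t : ℝ} (ha : 0 ≤ α t) :
    α t ^ 3 * W1InfSq (fun y => v y t) ≤ E2 α η v t := by
  have ha3 : 0 ≤ α t ^ 3 := pow_nonneg ha 3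
  have h1 : 0 ≤ e2 α η v t := add_nonneg (setIntegral_weight_nonneg _ _)
    (Finset.sum_nonneg fun b _ => add_nonneg (mul_nonneg ha3 (setIntegral_weight_nonneg _ _))
      (setIntegral_weight_nonneg _ _))
  have h2 : 0 ≤ W1InfSq (fun y => η y t - y) := W1InfSq_nonneg _
  have h3 : 0 ≤ ∑ b ∈ Finset.range 4, (α t ^ 3 * HSq (2 + b) (fun y => dd y ^ b * v y t) +
      HSq (2 + b) (fun y => dd y ^ b * (η y t - y))) :=
    Finset.sum_nonneg fun b _ => add_nonneg (mul_nonneg ha3 (HSq_nonneg _ _)) (HSq_nonneg _ _)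
  unfold E2
  linarith

lemma sqrt_le_of_mul_le {a w M : ℝ} (ha : 0 < a) (h : a ^ 3 * w ≤ M) :
    √w ≤ √M * a ^ (-(3 : ℝ) / 2) := by
  have ha3 : 0 < a ^ 3 := pow_pos ha 3
  have e : a ^ (-(3 : ℝ) / 2) = √((a ^ 3)⁻¹) := by
    rw [Real.sqrt_eq_rpow, ← Real.rpow_natCast, ← Real.rpow_neg ha.le, ← Real.rpow_mul ha.le]
    norm_num
  rw [e, ← Real.sqrt_mul' _ (inv_nonneg.2 ha3.le)]
  refine Real.sqrt_le_sqrt ?_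
  rw [← div_eq_mul_inv, le_div_iff₀ ha3]
  linarith

end Shallow

/-- Global existence for the 1-d compressible Euler equations with `γ = 2` (shallow water):
small data `u₀` yield a global solution of the perturbation system with `E₂(t) ≤ Cε` and
decay `‖v(·,t)‖_{W^{1,∞}} ≤ (Cε)^{1/2} α(t)^{−3/2}`. -/
theorem stmt17 (α α' : ℝ → ℝ)
    (hαpos : ∀ t ∈ Ici (0 : ℝ), 0 < α t)
    (hα : ∀ t ∈ Ici (0 : ℝ), HasDerivWithinAt α (α' t) (Ici 0) t)
    (hα' : ∀ t ∈ Ici (0 : ℝ), HasDerivWithinAt α' ((α t ^ 2)⁻¹) (Ici 0) t)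
    (hα0 : α 0 = 1) (hα'0 : 0 ≤ α' 0) :
    ∃ ε₀ > (0 : ℝ), ∃ C ≥ (1 : ℝ),
      ∀ ε : ℝ, 0 < ε → ε ≤ ε₀ →
      ∀ u₀ : ℝ → ℝ, (∀ n : ℕ, ContDiffOn ℝ n u₀ (Icc (-1) 1)) →
      (∑ b ∈ Finset.range 6,
          ∫ x in Ω₀, dd x ^ (1 + b) * (iteratedDeriv b u₀ x) ^ 2) < ε →
      ∃ η v : ℝ → ℝ → ℝ,
        IsSol2 α α' η v ∧
        (∀ x ∈ Ω₀, η x 0 = x ∧ v x 0 = u₀ x) ∧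
        (∀ t ∈ Ici (0 : ℝ), E2 α η v t ≤ C * ε) ∧
        (∀ t ∈ Ici (0 : ℝ),
          Real.sqrt (W1InfSq (fun y => v y t)) ≤
            Real.sqrt (C * ε) * α t ^ (-(3 : ℝ) / 2)) := by
  open Shallow in
  obtain ⟨c, hS⟩ := exists_scale hαpos hα hα' hα0 hα'0
  obtain ⟨δ, hδ, hsmall, hcurve⟩ := exists_galerkin_curve hS
  obtain ⟨C, hC1, hC⟩ := exists_staticBd
  obtain ⟨D, hD1, hD⟩ := exists_energyBdd_iterate
  refine ⟨δ / 12, by positivity, 6 * (17 * C + 48 * D), by linarith,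
    fun ε hε hε₀ u₀ hu₀ hsum => ?_⟩
  choose w hwdeg hwproj hwN using fun N => exists_projection hu₀ N
  have hwε : ∀ N, N5 (w N) ≤ ε := fun N => (hwN N).trans hsum.le
  choose P V Z hG hV0 using fun N : ℕ =>
    hcurve N N (w N) (Nat.cast_nonneg N) (hwdeg N) (by linarith [hwε N])
  have happrox : Approx α α' (6 * ε) P V := by
    intro T
    filter_upwards [eventually_U ⌈T⌉₊ fun N hN => (Nat.le_of_ceil_le hN : T ≤ N)] with N hN
    have hg := (hG N).mono hN
    refine ⟨⟨Z N, { hg with bound := fun t ht => (hg.bound t ht).trans ?_ }⟩,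
      fun t ht => hsmall _ ?_⟩
    · linarith [hwε N]
    · exact (le_of_Bq_le (hS.one_le t ht.1) (hg.bound t ht)).1.trans (by linarith [hwε N])
  have hE : ∀ t ∈ Ici (0 : ℝ), E2 α (fun x t => x + lim P t x) (fun x t => lim V t x) t ≤
      6 * (17 * C + 48 * D) * ε := fun t ht =>
    (happrox.E2_le hS hC1 hC (by linarith) hD ht).trans_eq (by ring)
  have hinit := happrox.initial hS (hu₀ 0).continuousOn fun q =>
    eventually_U q.natDegree fun N hN => by rw [hV0 N]; exact hwproj N q hN
  exact ⟨_, _, happrox.isSol2 hS hα', fun x hx => ⟨by simp [(hinit x hx).1], (hinit x hx).2⟩, hE,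
    fun t ht => sqrt_le_of_mul_le (hαpos t ht) ((W1InfSq_le_E2 (hαpos t ht).le).trans (hE t ht))⟩
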